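/- Let k be a number field with r₁ real places and r₂ complex places, and suppose [k:ℚ] > 10⁵. Then D_k ≥ 55^{r₁}·21^{2r₂}, where D_k is the absolute value of the discriminant of k. -/

import Mathlib

open NumberField

open MeasureTheory Module
open scoped Pointwise Matrix ENNReal

noncomputable section

section ZSpanUnfolding

variable {κ E : Type*} [Fintype κ] [NormedAddCommGroup E] [NormedSpace ℝ E]

/-- The `ℤ`-span of an `ℝ`-basis, parametrised by integer coordinate vectors. -/
def intCoordEquiv (e : Basis κ ℝ E) :
    (κ → ℤ) ≃ Submodule.span ℤ (Set.range e) :=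
  (e.restrictScalars ℤ).equivFun.symm.toEquiv

lemma intCoordEquiv_coe (e : Basis κ ℝ E) (m : κ → ℤ) :
    (intCoordEquiv e m : E) = ∑ i, m i • e i := by
  simp [intCoordEquiv, Basis.equivFun_symm_apply]

variable [MeasurableSpace E] [BorelSpace E]

lemma hasSum_setIntegral_fundamentalDomain (e : Basis κ ℝ E) (μ : Measure E)
    [μ.IsAddHaarMeasure] {F : Type*} [NormedAddCommGroup F] [NormedSpace ℝ F]
    {f : E → F} (hf : Integrable f μ) :
    HasSum (fun m : κ → ℤ ↦ ∫ x in ZSpan.fundamentalDomain e, f (x + ∑ i, m i • e i) ∂μ)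
      (∫ x, f x ∂μ) := by
  have hD := ZSpan.isAddFundamentalDomain e μ
  have : FiniteDimensional ℝ E := e.finiteDimensional_of_finite
  have : VAddInvariantMeasure (Submodule.span ℤ (Set.range e)) E μ :=
    inferInstanceAs <| VAddInvariantMeasure (Submodule.span ℤ (Set.range e)).toAddSubgroup E μ
  have hs := hD.sum_restrict
  have h1 := hasSum_integral_measure (f := f)
    (μ := fun g : Submodule.span ℤ (Set.range e) ↦
      μ.restrict (g +ᵥ ZSpan.fundamentalDomain e)) (by rwa [hs])
  rw [hs] at h1
  rw [← (intCoordEquiv e).hasSum_iff] at h1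
  convert h1 using 2 with m
  simp only [Function.comp_apply]
  rw [← Set.image_vadd, (measurePreserving_vadd (intCoordEquiv e m) μ).setIntegral_image_emb
    (measurableEmbedding_const_vadd _)]
  refine integral_congr_ae (Filter.Eventually.of_forall fun x ↦ ?_)
  simp only [Submodule.vadd_def, vadd_eq_add, intCoordEquiv_coe]
  rw [add_comm]

end ZSpanUnfolding

section GaussianSums

variable {ι : Type*} [Fintype ι]

lemma summable_exp_neg_norm_sq {c : ℝ} (hc : 0 < c) :
    Summable fun m : ι → ℤ ↦ Real.exp (-c * ‖(fun i ↦ (m i : ℝ))‖ ^ 2) := by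
  classical
  let e := Pi.basisFun ℝ ι
  let L := Submodule.span ℤ (Set.range e)
  set N := finrank ℤ L + 1 with hN
  have h1 := ZLattice.summable_norm_pow_inv L (2 * N) (by omega)
  rw [← (intCoordEquiv e).summable_iff] at h1
  have hval : ∀ m : ι → ℤ, ‖intCoordEquiv e m‖ = ‖(fun i ↦ (m i : ℝ))‖ := by
    intro m
    rw [Submodule.coe_norm, intCoordEquiv_coe]
    congr 1
    ext j
    simp [e, Pi.single_apply]
  refine Summable.of_norm_bounded_eventually (h1.mul_left (N.factorial / c ^ N)) ?_
  rw [Filter.eventually_cofinite]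
  refine (Set.finite_singleton (0 : ι → ℤ)).subset fun m hm ↦ ?_
  by_contra h0
  apply hm
  simp only [Function.comp_apply, hval]
  set r := ‖(fun i ↦ (m i : ℝ))‖ with hr
  have hrpos : 0 < r := by
    rw [hr, norm_pos_iff]
    intro h
    apply h0
    ext i
    simpa using congr_fun h i
  rw [Real.norm_of_nonneg (Real.exp_pos _).le, neg_mul, Real.exp_neg]
  have h2 := Real.pow_div_factorial_le_exp (c * r ^ 2) (by positivity) N
  calc (Real.exp (c * r ^ 2))⁻¹ ≤ ((c * r ^ 2) ^ N / N.factorial)⁻¹ := by gcongr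
    _ = N.factorial / c ^ N * r⁻¹ ^ (2 * N) := by
      rw [inv_div, mul_pow, ← pow_mul, inv_pow]
      field_simp

end GaussianSums

section GaussianPoisson

variable {ι : Type*} [Fintype ι] [DecidableEq ι]

/-- A nondegenerate sum of squares dominates a multiple of the squared sup norm. -/
lemma exists_mul_norm_sq_le_sum_mulVec_sq {B : Matrix ι ι ℝ} (hB : B.det ≠ 0) :
    ∃ c : ℝ, 0 < c ∧ ∀ x : ι → ℝ, c * ‖x‖ ^ 2 ≤ ∑ i, (B *ᵥ x) i ^ 2 := by
  obtain ⟨C, hC0, hC⟩ := (Matrix.mulVecLin B⁻¹).toContinuousLinearMap.isBoundedLinearMap.bound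
  refine ⟨1 / C ^ 2, by positivity, fun x ↦ ?_⟩
  have h1 : ‖x‖ ≤ C * ‖B *ᵥ x‖ := by
    have := hC (B *ᵥ x)
    simpa [Matrix.mulVec_mulVec, Matrix.nonsing_inv_mul B (isUnit_iff_ne_zero.mpr hB)] using this
  have h2 : ‖B *ᵥ x‖ ^ 2 ≤ ∑ i, (B *ᵥ x) i ^ 2 := by
    have h3 : ‖B *ᵥ x‖ ≤ √(∑ i, (B *ᵥ x) i ^ 2) := by
      rw [pi_norm_le_iff_of_nonneg (Real.sqrt_nonneg _)]
      intro i
      rw [Real.norm_eq_abs, ← Real.sqrt_sq_eq_abs]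
      exact Real.sqrt_le_sqrt (Finset.single_le_sum (f := fun i ↦ (B *ᵥ x) i ^ 2)
        (fun j _ ↦ sq_nonneg _) (Finset.mem_univ i))
    calc ‖B *ᵥ x‖ ^ 2 ≤ √(∑ i, (B *ᵥ x) i ^ 2) ^ 2 := by gcongr
      _ = _ := Real.sq_sqrt (Finset.sum_nonneg fun i _ ↦ sq_nonneg _)
  calc 1 / C ^ 2 * ‖x‖ ^ 2 ≤ 1 / C ^ 2 * (C * ‖B *ᵥ x‖) ^ 2 := by gcongr
    _ = ‖B *ᵥ x‖ ^ 2 := by field_simp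
    _ ≤ _ := h2

/-- The Gaussian attached to the quadratic form `x ↦ |B x|²`. -/
def matrixGaussian (B : Matrix ι ι ℝ) (x : ι → ℝ) : ℂ :=
  Complex.exp (-Real.pi * ∑ i, ((B *ᵥ x) i : ℂ) ^ 2)

omit [DecidableEq ι] in
lemma norm_matrixGaussian (B : Matrix ι ι ℝ) (x : ι → ℝ) :
    ‖matrixGaussian B x‖ = Real.exp (-Real.pi * ∑ i, (B *ᵥ x) i ^ 2) := by
  rw [matrixGaussian, Complex.norm_exp]
  congr 1
  norm_cast

omit [DecidableEq ι] in
lemma continuous_matrixGaussian (B : Matrix ι ι ℝ) : Continuous (matrixGaussian B) := by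
  unfold matrixGaussian
  have h : Continuous fun x : ι → ℝ ↦ B *ᵥ x := (Matrix.mulVecLin B).continuous_of_finiteDimensional
  have h' : ∀ i, Continuous fun x : ι → ℝ ↦ (B *ᵥ x) i := fun i ↦ (continuous_apply i).comp h
  fun_prop

lemma integral_matrixGaussian_mul_exp {B : Matrix ι ι ℝ} (hB : B.det ≠ 0) (n : ι → ℝ) :
    Integrable (fun x ↦ Complex.exp (-2 * Real.pi * Complex.I * ∑ i, n i * x i)
      * matrixGaussian B x) ∧
    ∫ x, Complex.exp (-2 * Real.pi * Complex.I * ∑ i, n i * x i) * matrixGaussian B x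
      = |B.det|⁻¹ * matrixGaussian (B⁻¹)ᵀ n := by
  set w := (B⁻¹)ᵀ *ᵥ n with hw
  let g : (ι → ℝ) → ℂ := fun u ↦
    Complex.exp (-(Real.pi : ℂ) * ∑ i, (u i : ℂ) ^ 2 + ∑ i, (-2 * Real.pi * Complex.I * w i) * u i)
  have hfg : (fun x ↦ Complex.exp (-2 * Real.pi * Complex.I * ∑ i, n i * x i)
      * matrixGaussian B x) = fun x ↦ g (Matrix.toLin' B x) := by
    ext x
    simp only [g, matrixGaussian, ← Complex.exp_add, Matrix.toLin'_apply]
    rw [add_comm]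
    congr 2
    simp only [mul_assoc, ← Finset.mul_sum]
    congr 4
    have : w ⬝ᵥ (B *ᵥ x) = n ⬝ᵥ x := by
      rw [hw, Matrix.mulVec_transpose, ← Matrix.dotProduct_mulVec, Matrix.mulVec_mulVec,
        Matrix.nonsing_inv_mul B (isUnit_iff_ne_zero.mpr hB), Matrix.one_mulVec]
    simp only [dotProduct] at this
    exact_mod_cast this.symm
  have hmap := Real.map_matrix_volume_pi_eq_smul_volume_pi hB
  have hemb : MeasurableEmbedding (Matrix.toLin' B) := by
    refine (LinearMap.isClosedEmbedding_of_injective ?_).measurableEmbedding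
    rw [LinearMap.ker_eq_bot]
    exact Matrix.mulVec_injective_of_isUnit ((Matrix.isUnit_iff_isUnit_det B).mpr
      (isUnit_iff_ne_zero.mpr hB))
  have hg : Integrable g := GaussianFourier.integrable_cexp_neg_mul_sum_add
    (by simpa using Real.pi_pos) _
  rw [hfg]
  constructor
  · have : Integrable g (Measure.map (Matrix.toLin' B) volume) := by
      rw [hmap]
      exact hg.smul_measure ENNReal.ofReal_ne_top
    exact (hemb.integrable_map_iff).mp this
  · rw [← hemb.integral_map, hmap, integral_smul_measure, ENNReal.toReal_ofReal (abs_nonneg _)]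
    have := GaussianFourier.integral_cexp_neg_mul_sum_add (b := (Real.pi : ℂ))
      (by simpa using Real.pi_pos) (fun i ↦ -2 * Real.pi * Complex.I * w i)
    rw [this, div_self (by exact_mod_cast Real.pi_ne_zero), Complex.one_cpow, one_mul,
      Complex.real_smul, abs_inv]
    push_cast
    congr 1
    rw [matrixGaussian]
    congr 1
    have hpi : (Real.pi : ℂ) ≠ 0 := by exact_mod_cast Real.pi_ne_zero
    rw [Finset.sum_div, Finset.mul_sum]
    refine Finset.sum_congr rfl fun i _ ↦ ?_
    rw [mul_pow, mul_pow, mul_pow, Complex.I_sq, ← hw]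
    field_simp
    ring

lemma summable_matrixGaussian {B : Matrix ι ι ℝ} (hB : B.det ≠ 0) :
    Summable fun m : ι → ℤ ↦ matrixGaussian B (fun i ↦ (m i : ℝ)) := by
  obtain ⟨c, hc, h⟩ := exists_mul_norm_sq_le_sum_mulVec_sq hB
  refine Summable.of_norm_bounded (summable_exp_neg_norm_sq (mul_pos Real.pi_pos hc)) fun m ↦ ?_
  rw [norm_matrixGaussian, neg_mul, neg_mul, mul_assoc]
  gcongr
  exact h _

lemma continuous_tsum_matrixGaussian {B : Matrix ι ι ℝ} (hB : B.det ≠ 0) :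
    Continuous fun x : ι → ℝ ↦ ∑' m : ι → ℤ, matrixGaussian B (x + fun i ↦ (m i : ℝ)) := by
  obtain ⟨c, hc, h⟩ := exists_mul_norm_sq_le_sum_mulVec_sq hB
  rw [continuous_iff_continuousAt]
  intro x₀
  have hs := (summable_exp_neg_norm_sq (ι := ι)
    (show 0 < Real.pi * c / 2 by have := Real.pi_pos; positivity)).mul_left
      (Real.exp (Real.pi * c * (‖x₀‖ + 1) ^ 2))
  refine (continuousOn_tsum (s := Metric.ball x₀ 1) (fun m ↦ ?_) hs (fun m x hx ↦ ?_)).continuousAt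
    (Metric.ball_mem_nhds _ one_pos)
  · exact ((continuous_matrixGaussian B).comp (continuous_id.add continuous_const)).continuousOn
  · rw [norm_matrixGaussian, ← Real.exp_add]
    gcongr
    set k : ι → ℝ := fun i ↦ (m i : ℝ)
    have h1 := h (x + k)
    have hx' : ‖x‖ ≤ ‖x₀‖ + 1 := by
      have h2 := mem_ball_iff_norm.mp hx
      linarith [norm_le_norm_add_norm_sub' x x₀]
    have h3 : ‖k‖ ≤ ‖x + k‖ + (‖x₀‖ + 1) := by
      have : ‖k‖ ≤ ‖x + k‖ + ‖x‖ := by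
        simpa using norm_sub_le (x + k) x
      linarith
    have h4 : ‖k‖ ^ 2 / 2 ≤ ‖x + k‖ ^ 2 + (‖x₀‖ + 1) ^ 2 := by
      have : ‖k‖ ^ 2 ≤ (‖x + k‖ + (‖x₀‖ + 1)) ^ 2 := by gcongr
      nlinarith [sq_nonneg (‖x + k‖ - (‖x₀‖ + 1))]
    have h5 : c * (‖k‖ ^ 2 / 2) ≤ ∑ i, (B *ᵥ (x + k)) i ^ 2 + c * (‖x₀‖ + 1) ^ 2 := by
      have := mul_le_mul_of_nonneg_left h4 hc.le
      linarith
    have := mul_le_mul_of_nonneg_left h5 Real.pi_pos.le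
    linarith

end GaussianPoisson

section GaussianPoisson

variable {ι : Type*} [Fintype ι] [DecidableEq ι]

omit [DecidableEq ι] in
lemma mFourier_coe_apply (n : ι → ℤ) (x : ι → ℝ) :
    UnitAddTorus.mFourier n (fun i ↦ (x i : UnitAddCircle)) =
      Complex.exp (2 * Real.pi * Complex.I * ∑ i, (n i : ℂ) * x i) := by
  simp only [UnitAddTorus.mFourier, ContinuousMap.coe_mk, fourier_coe_apply]
  rw [← Complex.exp_sum, Finset.mul_sum]
  congr 1
  refine Finset.sum_congr rfl fun i _ ↦ ?_
  push_cast
  ring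

omit [DecidableEq ι] in
lemma setIntegral_unitBox_tsum {f : (ι → ℝ) → ℂ} (hintegr : Integrable f) :
    ∫ x in {x : ι → ℝ | ∀ i, x i ∈ Set.Ioc ((0 : ι → ℝ) i) ((0 : ι → ℝ) i + 1)},
      ∑' m : ι → ℤ, f (x + fun i ↦ (m i : ℝ)) = ∫ x, f x := by
  classical
  let e := Pi.basisFun ℝ ι
  have hbox : {x : ι → ℝ | ∀ i, x i ∈ Set.Ioc ((0 : ι → ℝ) i) ((0 : ι → ℝ) i + 1)}
      =ᵐ[volume] ZSpan.fundamentalDomain e := by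
    have h1 : {x : ι → ℝ | ∀ i, x i ∈ Set.Ioc ((0 : ι → ℝ) i) ((0 : ι → ℝ) i + 1)} =
        Set.univ.pi fun i ↦ Set.Ioc ((0 : ι → ℝ) i) ((1 : ι → ℝ) i) := by ext; simp
    have h2 : ZSpan.fundamentalDomain e =
        Set.univ.pi fun i ↦ Set.Ico ((0 : ι → ℝ) i) ((1 : ι → ℝ) i) := by
      ext; simp [ZSpan.fundamentalDomain, e]
    rw [h1, h2]
    exact Measure.univ_pi_Ioc_ae_eq_Icc.trans Measure.univ_pi_Ico_ae_eq_Icc.symm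
  rw [setIntegral_congr_set hbox]
  have hsum := hasSum_setIntegral_fundamentalDomain e volume hintegr
  have hsumn := hasSum_setIntegral_fundamentalDomain e volume hintegr.norm
  have he : ∀ m : ι → ℤ, ∑ i, m i • e i = fun i ↦ (m i : ℝ) := by
    intro m; ext j; simp [e, Pi.single_apply]
  simp only [he] at hsum hsumn
  exact (hasSum_integral_of_summable_integral_norm
    (μ := volume.restrict (ZSpan.fundamentalDomain e))
    (F := fun (m : ι → ℤ) x ↦ f (x + fun i ↦ (m i : ℝ)))
    (fun m ↦ (hintegr.comp_add_right _).integrableOn) hsumn.summable).unique hsum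

/-- Poisson summation for the Gaussian of the quadratic form `x ↦ |B x|²`. -/
theorem tsum_matrixGaussian {B : Matrix ι ι ℝ} (hB : B.det ≠ 0) :
    ∑' m : ι → ℤ, matrixGaussian B (fun i ↦ (m i : ℝ)) =
      |B.det|⁻¹ * ∑' m : ι → ℤ, matrixGaussian (B⁻¹)ᵀ (fun i ↦ (m i : ℝ)) := by
  let P : (ι → ℝ) → ℂ := fun x ↦ ∑' m : ι → ℤ, matrixGaussian B (x + fun i ↦ (m i : ℝ))
  let p : (ι → ℝ) → UnitAddTorus ι := fun x i ↦ (x i : UnitAddCircle)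
  have hp : IsOpenQuotientMap p := IsOpenQuotientMap.piMap
    fun i ↦ (QuotientAddGroup.isOpenQuotientMap_mk (N := AddSubgroup.zmultiples (1 : ℝ)))
  have hPper : ∀ x y, p x = p y → P x = P y := by
    intro x y hxy
    have : ∀ i, ∃ k : ℤ, y i = x i + k := by
      intro i
      have h1 := congr_fun hxy i
      obtain ⟨k, hk⟩ := (QuotientAddGroup.eq_iff_sub_mem.mp h1.symm)
      refine ⟨k, ?_⟩
      simp only [zsmul_eq_mul, mul_one] at hk
      linarith
    choose k hk using this
    have hy : y = x + fun i ↦ (k i : ℝ) := funext hk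
    simp only [P, hy]
    rw [← (Equiv.addLeft k).tsum_eq fun m : ι → ℤ ↦ matrixGaussian B (x + fun i ↦ (m i : ℝ))]
    congr 1 with m
    rw [add_assoc]
    congr 2
    ext i
    simp
  let q : UnitAddTorus ι → ℂ := fun y ↦ P (Function.surjInv hp.surjective y)
  have hQ : ∀ x, q (p x) = P x := fun x ↦ hPper _ _ (Function.surjInv_eq hp.surjective (p x))
  let Q : C(UnitAddTorus ι, ℂ) := ⟨q, by
    rw [hp.isQuotientMap.continuous_iff, show q ∘ p = P from funext hQ]
    exact continuous_tsum_matrixGaussian hB⟩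
  replace hQ : ∀ x, Q (p x) = P x := hQ
  have hcoeff : ∀ n : ι → ℤ, UnitAddTorus.mFourierCoeff Q n =
      |B.det|⁻¹ * matrixGaussian (B⁻¹)ᵀ (fun i ↦ (n i : ℝ)) := by
    intro n
    obtain ⟨hintegr, hval⟩ := integral_matrixGaussian_mul_exp hB (fun i ↦ (n i : ℝ))
    rw [← hval, UnitAddTorus.mFourierCoeff_eq_integral _ _ 0]
    rw [← setIntegral_unitBox_tsum hintegr]
    refine integral_congr_ae (Filter.Eventually.of_forall fun x ↦ ?_)
    simp only [smul_eq_mul]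
    change _ * Q (p x) = _
    rw [hQ, ← tsum_mul_left]
    congr 1 with m
    rw [mFourier_coe_apply]
    have h1 : Complex.exp (-2 * Real.pi * Complex.I * ∑ i, (n i : ℂ) * (m i : ℂ)) = 1 := by
      rw [Complex.exp_eq_one_iff]
      refine ⟨-∑ i, n i * m i, ?_⟩
      push_cast
      ring
    rw [← mul_one (Complex.exp (2 * _ * _ * _)), ← h1, ← Complex.exp_add]
    congr 2
    simp only [Pi.add_apply, Pi.neg_apply, Complex.ofReal_sum, Complex.ofReal_mul,
      Complex.ofReal_add, Complex.ofReal_intCast, mul_add, Finset.sum_add_distrib, Int.cast_neg,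
      neg_mul, Finset.sum_neg_distrib]
    ring
  have hdet : (B⁻¹)ᵀ.det ≠ 0 := by
    rw [Matrix.det_transpose, Matrix.det_nonsing_inv]
    simpa using hB
  have hsum : Summable (UnitAddTorus.mFourierCoeff Q) := by
    rw [show UnitAddTorus.mFourierCoeff Q = _ from funext hcoeff]
    exact (summable_matrixGaussian hdet).mul_left _
  have h := UnitAddTorus.hasSum_mFourier_series_apply_of_summable hsum (p 0)
  rw [hQ] at h
  have h' := h.tsum_eq
  simp only [P, zero_add] at h'
  rw [← h', ← tsum_mul_left]
  congr 1 with m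
  rw [hcoeff, mFourier_coe_apply]
  simp

end GaussianPoisson

section PosDefTheta

variable {ι : Type*} [Fintype ι] [DecidableEq ι]

omit [DecidableEq ι] in
lemma sum_mulVec_sq (B : Matrix ι ι ℝ) (x : ι → ℝ) :
    ∑ i, (B *ᵥ x) i ^ 2 = x ⬝ᵥ ((Bᵀ * B) *ᵥ x) := by
  rw [← Matrix.mulVec_mulVec, Matrix.dotProduct_mulVec, Matrix.vecMul_transpose]
  simp [dotProduct, sq]

open scoped MatrixOrder in
lemma exists_transpose_mul_self {A : Matrix ι ι ℝ} (hA : A.PosDef) :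
    ∃ B : Matrix ι ι ℝ, B.det ≠ 0 ∧ A = Bᵀ * B := by
  obtain ⟨B, hB⟩ := CStarAlgebra.nonneg_iff_eq_star_mul_self.mp hA.posSemidef.nonneg
  have hA' : A = Bᵀ * B := by
    rw [hB, Matrix.star_eq_conjTranspose, Matrix.conjTranspose_eq_transpose_of_trivial]
  refine ⟨B, fun h0 ↦ hA.det_pos.ne' ?_, hA'⟩
  rw [hA', Matrix.det_mul, h0, mul_zero]

/-- The summable theta series of a positive definite quadratic form. -/
theorem summable_posDef_theta {A : Matrix ι ι ℝ} (hA : A.PosDef) :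
    Summable fun m : ι → ℤ ↦ Real.exp (-Real.pi *
      ((fun i ↦ (m i : ℝ)) ⬝ᵥ (A *ᵥ fun i ↦ (m i : ℝ)))) := by
  obtain ⟨B, hB0, rfl⟩ := exists_transpose_mul_self hA
  refine (summable_matrixGaussian hB0).norm.congr fun m ↦ ?_
  rw [norm_matrixGaussian, sum_mulVec_sq]

theorem tsum_posDef_theta {A : Matrix ι ι ℝ} (hA : A.PosDef) :
    ∑' m : ι → ℤ, Real.exp (-Real.pi * ((fun i ↦ (m i : ℝ)) ⬝ᵥ (A *ᵥ fun i ↦ (m i : ℝ)))) =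
      (√A.det)⁻¹ * ∑' m : ι → ℤ,
        Real.exp (-Real.pi * ((fun i ↦ (m i : ℝ)) ⬝ᵥ (A⁻¹ *ᵥ fun i ↦ (m i : ℝ)))) := by
  obtain ⟨B, hB0, rfl⟩ := exists_transpose_mul_self hA
  have h := tsum_matrixGaussian hB0
  have hg : ∀ (C : Matrix ι ι ℝ) (x : ι → ℝ), matrixGaussian C x =
      (Real.exp (-Real.pi * (x ⬝ᵥ ((Cᵀ * C) *ᵥ x))) : ℝ) := by
    intro C x
    rw [matrixGaussian, ← sum_mulVec_sq]
    push_cast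
    rfl
  have hinv : (B⁻¹)ᵀᵀ * (B⁻¹)ᵀ = (Bᵀ * B)⁻¹ := by
    rw [Matrix.mul_inv_rev, Matrix.transpose_transpose, Matrix.transpose_nonsing_inv]
  have hdet : √(Bᵀ * B).det = |B.det| := by
    rw [Matrix.det_mul, Matrix.det_transpose, Real.sqrt_mul_self_eq_abs]
  simp only [hg, hinv] at h
  rw [hdet]
  exact_mod_cast h

end PosDefTheta

section PlaceForm

open NumberField NumberField.InfinitePlace ComplexConjugate

variable {K : Type*} [Field K] [NumberField K]

/-- The positive definite form `x ↦ ∑ v, mult v * y v * |x|_v²` on a number field. -/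
def placeForm (y : InfinitePlace K → ℝ) (x : K) : ℝ :=
  ∑ v : InfinitePlace K, v.mult * y v * v x ^ 2

/-- The infinite place attached to a `ℚ`-embedding. -/
def algHomPlace (σ : K →ₐ[ℚ] ℂ) : InfinitePlace K := InfinitePlace.mk σ.toRingHom

lemma sum_algHomPlace {M : Type*} [AddCommMonoid M] (f : InfinitePlace K → M) :
    ∑ σ : K →ₐ[ℚ] ℂ, f (algHomPlace σ) = ∑ v : InfinitePlace K, v.mult • f v := by
  classical
  have h := Fintype.sum_equiv (RingHom.equivRatAlgHom (R := K) (S := ℂ)).symm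
    (fun σ ↦ f (algHomPlace σ)) (fun σ ↦ f (InfinitePlace.mk σ)) (fun σ ↦ rfl)
  rw [h, ← Finset.sum_fiberwise Finset.univ (fun φ : K →+* ℂ ↦ InfinitePlace.mk φ)]
  refine Finset.sum_congr rfl fun v _ ↦ ?_
  rw [Finset.sum_congr rfl (g := fun _ ↦ f v) fun σ hσ ↦ by rw [(Finset.mem_filter.mp hσ).2],
    Finset.sum_const, card_filter_mk_eq]

lemma algHomPlace_apply (σ : K →ₐ[ℚ] ℂ) (x : K) : algHomPlace σ x = ‖σ x‖ := rfl

lemma placeForm_eq_sum (y : InfinitePlace K → ℝ) (x : K) :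
    placeForm y x = ∑ σ : K →ₐ[ℚ] ℂ, y (algHomPlace σ) * ‖σ x‖ ^ 2 := by
  have h := sum_algHomPlace (fun v : InfinitePlace K ↦ y v * v x ^ 2)
  simp only [algHomPlace_apply] at h
  rw [h, placeForm]
  simp [nsmul_eq_mul, mul_assoc]

lemma prod_algHomPlace (y : InfinitePlace K → ℝ) :
    ∏ σ : K →ₐ[ℚ] ℂ, y (algHomPlace σ) = ∏ v : InfinitePlace K, y v ^ v.mult := by
  have h := sum_algHomPlace (M := Additive ℝ) (fun v ↦ Additive.ofMul (y v))
  exact h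

variable {ι : Type*} [Fintype ι] [DecidableEq ι]

/-- The Gram matrix of `placeForm y` in a basis. -/
def gramMatrix (b : Basis ι ℚ K) (y : InfinitePlace K → ℝ) : Matrix ι ι ℝ :=
  Matrix.of fun i j ↦ (∑ σ : K →ₐ[ℚ] ℂ, (y (algHomPlace σ) : ℂ) * (σ (b i) * conj (σ (b j)))).re

/-- Complex conjugation on the embeddings of a number field. -/
def conjAlgHom : (K →ₐ[ℚ] ℂ) ≃ (K →ₐ[ℚ] ℂ) where
  toFun σ := (Complex.conjAe.toAlgHom.restrictScalars ℚ).comp σ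
  invFun σ := (Complex.conjAe.toAlgHom.restrictScalars ℚ).comp σ
  left_inv σ := by ext; simp
  right_inv σ := by ext; simp

lemma conjAlgHom_apply (σ : K →ₐ[ℚ] ℂ) (x : K) : conjAlgHom σ x = conj (σ x) := rfl

lemma algHomPlace_conjAlgHom (σ : K →ₐ[ℚ] ℂ) : algHomPlace (conjAlgHom σ) = algHomPlace σ := by
  ext x
  simp [algHomPlace_apply, conjAlgHom_apply]

omit [Fintype ι] [DecidableEq ι] in
lemma gramMatrix_coe (b : Basis ι ℚ K) (y : InfinitePlace K → ℝ) (i j : ι) :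
    (gramMatrix b y i j : ℂ) =
      ∑ σ : K →ₐ[ℚ] ℂ, (y (algHomPlace σ) : ℂ) * (σ (b i) * conj (σ (b j))) := by
  rw [gramMatrix, Matrix.of_apply, ← Complex.conj_eq_iff_re, map_sum,
    ← (conjAlgHom (K := K)).sum_comp]
  refine Finset.sum_congr rfl fun σ _ ↦ ?_
  simp [algHomPlace_conjAlgHom, conjAlgHom_apply]

omit [Fintype ι] [DecidableEq ι] in
lemma gramMatrix_coe' (b : Basis ι ℚ K) (y : InfinitePlace K → ℝ) (i j : ι) :
    (gramMatrix b y i j : ℂ) =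
      ∑ σ : K →ₐ[ℚ] ℂ, (y (algHomPlace σ) : ℂ) * (conj (σ (b i)) * σ (b j)) := by
  rw [← Complex.conj_ofReal, gramMatrix_coe, map_sum]
  simp

omit [DecidableEq ι] in
lemma dotProduct_gramMatrix (b : Basis ι ℚ K) (y : InfinitePlace K → ℝ) (x : ι → ℝ) :
    x ⬝ᵥ (gramMatrix b y *ᵥ x) =
      ∑ σ : K →ₐ[ℚ] ℂ, y (algHomPlace σ) * ‖∑ i, (x i : ℂ) * σ (b i)‖ ^ 2 := by
  rw [← Complex.ofReal_inj]
  simp only [dotProduct, Matrix.mulVec, Complex.ofReal_sum, Complex.ofReal_mul, gramMatrix_coe,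
    Complex.ofReal_pow, ← Complex.mul_conj', map_sum, map_mul, Complex.conj_ofReal]
  simp only [Finset.mul_sum, Finset.sum_mul]
  rw [Finset.sum_comm]
  conv_rhs => rw [Finset.sum_comm]
  refine Finset.sum_congr rfl fun i _ ↦ ?_
  conv_rhs => rw [Finset.sum_comm]
  refine Finset.sum_congr rfl fun j _ ↦ ?_
  exact Finset.sum_congr rfl fun σ _ ↦ by ring

/-- The square matrix of conjugates of a basis. -/
def conjugatesMatrix (b : Basis ι ℚ K) (e : ι ≃ (K →ₐ[ℚ] ℂ)) : Matrix ι ι ℂ :=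
  Algebra.embeddingsMatrixReindex ℚ ℂ b e

omit [Fintype ι] [DecidableEq ι] in
lemma conjugatesMatrix_apply (b : Basis ι ℚ K) (e : ι ≃ (K →ₐ[ℚ] ℂ)) (i j : ι) :
    conjugatesMatrix b e i j = e j (b i) := rfl

lemma det_conjugatesMatrix_sq (b : Basis ι ℚ K) (e : ι ≃ (K →ₐ[ℚ] ℂ)) :
    ((Algebra.discr ℚ b : ℚ) : ℂ) = (conjugatesMatrix b e).det ^ 2 :=
  Algebra.discr_eq_det_embeddingsMatrixReindex_pow_two ℚ ℂ b e

lemma det_conjugatesMatrix_ne_zero (b : Basis ι ℚ K) (e : ι ≃ (K →ₐ[ℚ] ℂ)) :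
    (conjugatesMatrix b e).det ≠ 0 := by
  intro h
  have := det_conjugatesMatrix_sq b e
  rw [h] at this
  exact Algebra.discr_not_zero_of_basis ℚ b (by exact_mod_cast (by simpa using this))

lemma gramMatrix_map (b : Basis ι ℚ K) (y : InfinitePlace K → ℝ) (e : ι ≃ (K →ₐ[ℚ] ℂ)) :
    (gramMatrix b y).map ((↑) : ℝ → ℂ) = conjugatesMatrix b e *
      Matrix.diagonal (fun i ↦ (y (algHomPlace (e i)) : ℂ)) * (conjugatesMatrix b e)ᴴ := by
  ext i j
  rw [Matrix.map_apply, gramMatrix_coe, Matrix.mul_apply, ← e.sum_comp]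
  refine Finset.sum_congr rfl fun l _ ↦ ?_
  simp only [Matrix.mul_diagonal, Matrix.conjTranspose_apply, conjugatesMatrix_apply,
    starRingEnd_apply]
  ring

lemma gramMatrix_map' (b : Basis ι ℚ K) (y : InfinitePlace K → ℝ) (e : ι ≃ (K →ₐ[ℚ] ℂ)) :
    (gramMatrix b y).map ((↑) : ℝ → ℂ) = (conjugatesMatrix b e).map conj *
      Matrix.diagonal (fun i ↦ (y (algHomPlace (e i)) : ℂ)) * (conjugatesMatrix b e)ᵀ := by
  ext i j
  rw [Matrix.map_apply, gramMatrix_coe', Matrix.mul_apply, ← e.sum_comp]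
  refine Finset.sum_congr rfl fun l _ ↦ ?_
  simp only [Matrix.mul_diagonal, Matrix.transpose_apply, conjugatesMatrix_apply, Matrix.map_apply]
  ring

omit [DecidableEq ι] in
lemma exists_embeddings_equiv (b : Basis ι ℚ K) : Nonempty (ι ≃ (K →ₐ[ℚ] ℂ)) := by
  refine Fintype.card_eq.mp ?_
  rw [AlgHom.card, Module.finrank_eq_card_basis b]

lemma det_gramMatrix (b : Basis ι ℚ K) (y : InfinitePlace K → ℝ) :
    (gramMatrix b y).det = |((Algebra.discr ℚ b : ℚ) : ℝ)| * ∏ v, y v ^ v.mult := by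
  obtain ⟨e⟩ := exists_embeddings_equiv b
  have h := congr_arg Matrix.det (gramMatrix_map b y e)
  rw [Matrix.det_mul, Matrix.det_mul, Matrix.det_diagonal, Matrix.det_conjTranspose] at h
  have h1 : ((gramMatrix b y).map ((↑) : ℝ → ℂ)).det = ((gramMatrix b y).det : ℂ) :=
    (RingHom.map_det Complex.ofRealHom _).symm
  have h2 : ((|((Algebra.discr ℚ b : ℚ) : ℝ)| : ℝ) : ℂ) =
      (conjugatesMatrix b e).det * star (conjugatesMatrix b e).det := by
    have h3 := congr_arg norm (det_conjugatesMatrix_sq b e)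
    rw [norm_pow] at h3
    rw [← starRingEnd_apply, Complex.mul_conj', ← Complex.ofReal_pow, ← h3]
    congr 1
    rw [← Complex.ofReal_ratCast, Complex.norm_real, Real.norm_eq_abs]
  rw [h1] at h
  rw [← Complex.ofReal_inj, h, Complex.ofReal_mul, h2, ← prod_algHomPlace, ← e.prod_comp]
  push_cast
  ring

lemma posDef_gramMatrix (b : Basis ι ℚ K) {y : InfinitePlace K → ℝ} (hy : ∀ v, 0 < y v) :
    (gramMatrix b y).PosDef := by
  obtain ⟨e⟩ := exists_embeddings_equiv b
  refine Matrix.PosDef.of_dotProduct_mulVec_pos ?_ fun x hx ↦ ?_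
  · ext i j
    rw [Matrix.conjTranspose_apply, star_trivial, ← Complex.ofReal_inj, gramMatrix_coe,
      gramMatrix_coe']
    simp only [mul_comm]
  · rw [star_trivial, dotProduct_gramMatrix]
    have h0 : ∀ σ : K →ₐ[ℚ] ℂ, 0 ≤ y (algHomPlace σ) * ‖∑ i, (x i : ℂ) * σ (b i)‖ ^ 2 :=
      fun σ ↦ mul_nonneg (hy _).le (by positivity)
    refine lt_of_le_of_ne (Finset.sum_nonneg fun σ _ ↦ h0 σ) fun h ↦ hx ?_
    have h1 := (Finset.sum_eq_zero_iff_of_nonneg fun σ _ ↦ h0 σ).mp h.symm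
    have h2 : (fun i ↦ (x i : ℂ)) ᵥ* conjugatesMatrix b e = 0 := by
      ext j
      have := h1 (e j) (Finset.mem_univ _)
      simpa [(hy _).ne', Matrix.vecMul, dotProduct, conjugatesMatrix_apply] using this
    have h3 := Matrix.eq_zero_of_vecMul_eq_zero (det_conjugatesMatrix_ne_zero b e) h2
    ext i
    simpa using congr_fun h3 i

/-- The basis dual to `b` for the trace form. -/
def traceDualBasis (b : Basis ι ℚ K) : Basis ι ℚ K :=
  (Algebra.traceForm ℚ K).dualBasis (traceForm_nondegenerate ℚ K) b

lemma conjugatesMatrix_mul_traceDualBasis (b : Basis ι ℚ K) (e : ι ≃ (K →ₐ[ℚ] ℂ)) :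
    conjugatesMatrix b e * (conjugatesMatrix (traceDualBasis b) e)ᵀ = 1 := by
  ext i j
  simp only [Matrix.mul_apply, Matrix.transpose_apply, conjugatesMatrix_apply, ← map_mul]
  rw [e.sum_comp (fun σ : K →ₐ[ℚ] ℂ ↦ σ (b i * traceDualBasis b j)),
    ← trace_eq_sum_embeddings ℂ (K := ℚ)]
  have := LinearMap.BilinForm.apply_dualBasis_right (B := Algebra.traceForm ℚ K)
    (traceForm_nondegenerate ℚ K) (Algebra.traceForm_isSymm ℚ) b i j
  rw [Algebra.traceForm_apply] at this
  rw [traceDualBasis, this, Matrix.one_apply]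
  split_ifs <;> simp_all

lemma gramMatrix_traceDualBasis (b : Basis ι ℚ K) {y : InfinitePlace K → ℝ} (hy : ∀ v, 0 < y v) :
    gramMatrix (traceDualBasis b) y⁻¹ = (gramMatrix b y)⁻¹ := by
  obtain ⟨e⟩ := exists_embeddings_equiv b
  symm
  apply Matrix.inv_eq_right_inv
  have hinj : Function.Injective fun A : Matrix ι ι ℝ ↦ A.map ((↑) : ℝ → ℂ) :=
    Matrix.map_injective Complex.ofReal_injective
  apply hinj
  have hmul : ∀ A B : Matrix ι ι ℝ, (A * B).map ((↑) : ℝ → ℂ) =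
      A.map ((↑) : ℝ → ℂ) * B.map ((↑) : ℝ → ℂ) := fun A B ↦ Matrix.map_mul (f := Complex.ofRealHom)
  simp only [hmul]
  rw [gramMatrix_map b y e, gramMatrix_map' _ _ e]
  set M := conjugatesMatrix b e
  set M' := conjugatesMatrix (traceDualBasis b) e
  have h1 : M * M'ᵀ = 1 := conjugatesMatrix_mul_traceDualBasis b e
  have h2 : Mᴴ * M'.map conj = 1 := by
    have h3 : M'ᵀ * M = 1 := mul_eq_one_comm.mp h1
    have h4 := congr_arg Matrix.conjTranspose h3
    rw [Matrix.conjTranspose_mul, Matrix.conjTranspose_one] at h4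
    exact h4
  have h3 : Matrix.diagonal (fun i ↦ (y (algHomPlace (e i)) : ℂ)) *
      Matrix.diagonal (fun i ↦ ((y⁻¹ (algHomPlace (e i)) : ℝ) : ℂ)) = 1 := by
    rw [Matrix.diagonal_mul_diagonal, ← Matrix.diagonal_one]
    congr 1
    ext i
    have := (hy (algHomPlace (e i))).ne'
    simp [this]
  calc _ = M * (Matrix.diagonal (fun i ↦ (y (algHomPlace (e i)) : ℂ)) * (Mᴴ * M'.map conj) *
        Matrix.diagonal (fun i ↦ ((y⁻¹ (algHomPlace (e i)) : ℝ) : ℂ))) * M'ᵀ := by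
        simp only [Matrix.mul_assoc]
    _ = 1 := by rw [h2, Matrix.mul_one, h3, Matrix.mul_one, h1]
    _ = _ := by simp

/-- The theta function of the lattice spanned by a basis. -/
def latticeTheta (b : Basis ι ℚ K) (y : InfinitePlace K → ℝ) : ℝ :=
  ∑' x : Submodule.span ℤ (Set.range b), Real.exp (-Real.pi * placeForm y x)

/-- Integer coordinates on the lattice spanned by a basis. -/
def latticeCoord (b : Basis ι ℚ K) : (ι → ℤ) ≃ Submodule.span ℤ (Set.range b) :=
  (b.restrictScalars ℤ).equivFun.symm.toEquiv

omit [DecidableEq ι] in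
lemma latticeCoord_coe (b : Basis ι ℚ K) (m : ι → ℤ) :
    (latticeCoord b m : K) = ∑ i, m i • b i := by
  simp [latticeCoord, Basis.equivFun_symm_apply]

omit [DecidableEq ι] in
lemma placeForm_latticeCoord (b : Basis ι ℚ K) (y : InfinitePlace K → ℝ) (m : ι → ℤ) :
    placeForm y (latticeCoord b m : K) =
      (fun i ↦ (m i : ℝ)) ⬝ᵥ (gramMatrix b y *ᵥ fun i ↦ (m i : ℝ)) := by
  rw [dotProduct_gramMatrix, placeForm_eq_sum, latticeCoord_coe]
  simp

lemma summable_latticeTheta (b : Basis ι ℚ K) {y : InfinitePlace K → ℝ} (hy : ∀ v, 0 < y v) :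
    Summable fun x : Submodule.span ℤ (Set.range b) ↦ Real.exp (-Real.pi * placeForm y x) := by
  rw [← (latticeCoord b).summable_iff]
  refine (summable_posDef_theta (posDef_gramMatrix b hy)).congr fun m ↦ ?_
  rw [Function.comp_apply, placeForm_latticeCoord]

theorem latticeTheta_eq (b : Basis ι ℚ K) {y : InfinitePlace K → ℝ} (hy : ∀ v, 0 < y v) :
    latticeTheta b y = (√(|((Algebra.discr ℚ b : ℚ) : ℝ)| * ∏ v, y v ^ v.mult))⁻¹ *
      latticeTheta (traceDualBasis b) y⁻¹ := by
  rw [latticeTheta, latticeTheta, ← (latticeCoord b).tsum_eq,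
    ← (latticeCoord (traceDualBasis b)).tsum_eq]
  simp only [placeForm_latticeCoord, gramMatrix_traceDualBasis b hy]
  rw [tsum_posDef_theta (posDef_gramMatrix b hy), det_gramMatrix]

end PlaceForm

section ZSpanLIntegral

variable {κ E : Type*} [Fintype κ] [NormedAddCommGroup E] [NormedSpace ℝ E]
  [MeasurableSpace E] [BorelSpace E]

lemma lintegral_eq_tsum_fundamentalDomain (e : Basis κ ℝ E) (μ : Measure E)
    [μ.IsAddHaarMeasure] (f : E → ℝ≥0∞) :
    ∫⁻ x, f x ∂μ =
      ∑' m : κ → ℤ, ∫⁻ x in ZSpan.fundamentalDomain e, f (x + ∑ i, m i • e i) ∂μ := by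
  have hD := ZSpan.isAddFundamentalDomain e μ
  have : FiniteDimensional ℝ E := e.finiteDimensional_of_finite
  have : VAddInvariantMeasure (Submodule.span ℤ (Set.range e)) E μ :=
    inferInstanceAs <| VAddInvariantMeasure (Submodule.span ℤ (Set.range e)).toAddSubgroup E μ
  rw [hD.lintegral_eq_tsum'', ← (intCoordEquiv e).tsum_eq]
  simp only [Submodule.vadd_def, vadd_eq_add, intCoordEquiv_coe, add_comm]

lemma setLIntegral_fundamentalDomain_neg (e : Basis κ ℝ E) (μ : Measure E)
    [μ.IsAddHaarMeasure] (f : E → ℝ≥0∞)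
    (hf : ∀ (m : κ → ℤ) x, f (x + ∑ i, m i • e i) = f x) :
    ∫⁻ x in ZSpan.fundamentalDomain e, f (-x) ∂μ = ∫⁻ x in ZSpan.fundamentalDomain e, f x ∂μ := by
  have hD := ZSpan.isAddFundamentalDomain e μ
  have : FiniteDimensional ℝ E := e.finiteDimensional_of_finite
  have : VAddInvariantMeasure (Submodule.span ℤ (Set.range e)) E μ :=
    inferInstanceAs <| VAddInvariantMeasure (Submodule.span ℤ (Set.range e)).toAddSubgroup E μ
  have hmp : MeasurePreserving (Neg.neg : E → E) μ μ := Measure.measurePreserving_neg μ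
  have hD' : IsAddFundamentalDomain (Submodule.span ℤ (Set.range e))
      (Neg.neg ⁻¹' ZSpan.fundamentalDomain e) μ :=
    hD.preimage_of_equiv hmp.quasiMeasurePreserving
      (e := Neg.neg) (Equiv.neg _).bijective fun g x ↦ by
        simp [Submodule.vadd_def, add_comm]
  have h1 := hmp.setLIntegral_comp_preimage_emb (MeasurableEquiv.neg E).measurableEmbedding f
    (Neg.neg ⁻¹' ZSpan.fundamentalDomain e)
  have h2 : (Neg.neg ⁻¹' (Neg.neg ⁻¹' ZSpan.fundamentalDomain e) : Set E) =
      ZSpan.fundamentalDomain e := by ext; simp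
  rw [h2] at h1
  rw [h1]
  refine hD'.setLIntegral_eq hD f fun g x ↦ ?_
  obtain ⟨m, rfl⟩ := (intCoordEquiv e).surjective g
  rw [Submodule.vadd_def, vadd_eq_add, intCoordEquiv_coe, add_comm, hf]

end ZSpanLIntegral

section UnitFolding

open NumberField NumberField.InfinitePlace NumberField.Units NumberField.Units.dirichletUnitTheorem

variable {K : Type*} [Field K] [NumberField K]

open scoped Classical

/-- Extend a vector of the log space to the trace zero hyperplane. -/
def fullLog (h : logSpace K) (v : InfinitePlace K) : ℝ :=
  if hv : v ≠ w₀ then h ⟨v, hv⟩ else -∑ w, h w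

lemma fullLog_add (h h' : logSpace K) : fullLog (h + h') = fullLog h + fullLog h' := by
  ext v
  simp only [fullLog, Pi.add_apply, Finset.sum_add_distrib]
  split_ifs <;> ring

lemma fullLog_neg (h : logSpace K) : fullLog (-h) = -fullLog h := by
  ext v
  simp only [fullLog, Pi.neg_apply, Finset.sum_neg_distrib]
  split_ifs <;> ring

lemma fullLog_smul (c : ℝ) (h : logSpace K) : fullLog (c • h) = c • fullLog h := by
  ext v
  simp only [fullLog, Pi.smul_apply, smul_eq_mul, ← Finset.mul_sum]
  split_ifs <;> ring

lemma sum_fullLog (h : logSpace K) : ∑ v, fullLog h v = 0 := by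
  classical
  rw [Fintype.sum_eq_add_sum_subtype_ne (fullLog h) w₀]
  have h1 : ∀ v : {v : InfinitePlace K // v ≠ w₀}, fullLog h v = h v := fun v ↦ by
    simp [fullLog, v.2]
  rw [Fintype.sum_congr _ _ h1]
  simp [fullLog]

lemma fullLog_logEmbedding (u : (𝓞 K)ˣ) (v : InfinitePlace K) :
    fullLog (logEmbedding K (Additive.ofMul u)) v = v.mult * Real.log (v (u : K)) := by
  classical
  by_cases hv : v = w₀
  · have := sum_logEmbedding_component u
    simp only [fullLog, hv, ne_eq, not_true_eq_false, dif_neg, not_false_eq_true]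
    rw [neg_eq_iff_eq_neg, ← neg_mul]
    convert this
  · simp [fullLog, hv, logEmbedding_component]

lemma continuous_fullLog (v : InfinitePlace K) : Continuous fun h : logSpace K ↦ fullLog h v := by
  unfold fullLog
  split_ifs <;> fun_prop

/-- The weights on the infinite places attached to a point of the log space. -/
def unitWeight (h : logSpace K) (v : InfinitePlace K) : ℝ :=
  Real.exp (2 * fullLog h v / v.mult)

lemma unitWeight_pos (h : logSpace K) (v : InfinitePlace K) : 0 < unitWeight h v := Real.exp_pos _

lemma unitWeight_neg (h : logSpace K) : unitWeight (-h) = (unitWeight h)⁻¹ := by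
  ext v
  simp only [unitWeight, fullLog_neg, Pi.neg_apply, Pi.inv_apply, ← Real.exp_neg]
  ring_nf

omit [NumberField K] in
lemma mult_cast_ne_zero (v : InfinitePlace K) : (v.mult : ℝ) ≠ 0 := by
  exact_mod_cast v.mult_ne_zero

lemma prod_unitWeight (h : logSpace K) : ∏ v, unitWeight h v ^ v.mult = 1 := by
  have : ∀ v : InfinitePlace K, unitWeight h v ^ v.mult = Real.exp (2 * fullLog h v) := fun v ↦ by
    rw [unitWeight, ← Real.exp_nat_mul]
    congr 1
    field_simp [mult_cast_ne_zero v]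
  rw [Finset.prod_congr rfl fun v _ ↦ this v, ← Real.exp_sum, ← Finset.mul_sum, sum_fullLog]
  simp

lemma continuous_unitWeight (v : InfinitePlace K) :
    Continuous fun h : logSpace K ↦ unitWeight h v := by
  have := continuous_fullLog v
  unfold unitWeight
  fun_prop

lemma unitWeight_add_logEmbedding (h : logSpace K) (u : (𝓞 K)ˣ) (v : InfinitePlace K) :
    unitWeight (h + logEmbedding K (Additive.ofMul u)) v = unitWeight h v * v (u : K) ^ 2 := by
  have hu : 0 < v (u : K) := v.pos_iff.mpr (by simp)
  rw [unitWeight, fullLog_add, Pi.add_apply, fullLog_logEmbedding, unitWeight, mul_add, add_div,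
    Real.exp_add]
  congr 1
  rw [show 2 * (v.mult * Real.log (v (u : K))) / (v.mult : ℝ) = Real.log (v (u : K)) * (2 : ℕ) by
    field_simp [mult_cast_ne_zero v]; push_cast; ring]
  rw [mul_comm, Real.exp_nat_mul, Real.exp_log hu]

lemma placeForm_unitWeight_add (t : ℝ) (h : logSpace K) (u : (𝓞 K)ˣ) (x : K) :
    placeForm (t • unitWeight (h + logEmbedding K (Additive.ofMul u))) x =
      placeForm (t • unitWeight h) (u * x) := by
  unfold placeForm
  refine Finset.sum_congr rfl fun v _ ↦ ?_
  simp only [Pi.smul_apply, smul_eq_mul, unitWeight_add_logEmbedding, map_mul]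
  ring

variable (K) in
/-- The real basis of the log space given by the fundamental units. -/
def logBasis : Basis (Fin (rank K)) ℝ (logSpace K) :=
  (basisUnitLattice K).ofZLatticeBasis ℝ (unitLattice K)

/-- The unit with given exponents with respect to the fundamental system. -/
def fundUnit (m : Fin (rank K) → ℤ) : (𝓞 K)ˣ := ∏ i, fundSystem K i ^ m i

lemma logEmbedding_fundUnit (m : Fin (rank K) → ℤ) :
    logEmbedding K (Additive.ofMul (fundUnit m)) = ∑ i, m i • logBasis K i := by
  simp only [fundUnit, ofMul_prod, map_sum, ofMul_zpow, map_zsmul, logEmbedding_fundSystem,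
    logBasis, Basis.ofZLatticeBasis_apply]

lemma fundUnit_add (m m' : Fin (rank K) → ℤ) :
    fundUnit (m + m') = fundUnit m * fundUnit (K := K) m' := by
  simp [fundUnit, zpow_add, Finset.prod_mul_distrib]

lemma fundUnit_zero : fundUnit (K := K) 0 = 1 := by simp [fundUnit]

lemma fundUnit_injective : Function.Injective (fundUnit (K := K)) := by
  intro m m' h
  have h1 := congr_arg (fun u ↦ logEmbedding K (Additive.ofMul u)) h
  simp only [logEmbedding_fundUnit] at h1
  have h2 := (intCoordEquiv (logBasis K)).injective (a₁ := m) (a₂ := m')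
    (Subtype.ext (by simpa only [intCoordEquiv_coe] using h1))
  exact h2

end UnitFolding

section FoldedTheta

open NumberField NumberField.InfinitePlace NumberField.Units NumberField.Units.dirichletUnitTheorem
open scoped Classical

variable {K : Type*} [Field K] [NumberField K]

lemma placeForm_smul (t : ℝ) (y : InfinitePlace K → ℝ) (x : K) :
    placeForm (t • y) x = t * placeForm y x := by
  simp only [placeForm, Finset.mul_sum, Pi.smul_apply, smul_eq_mul]
  exact Finset.sum_congr rfl fun v _ ↦ by ring

lemma placeForm_zero (y : InfinitePlace K → ℝ) : placeForm y 0 = 0 := by simp [placeForm]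

lemma placeForm_mono {y y' : InfinitePlace K → ℝ} (h : ∀ v, y v ≤ y' v) (x : K) :
    placeForm y x ≤ placeForm y' x := by
  unfold placeForm
  gcongr with v
  exact h v

lemma smul_unitWeight_pos {t : ℝ} (ht : 0 < t) (h : logSpace K) (v : InfinitePlace K) :
    0 < (t • unitWeight h) v := mul_pos ht (unitWeight_pos h v)

variable {ι : Type*} [Fintype ι] (b : Basis ι ℚ K)

/-- The nonzero vectors of the lattice spanned by a basis. -/
abbrev nonzeroLattice : Set (Submodule.span ℤ (Set.range b)) := {0}ᶜ

/-- The theta series without its constant term. -/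
def tailTheta (y : InfinitePlace K → ℝ) : ℝ≥0∞ :=
  ∑' x : nonzeroLattice b, ENNReal.ofReal (Real.exp (-Real.pi * placeForm y x.1))

lemma one_add_tailTheta {y : InfinitePlace K → ℝ} (hy : ∀ v, 0 < y v) :
    1 + tailTheta b y = ENNReal.ofReal (latticeTheta b y) := by
  rw [latticeTheta, ENNReal.ofReal_tsum_of_nonneg (fun _ ↦ (Real.exp_pos _).le)
    (summable_latticeTheta b hy), ← Summable.tsum_add_tsum_compl
      (s := ({0} : Set (Submodule.span ℤ (Set.range b)))) ENNReal.summable ENNReal.summable]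
  congr 1
  rw [tsum_singleton (0 : Submodule.span ℤ (Set.range b))
    (fun x ↦ ENNReal.ofReal (Real.exp (-Real.pi * placeForm y x)))]
  simp [placeForm_zero]

lemma tailTheta_ne_top {y : InfinitePlace K → ℝ} (hy : ∀ v, 0 < y v) : tailTheta b y ≠ ⊤ := by
  have h := one_add_tailTheta b hy
  intro h'
  simp [h'] at h

omit [Fintype ι] in
lemma tailTheta_anti {y y' : InfinitePlace K → ℝ} (h : ∀ v, y v ≤ y' v) :
    tailTheta b y' ≤ tailTheta b y := by
  refine ENNReal.tsum_le_tsum fun x ↦ ENNReal.ofReal_le_ofReal (Real.exp_le_exp.mpr ?_)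
  have := mul_le_mul_of_nonneg_left (placeForm_mono h (x.1 : K)) Real.pi_pos.le
  linarith

/-- The lattice spanned by `b` is stable under multiplication by units. -/
def UnitStable : Prop :=
  ∀ (u : (𝓞 K)ˣ) (x : K), x ∈ Submodule.span ℤ (Set.range b) →
    (u : K) * x ∈ Submodule.span ℤ (Set.range b)

variable {b}

/-- Multiplication by a unit on the nonzero vectors of a unit stable lattice. -/
def unitMulEquiv (hb : UnitStable b) (u : (𝓞 K)ˣ) : nonzeroLattice b ≃ nonzeroLattice b where
  toFun x := ⟨⟨u * x.1, hb u _ x.1.2⟩, fun h ↦ x.2 (Subtype.ext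
    ((mul_eq_zero_iff_left (coe_ne_zero u)).mp (congr_arg Subtype.val h)))⟩
  invFun x := ⟨⟨(u⁻¹ : (𝓞 K)ˣ) * x.1, hb u⁻¹ _ x.1.2⟩, fun h ↦ x.2 (Subtype.ext
    ((mul_eq_zero_iff_left (coe_ne_zero u⁻¹)).mp (congr_arg Subtype.val h)))⟩
  left_inv x := by ext; simp
  right_inv x := by ext; simp

omit [Fintype ι] in
lemma unitMulEquiv_coe (hb : UnitStable b) (u : (𝓞 K)ˣ) (x : nonzeroLattice b) :
    ((unitMulEquiv hb u x).1 : K) = u * (x.1 : K) := rfl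

omit [Fintype ι] in
lemma tailTheta_add_logEmbedding (hb : UnitStable b) (t : ℝ) (h : logSpace K) (u : (𝓞 K)ˣ) :
    tailTheta b (t • unitWeight (h + logEmbedding K (Additive.ofMul u))) =
      tailTheta b (t • unitWeight h) := by
  rw [tailTheta, tailTheta]
  conv_rhs => rw [← (unitMulEquiv hb u).tsum_eq]
  simp only [placeForm_unitWeight_add, unitMulEquiv_coe]

variable (K) in
/-- The fundamental parallelepiped of the unit lattice. -/
abbrev unitDomain : Set (logSpace K) := ZSpan.fundamentalDomain (logBasis K)

variable (b) in
/-- The theta series without its constant term, integrated over the units. -/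
def foldedTheta (t : ℝ) : ℝ≥0∞ := ∫⁻ h in unitDomain K, tailTheta b (t • unitWeight h)

variable (K) in
/-- The covolume of the unit lattice. -/
def unitCovolume : ℝ := (volume (unitDomain K)).toReal

variable (K) in
lemma volume_unitDomain_ne_top : volume (unitDomain K) ≠ ⊤ :=
  (ZSpan.fundamentalDomain_isBounded (logBasis K)).measure_lt_top.ne

lemma volume_add_foldedTheta [DecidableEq ι] {t : ℝ} (ht : 0 < t) :
    volume (unitDomain K) + foldedTheta b t =
      ∫⁻ h in unitDomain K, ENNReal.ofReal (latticeTheta b (t • unitWeight h)) := by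
  have : ∀ h : logSpace K, ENNReal.ofReal (latticeTheta b (t • unitWeight h)) =
      1 + tailTheta b (t • unitWeight h) := fun h ↦
    (one_add_tailTheta b (smul_unitWeight_pos ht h)).symm
  simp only [this]
  rw [lintegral_add_left measurable_const]
  simp [foldedTheta]

variable (b) in
/-- The absolute value of the discriminant of a basis. -/
def absDiscr [DecidableEq ι] : ℝ := |((Algebra.discr ℚ b : ℚ) : ℝ)|

lemma absDiscr_pos [DecidableEq ι] : 0 < absDiscr b :=
  abs_pos.mpr (by exact_mod_cast Algebra.discr_not_zero_of_basis ℚ b)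

lemma foldedTheta_feq [DecidableEq ι] (hb : UnitStable (traceDualBasis b)) {t : ℝ} (ht : 0 < t) :
    volume (unitDomain K) + foldedTheta b t =
      ENNReal.ofReal (√(absDiscr b * t ^ finrank ℚ K))⁻¹ *
        (volume (unitDomain K) + foldedTheta (traceDualBasis b) t⁻¹) := by
  have h1 : ∀ h : logSpace K, ENNReal.ofReal (latticeTheta b (t • unitWeight h)) =
      ENNReal.ofReal (√(absDiscr b * t ^ finrank ℚ K))⁻¹ *
        ENNReal.ofReal (latticeTheta (traceDualBasis b) (t⁻¹ • unitWeight (-h))) := fun h ↦ by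
    rw [latticeTheta_eq b (smul_unitWeight_pos ht h),
      ENNReal.ofReal_mul (by positivity)]
    congr 3
    · congr 1
      rw [absDiscr]
      congr 1
      simp only [Pi.smul_apply, smul_eq_mul, mul_pow, Finset.prod_mul_distrib, prod_unitWeight,
        mul_one, Finset.prod_pow_eq_pow_sum, sum_mult_eq]
    · rw [unitWeight_neg]
      ext v
      simp [mul_comm]
  rw [volume_add_foldedTheta ht, volume_add_foldedTheta (inv_pos.mpr ht)]
  simp only [h1]
  rw [lintegral_const_mul' _ _ ENNReal.ofReal_ne_top]
  congr 1
  refine setLIntegral_fundamentalDomain_neg (logBasis K) volume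
    (fun h ↦ ENNReal.ofReal (latticeTheta (traceDualBasis b) (t⁻¹ • unitWeight h))) fun m h ↦ ?_
  rw [← one_add_tailTheta _ (smul_unitWeight_pos (inv_pos.mpr ht) _),
    ← one_add_tailTheta _ (smul_unitWeight_pos (inv_pos.mpr ht) _),
    ← logEmbedding_fundUnit, tailTheta_add_logEmbedding hb]

variable (K) in
lemma exists_unitWeight_lower_bound :
    ∃ c : ℝ, 0 < c ∧ ∀ h ∈ unitDomain K, ∀ v, c ≤ unitWeight h v := by
  have hc : IsCompact (closure (unitDomain K)) :=
    (ZSpan.fundamentalDomain_isBounded (logBasis K)).isCompact_closure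
  have : ∀ v : InfinitePlace K, ∃ c : ℝ, 0 < c ∧ ∀ h ∈ unitDomain K, c ≤ unitWeight h v := by
    intro v
    rcases (closure (unitDomain K)).eq_empty_or_nonempty with h0 | hne
    · refine ⟨1, one_pos, fun h hh ↦ ?_⟩
      have := subset_closure hh
      simp [h0] at this
    · obtain ⟨h', -, hmin⟩ := hc.exists_isMinOn hne (continuous_unitWeight v).continuousOn
      exact ⟨unitWeight h' v, unitWeight_pos _ _, fun h hh ↦ hmin (subset_closure hh)⟩
  choose c hc0 hc using this
  obtain ⟨i, hi⟩ := Finite.exists_min c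
  exact ⟨c i, hc0 i, fun h hh v ↦ (hi v).trans (hc v h hh)⟩

variable (b) in
lemma exists_placeForm_lower_bound :
    ∃ q : ℝ, 0 < q ∧ ∀ x : nonzeroLattice b, q ≤ placeForm 1 (x.1 : K) := by
  obtain ⟨B, hB, hA⟩ := exists_transpose_mul_self
    (posDef_gramMatrix b (y := (1 : InfinitePlace K → ℝ)) fun _ ↦ one_pos)
  obtain ⟨c, hc0, hc⟩ := exists_mul_norm_sq_le_sum_mulVec_sq hB
  refine ⟨c, hc0, fun x ↦ ?_⟩
  obtain ⟨m, hm⟩ := (latticeCoord b).surjective x.1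
  have hm0 : m ≠ 0 := by
    rintro rfl
    apply x.2
    rw [← hm]
    ext
    simp [latticeCoord_coe]
  obtain ⟨i, hi⟩ := Function.ne_iff.mp hm0
  have h1 : 1 ≤ ‖fun i ↦ (m i : ℝ)‖ := by
    refine le_trans ?_ (norm_le_pi_norm _ i)
    rw [Real.norm_eq_abs]
    exact_mod_cast Int.one_le_abs hi
  rw [← hm, placeForm_latticeCoord, hA, ← sum_mulVec_sq]
  refine le_trans ?_ (hc _)
  have : 1 ≤ ‖fun i ↦ (m i : ℝ)‖ ^ 2 := one_le_pow₀ h1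
  nlinarith

variable (b) in
lemma exists_foldedTheta_bound : ∃ c q : ℝ, 0 < c ∧ 0 < q ∧
    (∀ t > 0, foldedTheta b t ≠ ⊤) ∧ ∀ t ≥ 1, (foldedTheta b t).toReal ≤ c * Real.exp (-q * t) := by
  obtain ⟨c₀, hc₀, hF⟩ := exists_unitWeight_lower_bound K
  obtain ⟨q, hq, hL⟩ := exists_placeForm_lower_bound b
  have h1 : ∀ t > 0, foldedTheta b t ≤ tailTheta b ((t * c₀) • 1) * volume (unitDomain K) := by
    intro t ht
    rw [foldedTheta, ← setLIntegral_const]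
    refine setLIntegral_mono' (ZSpan.fundamentalDomain_measurableSet _) fun h hh ↦ ?_
    refine tailTheta_anti b fun v ↦ ?_
    simpa using mul_le_mul_of_nonneg_left (hF h hh v) ht.le
  have hfin : ∀ t : ℝ, 0 < t → tailTheta b ((t * c₀) • 1) ≠ ⊤ := fun t ht ↦
    tailTheta_ne_top b fun v ↦ by simpa using mul_pos ht hc₀
  have h2 : ∀ t ≥ 1, tailTheta b ((t * c₀) • 1) ≤
      ENNReal.ofReal (Real.exp (-(Real.pi * (t - 1) * c₀ * q))) * tailTheta b ((1 * c₀) • 1) := by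
    intro t ht
    rw [tailTheta, tailTheta, ← ENNReal.tsum_mul_left]
    refine ENNReal.tsum_le_tsum fun x ↦ ?_
    rw [← ENNReal.ofReal_mul (Real.exp_pos _).le, ← Real.exp_add]
    refine ENNReal.ofReal_le_ofReal (Real.exp_le_exp.mpr ?_)
    simp only [placeForm_smul]
    have h3 : Real.pi * (t - 1) * c₀ * q ≤ Real.pi * (t - 1) * c₀ * placeForm 1 (x.1 : K) := by
      have := hL x
      have := sub_nonneg.mpr ht
      have := Real.pi_pos
      gcongr
    linarith
  set A := (tailTheta b ((1 * c₀) • 1) * volume (unitDomain K)).toReal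
  refine ⟨(A + 1) * Real.exp (Real.pi * c₀ * q), Real.pi * c₀ * q, by positivity,
    by have := Real.pi_pos; positivity,
    fun t ht ↦ ne_top_of_le_ne_top (ENNReal.mul_ne_top (hfin t ht) (volume_unitDomain_ne_top K))
      (h1 t ht), fun t ht ↦ ?_⟩
  have ht0 : 0 < t := by linarith
  have h3 := (h1 t ht0).trans (mul_le_mul_left (h2 t ht) _)
  rw [mul_assoc] at h3
  have h4 := ENNReal.toReal_mono (ENNReal.mul_ne_top ENNReal.ofReal_ne_top
    (ENNReal.mul_ne_top (hfin 1 one_pos) (volume_unitDomain_ne_top K))) h3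
  rw [ENNReal.toReal_mul, ENNReal.toReal_ofReal (Real.exp_pos _).le] at h4
  refine h4.trans ?_
  rw [mul_assoc (A + 1), ← Real.exp_add, mul_comm]
  refine mul_le_mul (by simp [A]) (Real.exp_le_exp.mpr (by linarith)) (Real.exp_pos _).le
    (by positivity)

omit [Fintype ι] in
lemma foldedTheta_antitone {t t' : ℝ} (h : t ≤ t') : foldedTheta b t' ≤ foldedTheta b t := by
  refine lintegral_mono fun w ↦ tailTheta_anti b fun v ↦ ?_
  exact mul_le_mul_of_nonneg_right h (unitWeight_pos w v).le

variable (b) in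
/-- The folded theta function, including its constant term. -/
def foldedThetaC (t : ℝ) : ℂ := ((unitCovolume K + (foldedTheta b t).toReal : ℝ) : ℂ)

lemma locallyIntegrableOn_foldedThetaC : LocallyIntegrableOn (foldedThetaC b) (Set.Ioi 0) := by
  obtain ⟨c, q, -, -, hfin, -⟩ := exists_foldedTheta_bound b
  refine (locallyIntegrableOn_iff (isOpen_Ioi.isLocallyClosed)).mpr fun k hk hkc ↦ ?_
  have h : AntitoneOn (fun t ↦ unitCovolume K + (foldedTheta b t).toReal) k := by
    intro x hx y hy hxy
    have := ENNReal.toReal_mono (hfin x (hk hx)) (foldedTheta_antitone (b := b) hxy)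
    simpa using this
  exact (h.integrableOn_isCompact hkc).ofReal

lemma foldedThetaC_isBigO (r : ℝ) :
    (fun t ↦ foldedThetaC b t - (unitCovolume K : ℂ)) =O[Filter.atTop] fun t ↦ t ^ r := by
  obtain ⟨c, q, hc, hq, -, hbd⟩ := exists_foldedTheta_bound b
  refine Asymptotics.IsBigO.trans ?_ (isLittleO_exp_neg_mul_rpow_atTop hq r).isBigO
  refine Asymptotics.IsBigO.of_bound c ?_
  filter_upwards [Filter.eventually_ge_atTop 1] with t ht
  rw [foldedThetaC, ← Complex.ofReal_sub, Complex.norm_real, add_sub_cancel_left,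
    Real.norm_of_nonneg ENNReal.toReal_nonneg, Real.norm_of_nonneg (Real.exp_pos _).le]
  exact hbd t ht

/-- The functional equation pair attached to a lattice and its dual. -/
def thetaPair [DecidableEq ι] (hb : UnitStable (traceDualBasis b)) : WeakFEPair ℂ where
  f := foldedThetaC b
  g := foldedThetaC (traceDualBasis b)
  k := finrank ℚ K / 2
  ε := ((√(absDiscr b))⁻¹ : ℝ)
  f₀ := unitCovolume K
  g₀ := unitCovolume K
  hf_int := locallyIntegrableOn_foldedThetaC
  hg_int := locallyIntegrableOn_foldedThetaC
  hk := by have : 0 < finrank ℚ K := finrank_pos; positivity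
  hε := by
    have := absDiscr_pos (b := b)
    simpa [Real.sqrt_eq_zero'] using this
  h_feq x hx := by
    have hx' : 0 < x := hx
    obtain ⟨-, -, -, -, hfin, -⟩ := exists_foldedTheta_bound b
    obtain ⟨-, -, -, -, hfin', -⟩ := exists_foldedTheta_bound (traceDualBasis b)
    have h := congr_arg ENNReal.toReal (foldedTheta_feq hb (inv_pos.mpr hx'))
    rw [inv_inv, ENNReal.toReal_add (volume_unitDomain_ne_top K) (hfin _ (inv_pos.mpr hx')),
      ENNReal.toReal_mul, ENNReal.toReal_add (volume_unitDomain_ne_top K) (hfin' _ hx'),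
      ENNReal.toReal_ofReal (by positivity)] at h
    have h2 : (√(absDiscr b * x⁻¹ ^ finrank ℚ K))⁻¹ =
        (√(absDiscr b))⁻¹ * x ^ ((finrank ℚ K : ℝ) / 2) := by
      rw [Real.sqrt_mul absDiscr_pos.le, mul_inv, inv_pow, Real.sqrt_inv, inv_inv,
        Real.sqrt_eq_rpow (x ^ _), ← Real.rpow_natCast x, ← Real.rpow_mul hx'.le]
      congr 2
      ring
    rw [h2] at h
    rw [foldedThetaC, foldedThetaC, smul_eq_mul, one_div, unitCovolume, h]
    push_cast
    ring
  hf_top := foldedThetaC_isBigO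
  hg_top := foldedThetaC_isBigO

end FoldedTheta

section GammaKernel

lemma integral_Ioi_eq_integral_exp (g : ℝ → ℂ) :
    ∫ t in Set.Ioi (0 : ℝ), g t = ∫ τ : ℝ, Real.exp τ • g (Real.exp τ) := by
  have := integral_image_eq_integral_abs_deriv_smul (s := Set.univ) (f := Real.exp)
    MeasurableSet.univ (fun x _ ↦ (Real.hasDerivAt_exp x).hasDerivWithinAt)
    Real.exp_injective.injOn g
  simpa [Set.image_univ, Real.range_exp, abs_of_pos (Real.exp_pos _)] using this

lemma integrableOn_Ioi_iff_exp (g : ℝ → ℂ) :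
    IntegrableOn g (Set.Ioi 0) ↔ Integrable fun τ : ℝ ↦ Real.exp τ • g (Real.exp τ) := by
  have := integrableOn_image_iff_integrableOn_abs_deriv_smul (s := Set.univ) (f := Real.exp)
    MeasurableSet.univ (fun x _ ↦ (Real.hasDerivAt_exp x).hasDerivWithinAt)
    Real.exp_injective.injOn g
  simpa [Set.image_univ, Real.range_exp, abs_of_pos (Real.exp_pos _)] using this

lemma exp_smul_cpow_sub_one (z : ℂ) (τ : ℝ) (w : ℂ) :
    Real.exp τ • (((Real.exp τ : ℝ) : ℂ) ^ (z - 1) * w) = Complex.exp (z * τ) * w := by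
  rw [Complex.real_smul, ← mul_assoc]
  congr 1
  rw [Complex.cpow_def_of_ne_zero (by exact_mod_cast (Real.exp_pos τ).ne'), ← Complex.ofReal_log
    (Real.exp_pos τ).le, Real.log_exp, Complex.ofReal_exp, ← Complex.exp_add]
  ring_nf

lemma ofReal_cpow_eq_exp {a : ℝ} (ha : 0 < a) (z : ℂ) :
    (a : ℂ) ^ z = Complex.exp (z * Real.log a) := by
  rw [Complex.cpow_def_of_ne_zero (by exact_mod_cast ha.ne'), Complex.ofReal_log ha.le, mul_comm]

/-- The integrand of the Gamma integral in logarithmic coordinates. -/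
def gammaKernel (z : ℂ) (a T : ℝ) : ℂ := Complex.exp (z * T) * Real.exp (-a * Real.exp T)

lemma norm_gammaKernel (z : ℂ) (a T : ℝ) :
    ‖gammaKernel z a T‖ = Real.exp (z.re * T) * Real.exp (-a * Real.exp T) := by
  rw [gammaKernel, norm_mul, Complex.norm_exp, Complex.norm_real, Real.norm_of_nonneg
    (Real.exp_pos _).le]
  simp

lemma continuous_gammaKernel (z : ℂ) (a : ℝ) : Continuous (gammaKernel z a) := by
  unfold gammaKernel
  fun_prop

lemma integrable_gammaKernel {z : ℂ} {a : ℝ} (hz : 0 < z.re) (ha : 0 < a) :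
    Integrable (gammaKernel z a) := by
  have h1 : IntegrableOn (fun t : ℝ ↦ ((t : ℝ) : ℂ) ^ ((z.re : ℂ) - 1) * Real.exp (-a * t))
      (Set.Ioi 0) := by
    have := (integrableOn_rpow_mul_exp_neg_mul_rpow (p := 1) (s := z.re - 1) (by linarith) one_pos
      ha).ofReal (𝕜 := ℂ)
    refine IntegrableOn.congr_fun this (fun t ht ↦ ?_) measurableSet_Ioi
    have ht' : (0 : ℝ) ≤ t := le_of_lt ht
    simp [Complex.ofReal_cpow ht']
  rw [integrableOn_Ioi_iff_exp] at h1
  simp only [exp_smul_cpow_sub_one] at h1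
  refine Integrable.mono (g := gammaKernel z.re a) h1
    (continuous_gammaKernel z a).aestronglyMeasurable (ae_of_all _ fun τ ↦ ?_)
  · rw [norm_gammaKernel, norm_gammaKernel, Complex.ofReal_re]

lemma integral_gammaKernel {z : ℂ} {a : ℝ} (hz : 0 < z.re) (ha : 0 < a) :
    ∫ T, gammaKernel z a T = (a : ℂ) ^ (-z) * Complex.Gamma z := by
  have h := Complex.integral_cpow_mul_exp_neg_mul_Ioi hz ha
  rw [integral_Ioi_eq_integral_exp] at h
  simp only [exp_smul_cpow_sub_one] at h
  rw [Complex.cpow_neg, ← one_div, ← Complex.ofReal_one, ← Complex.ofReal_div] at *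
  convert h using 2
  · ext T; simp [gammaKernel]
  · rw [Complex.ofReal_div, Complex.ofReal_one, one_div, one_div, Complex.inv_cpow]
    rw [Complex.arg_ofReal_of_nonneg ha.le]
    exact Real.pi_pos.ne

end GammaKernel

section PlaceCoordinates

open NumberField NumberField.InfinitePlace NumberField.Units NumberField.Units.dirichletUnitTheorem
open scoped Classical

variable {K : Type*} [Field K] [NumberField K]

variable (K) in
/-- Logarithmic coordinates on the product over the infinite places, as the scaling direction
together with the log space. -/
def placeCoord : (ℝ × logSpace K) ≃ₗ[ℝ] (InfinitePlace K → ℝ) where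
  toFun p v := p.1 + 2 * fullLog p.2 v / v.mult
  map_add' p p' := by ext v; simp only [Prod.fst_add, Prod.snd_add, fullLog_add, Pi.add_apply]; ring
  map_smul' c p := by
    ext v
    simp only [Prod.smul_fst, Prod.smul_snd, fullLog_smul, Pi.smul_apply, smul_eq_mul,
      RingHom.id_apply]
    ring
  invFun T := ((∑ v, v.mult * T v) / finrank ℚ K,
    fun w ↦ w.1.mult * (T w.1 - (∑ v, v.mult * T v) / finrank ℚ K) / 2)
  left_inv p := by
    have hn : (finrank ℚ K : ℝ) ≠ 0 := by exact_mod_cast finrank_pos.ne'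
    have h1 : (∑ v : InfinitePlace K, v.mult * (p.1 + 2 * fullLog p.2 v / v.mult)) /
        (finrank ℚ K : ℝ) = p.1 := by
      have : ∀ v : InfinitePlace K, v.mult * (p.1 + 2 * fullLog p.2 v / v.mult) =
          v.mult * p.1 + 2 * fullLog p.2 v := fun v ↦ by
        field_simp [mult_cast_ne_zero v]
      simp only [this, Finset.sum_add_distrib, ← Finset.sum_mul, ← Finset.mul_sum, sum_fullLog]
      rw [← Nat.cast_sum, sum_mult_eq]
      field_simp
      simp
    refine Prod.ext h1 ?_
    ext w
    simp only [h1]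
    have := mult_cast_ne_zero w.1
    simp only [fullLog, ne_eq, w.2, not_false_eq_true, dif_pos, add_sub_cancel_left]
    field_simp
  right_inv T := by
    have hn : (finrank ℚ K : ℝ) ≠ 0 := by exact_mod_cast finrank_pos.ne'
    set A := (∑ v, v.mult * T v) / (finrank ℚ K : ℝ) with hA
    ext v
    have hv := mult_cast_ne_zero v
    have h2 : fullLog (fun w : {w : InfinitePlace K // w ≠ w₀} ↦ w.1.mult * (T w.1 - A) / 2) v =
        v.mult * (T v - A) / 2 := by
      by_cases h0 : v = w₀
      · have h3 : ∑ v : InfinitePlace K, v.mult * (T v - A) / 2 = 0 := by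
          simp only [mul_sub, ← Finset.sum_div, Finset.sum_sub_distrib, ← Finset.sum_mul]
          rw [← Nat.cast_sum, sum_mult_eq, hA]
          field_simp
          simp
        rw [Fintype.sum_eq_add_sum_subtype_ne _ w₀] at h3
        simp only [fullLog, h0, ne_eq, not_true_eq_false, dif_neg, not_false_eq_true]
        linarith
      · simp [fullLog, h0]
    change A + 2 * fullLog (fun w : {w : InfinitePlace K // w ≠ w₀} ↦
      w.1.mult * (T w.1 - A) / 2) v / v.mult = T v
    rw [h2]
    field_simp
    ring

lemma placeCoord_apply (p : ℝ × logSpace K) (v : InfinitePlace K) :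
    placeCoord K p v = p.1 + 2 * fullLog p.2 v / v.mult := rfl

variable (K) in
lemma exists_map_placeCoord : ∃ c : ℝ, 0 < c ∧
    Measure.map (placeCoord K) volume = ENNReal.ofReal c • volume := by
  let L := (placeCoord K).toContinuousLinearEquiv
  have : (volume : Measure (ℝ × logSpace K)).IsAddHaarMeasure :=
    inferInstanceAs ((volume : Measure ℝ).prod (volume : Measure (logSpace K))).IsAddHaarMeasure
  have : (Measure.map L (volume : Measure (ℝ × logSpace K))).IsAddHaarMeasure :=
    L.isAddHaarMeasure_map _
  have h := Measure.isAddLeftInvariant_eq_smul (Measure.map L volume)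
    (volume : Measure (InfinitePlace K → ℝ))
  set c := Measure.addHaarScalarFactor (Measure.map L volume)
    (volume : Measure (InfinitePlace K → ℝ))
  have hc : 0 < c := Measure.addHaarScalarFactor_pos_of_isAddHaarMeasure _ _
  refine ⟨c, by exact_mod_cast hc, ?_⟩
  rw [ENNReal.ofReal_coe_nnreal]
  exact h

variable (K) in
/-- The Jacobian of `placeCoord`. -/
def placeJacobian : ℝ := (exists_map_placeCoord K).choose

variable (K) in
lemma placeJacobian_pos : 0 < placeJacobian K := (exists_map_placeCoord K).choose_spec.1

variable (K) in
lemma map_placeCoord : Measure.map (placeCoord K) volume =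
    ENNReal.ofReal (placeJacobian K) • volume := (exists_map_placeCoord K).choose_spec.2

variable (K) in
/-- The archimedean factor of the zeta function. -/
def archFactor (s : ℂ) : ℂ :=
  ∏ v : InfinitePlace K, ((Real.pi * v.mult : ℝ) : ℂ) ^ (-(v.mult * s / 2)) *
    Complex.Gamma (v.mult * s / 2)

lemma prod_gammaKernel (s : ℂ) (x : K) (p : ℝ × logSpace K) :
    ∏ v, gammaKernel (v.mult * s / 2) (Real.pi * v.mult * v x ^ 2) (placeCoord K p v) =
      Complex.exp (finrank ℚ K * s / 2 * p.1) *
        Real.exp (-Real.pi * placeForm (Real.exp p.1 • unitWeight p.2) x) := by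
  simp only [gammaKernel, Finset.prod_mul_distrib, ← Complex.exp_sum, ← Complex.ofReal_prod,
    ← Real.exp_sum]
  congr 2
  · have : ∀ v : InfinitePlace K, (v.mult * s / 2 : ℂ) * (placeCoord K p v : ℝ) =
        v.mult * (s / 2 * p.1) + s * (fullLog p.2 v : ℝ) := fun v ↦ by
      have hv : (v.mult : ℂ) ≠ 0 := by exact_mod_cast v.mult_ne_zero
      rw [placeCoord_apply]
      push_cast
      field_simp
    simp only [this, Finset.sum_add_distrib, ← Finset.sum_mul, ← Finset.mul_sum,
      ← Complex.ofReal_sum, sum_fullLog]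
    rw [← Nat.cast_sum, sum_mult_eq]
    push_cast
    ring
  · simp only [placeForm, Finset.mul_sum]
    refine congr_arg Real.exp (Finset.sum_congr rfl fun v _ ↦ ?_)
    rw [placeCoord_apply, Real.exp_add, Pi.smul_apply, smul_eq_mul, unitWeight]
    ring

omit [NumberField K] in
lemma placeKernel_pos {x : K} (hx : x ≠ 0) (v : InfinitePlace K) :
    0 < Real.pi * v.mult * v x ^ 2 := by
  have h1 : 0 < v x := v.pos_iff.mpr hx
  have h2 : 0 < v.mult := v.mult_pos
  have := Real.pi_pos
  positivity

omit [NumberField K] in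
lemma mult_mul_div_re_pos {s : ℂ} (hs : 0 < s.re) (v : InfinitePlace K) :
    0 < (v.mult * s / 2 : ℂ).re := by
  have h2 : 0 < v.mult := v.mult_pos
  have : (v.mult * s / 2 : ℂ).re = v.mult * s.re / 2 := by
    rw [show (v.mult * s / 2 : ℂ) = ((v.mult / 2 : ℝ) : ℂ) * s by push_cast; ring,
      Complex.re_ofReal_mul]
    ring
  rw [this]
  positivity

lemma integrable_placeKernel {s : ℂ} (hs : 0 < s.re) {x : K} (hx : x ≠ 0) :
    Integrable fun p : ℝ × logSpace K ↦ Complex.exp (finrank ℚ K * s / 2 * p.1) *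
        Real.exp (-Real.pi * placeForm (Real.exp p.1 • unitWeight p.2) x) := by
  simp only [← prod_gammaKernel]
  have h1 : Integrable fun T : InfinitePlace K → ℝ ↦
      ∏ v, gammaKernel (v.mult * s / 2) (Real.pi * v.mult * v x ^ 2) (T v) :=
    Integrable.fintype_prod fun v ↦
      integrable_gammaKernel (mult_mul_div_re_pos hs v) (placeKernel_pos hx v)
  have h2 := h1.smul_measure (c := ENNReal.ofReal (placeJacobian K)) ENNReal.ofReal_ne_top
  rw [← map_placeCoord] at h2
  exact (integrable_map_equiv
    (placeCoord K).toContinuousLinearEquiv.toHomeomorph.toMeasurableEquiv _).mp h2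

lemma integral_placeKernel {s : ℂ} (hs : 0 < s.re) {x : K} (hx : x ≠ 0) :
    ∫ p : ℝ × logSpace K, Complex.exp (finrank ℚ K * s / 2 * p.1) *
        Real.exp (-Real.pi * placeForm (Real.exp p.1 • unitWeight p.2) x) =
      placeJacobian K * archFactor K s * (((|Algebra.norm ℚ x| : ℚ) : ℝ) : ℂ) ^ (-s) := by
  simp only [← prod_gammaKernel]
  have h1 := integral_map_equiv (μ := volume)
    (placeCoord K).toContinuousLinearEquiv.toHomeomorph.toMeasurableEquiv
    fun T : InfinitePlace K → ℝ ↦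
      ∏ v, gammaKernel (v.mult * s / 2) (Real.pi * v.mult * v x ^ 2) (T v)
  refine h1.symm.trans ?_
  change ∫ T, _ ∂(Measure.map (placeCoord K) volume) = _
  rw [map_placeCoord, integral_smul_measure, ENNReal.toReal_ofReal (placeJacobian_pos K).le,
    integral_fintype_prod_volume_eq_prod
      fun v : InfinitePlace K ↦ gammaKernel (v.mult * s / 2) (Real.pi * v.mult * v x ^ 2),
    Complex.real_smul, mul_assoc]
  congr 1
  have h2 : (((|Algebra.norm ℚ x| : ℚ) : ℝ) : ℂ) ^ (-s) =
      ∏ v : InfinitePlace K, ((v x ^ 2 : ℝ) : ℂ) ^ (-(v.mult * s / 2)) := by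
    have hpos : ∀ v : InfinitePlace K, 0 < v x := fun v ↦ v.pos_iff.mpr hx
    rw [← prod_eq_abs_norm, ofReal_cpow_eq_exp (Finset.prod_pos fun v _ ↦ pow_pos (hpos v) _),
      Real.log_prod fun v _ ↦ (pow_pos (hpos v) _).ne', Complex.ofReal_sum, Finset.mul_sum,
      Complex.exp_sum]
    refine Finset.prod_congr rfl fun v _ ↦ ?_
    rw [ofReal_cpow_eq_exp (pow_pos (hpos v) _), Real.log_pow, Real.log_pow]
    push_cast
    ring_nf
  rw [archFactor, h2, ← Finset.prod_mul_distrib]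
  refine Finset.prod_congr rfl fun v _ ↦ ?_
  rw [integral_gammaKernel (mult_mul_div_re_pos hs v) (placeKernel_pos hx v), Complex.ofReal_mul,
    Complex.mul_cpow_ofReal_nonneg (by positivity) (by positivity)]
  ring

end PlaceCoordinates

section Unfolding

open NumberField NumberField.InfinitePlace NumberField.Units NumberField.Units.dirichletUnitTheorem
open scoped Classical

variable {K : Type*} [Field K] [NumberField K] {ι : Type*} [Fintype ι] (b : Basis ι ℚ K)

/-- Association of nonzero lattice vectors under the fundamental units. -/
def unitOrbit : Setoid (nonzeroLattice b) where
  r x y := ∃ m : Fin (rank K) → ℤ, (y.1 : K) = fundUnit m * (x.1 : K)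
  iseqv :=
    { refl := fun x ↦ ⟨0, by simp [fundUnit_zero]⟩
      symm := by
        rintro x y ⟨m, hm⟩
        refine ⟨-m, ?_⟩
        have : (fundUnit (-m) : (𝓞 K)ˣ) * fundUnit m = 1 := by
          rw [← fundUnit_add, neg_add_cancel, fundUnit_zero]
        rw [hm, ← mul_assoc, ← coe_mul, this, coe_one, one_mul]
      trans := by
        rintro x y z ⟨m, hm⟩ ⟨m', hm'⟩
        exact ⟨m' + m, by rw [hm', hm, fundUnit_add, coe_mul, mul_assoc]⟩ }

/-- Orbits of nonzero lattice vectors under the fundamental units. -/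
abbrev LatticeOrbit := Quotient (unitOrbit b)

instance : Countable (LatticeOrbit b) := by
  have : Countable (Submodule.span ℤ (Set.range b)) := (latticeCoord b).symm.injective.countable
  infer_instance

variable {b}

/-- A representative of an orbit. -/
def orbitRep (q : LatticeOrbit b) : K := (q.out.1 : K)

omit [Fintype ι] in
lemma orbitRep_mem (q : LatticeOrbit b) : orbitRep q ∈ Submodule.span ℤ (Set.range b) := q.out.1.2

omit [Fintype ι] in
lemma orbitRep_ne_zero (q : LatticeOrbit b) : orbitRep q ≠ 0 := fun h ↦ q.out.2 (Subtype.ext h)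

omit [Fintype ι] in
lemma bijective_unitMulEquiv_out (hb : UnitStable b) :
    Function.Bijective fun p : LatticeOrbit b × (Fin (rank K) → ℤ) ↦
      unitMulEquiv hb (fundUnit p.2) p.1.out := by
  constructor
  · rintro ⟨q, m⟩ ⟨q', m'⟩ h
    have h0 : (fundUnit m : K) * orbitRep q = fundUnit m' * orbitRep q' :=
      congr_arg (fun x : nonzeroLattice b ↦ (x.1 : K)) h
    have hq : q = q' := by
      rw [← q.out_eq, ← q'.out_eq]
      refine Quotient.sound ⟨-m' + m, ?_⟩
      have h1 : (fundUnit (-m') : (𝓞 K)ˣ) * fundUnit m' = 1 := by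
        rw [← fundUnit_add, neg_add_cancel, fundUnit_zero]
      rw [fundUnit_add, coe_mul, mul_assoc]
      change orbitRep q' = _ * (_ * orbitRep q)
      rw [h0, ← mul_assoc, ← coe_mul, h1, coe_one, one_mul]
    subst hq
    have h2 := mul_right_cancel₀ (orbitRep_ne_zero q) h0
    rw [fundUnit_injective (coe_injective K h2)]
  · intro x
    obtain ⟨m, hm⟩ := Quotient.mk_out (s := unitOrbit b) x
    exact ⟨(⟦x⟧, m), Subtype.ext (Subtype.ext hm.symm)⟩

/-- The integral over the log space of the theta term of one vector. -/
def orbitTheta (x : K) (t : ℝ) : ℝ≥0∞ :=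
  ∫⁻ h : logSpace K, ENNReal.ofReal (Real.exp (-Real.pi * placeForm (t • unitWeight h) x))

lemma continuous_placeForm_unitWeight (t : ℝ) (x : K) :
    Continuous fun h : logSpace K ↦ placeForm (t • unitWeight h) x := by
  have := continuous_unitWeight (K := K)
  simp only [placeForm, Pi.smul_apply, smul_eq_mul]
  fun_prop

lemma foldedTheta_eq_tsum_orbitTheta (hb : UnitStable b) (t : ℝ) :
    foldedTheta b t = ∑' q : LatticeOrbit b, orbitTheta (orbitRep q) t := by
  have hm : ∀ x : K, Measurable fun h : logSpace K ↦
      ENNReal.ofReal (Real.exp (-Real.pi * placeForm (t • unitWeight h) x)) := fun x ↦ by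
    have := (continuous_placeForm_unitWeight t x).measurable
    fun_prop
  have h1 : ∀ h : logSpace K, tailTheta b (t • unitWeight h) =
      ∑' q : LatticeOrbit b, ∑' m : Fin (rank K) → ℤ, ENNReal.ofReal (Real.exp (-Real.pi *
        placeForm (t • unitWeight (h + ∑ i, m i • logBasis K i)) (orbitRep q))) := fun h ↦ by
    rw [tailTheta, ← (Equiv.ofBijective _ (bijective_unitMulEquiv_out hb)).tsum_eq,
      ENNReal.tsum_prod']
    refine tsum_congr fun q ↦ tsum_congr fun m ↦ ?_
    rw [← logEmbedding_fundUnit, placeForm_unitWeight_add]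
    rfl
  have hm' : ∀ (m : Fin (rank K) → ℤ) (x : K), Measurable fun h : logSpace K ↦
      ENNReal.ofReal (Real.exp (-Real.pi *
        placeForm (t • unitWeight (h + ∑ i, m i • logBasis K i)) x)) := fun m x ↦
    (hm x).comp (measurable_add_const (∑ i, m i • logBasis K i))
  simp only [foldedTheta, h1]
  rw [lintegral_tsum fun q ↦ (Measurable.tsum fun m ↦ hm' m _).aemeasurable]
  refine tsum_congr fun q ↦ ?_
  rw [lintegral_tsum fun m ↦ (hm' m _).aemeasurable, orbitTheta,
    lintegral_eq_tsum_fundamentalDomain (logBasis K)]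

lemma orbitTheta_toReal (x : K) (t : ℝ) : (orbitTheta x t).toReal =
    ∫ h : logSpace K, Real.exp (-Real.pi * placeForm (t • unitWeight h) x) := by
  rw [integral_eq_lintegral_of_nonneg_ae (ae_of_all _ fun _ ↦ (Real.exp_pos _).le)]
  · rfl
  · have := continuous_placeForm_unitWeight t x
    exact Continuous.aestronglyMeasurable (by fun_prop)

theorem hasSum_mellin_foldedTheta (hb : UnitStable b) {s : ℂ} (hs : 0 < s.re)
    (hM : MellinConvergent (fun t ↦ ((foldedTheta b t).toReal : ℂ)) (finrank ℚ K * s / 2)) :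
    HasSum (fun q : LatticeOrbit b ↦ placeJacobian K * archFactor K s *
      (((|Algebra.norm ℚ (orbitRep q)| : ℚ) : ℝ) : ℂ) ^ (-s))
      (mellin (fun t ↦ ((foldedTheta b t).toReal : ℂ)) (finrank ℚ K * s / 2)) := by
  obtain ⟨-, -, -, -, hfin, -⟩ := exists_foldedTheta_bound b
  set F : LatticeOrbit b → ℝ → ℂ := fun q τ ↦ Complex.exp (finrank ℚ K * s / 2 * τ) *
    ((orbitTheta (orbitRep q) (Real.exp τ)).toReal : ℂ) with hF
  have hF' : ∀ q τ, F q τ = ∫ h : logSpace K, Complex.exp (finrank ℚ K * s / 2 * τ) *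
      Real.exp (-Real.pi * placeForm (Real.exp τ • unitWeight h) (orbitRep q)) := fun q τ ↦ by
    rw [integral_const_mul, integral_complex_ofReal, ← orbitTheta_toReal]
  have hintegr : ∀ q, Integrable (F q) := fun q ↦ by
    have := (integrable_placeKernel hs (orbitRep_ne_zero q)).integral_prod_left
    exact this.congr (ae_of_all _ fun τ ↦ (hF' q τ).symm)
  have hval : ∀ q, ∫ τ, F q τ = placeJacobian K * archFactor K s *
      (((|Algebra.norm ℚ (orbitRep q)| : ℚ) : ℝ) : ℂ) ^ (-s) := fun q ↦ by
    rw [← integral_placeKernel hs (orbitRep_ne_zero q)]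
    refine Eq.trans ?_ (integral_prod _ (integrable_placeKernel hs (orbitRep_ne_zero q))).symm
    simp only [hF']
  have hne : ∀ τ : ℝ, ∑' q : LatticeOrbit b, orbitTheta (orbitRep q) (Real.exp τ) ≠ ⊤ := fun τ ↦ by
    rw [← foldedTheta_eq_tsum_orbitTheta hb]
    exact hfin _ (Real.exp_pos τ)
  have hsum : ∀ τ : ℝ, HasSum (fun q ↦ F q τ)
      (Complex.exp (finrank ℚ K * s / 2 * τ) * ((foldedTheta b (Real.exp τ)).toReal : ℂ)) := by
    intro τ
    refine HasSum.mul_left _ (Complex.hasSum_ofReal.mpr ?_)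
    rw [foldedTheta_eq_tsum_orbitTheta hb, ENNReal.tsum_toReal_eq (ENNReal.ne_top_of_tsum_ne_top
      (hne τ))]
    exact (ENNReal.summable_toReal (hne τ)).hasSum
  have hM' : Integrable fun τ : ℝ ↦
      Complex.exp (finrank ℚ K * s / 2 * τ) * ((foldedTheta b (Real.exp τ)).toReal : ℂ) := by
    rw [MellinConvergent, integrableOn_Ioi_iff_exp] at hM
    simpa only [smul_eq_mul, exp_smul_cpow_sub_one] using hM
  have hnorm : Summable fun q ↦ ∫ τ, ‖F q τ‖ := by
    have h1 : ∀ q, ∫ τ, ‖F q τ‖ = (∫⁻ τ, ‖F q τ‖ₑ).toReal := fun q ↦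
      integral_norm_eq_lintegral_enorm (hintegr q).1
    simp only [h1]
    refine ENNReal.summable_toReal ?_
    rw [← lintegral_tsum fun q ↦ (hintegr q).1.enorm]
    have h2 : ∀ τ, ∑' q, ‖F q τ‖ₑ =
        ‖Complex.exp (finrank ℚ K * s / 2 * τ) * ((foldedTheta b (Real.exp τ)).toReal : ℂ)‖ₑ := by
      intro τ
      have h3 : ∀ x : ℝ≥0∞, x ≠ ⊤ → ‖((x.toReal : ℝ) : ℂ)‖ₑ = x := fun x hx ↦ by
        rw [← ofReal_norm, Complex.norm_real, Real.norm_of_nonneg ENNReal.toReal_nonneg,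
          ENNReal.ofReal_toReal hx]
      simp only [hF, enorm_mul, ENNReal.tsum_mul_left]
      rw [h3 _ (hfin _ (Real.exp_pos τ)), foldedTheta_eq_tsum_orbitTheta hb]
      congr 1
      exact tsum_congr fun q ↦ h3 _ (ENNReal.ne_top_of_tsum_ne_top (hne τ) q)
    simp only [h2]
    exact hM'.2.ne
  have h := hasSum_integral_of_summable_integral_norm hintegr hnorm
  simp only [hval, (hsum _).tsum_eq] at h
  have h4 : mellin (fun t ↦ ((foldedTheta b t).toReal : ℂ)) (finrank ℚ K * s / 2) =
      ∫ τ : ℝ, Complex.exp (finrank ℚ K * s / 2 * τ) *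
        ((foldedTheta b (Real.exp τ)).toReal : ℂ) := by
    rw [mellin, integral_Ioi_eq_integral_exp]
    simp only [smul_eq_mul, exp_smul_cpow_sub_one]
  rw [h4]
  exact h

end Unfolding

section IntegralLattices

open NumberField NumberField.InfinitePlace
open scoped Classical

variable (K : Type*) [Field K] [NumberField K]

lemma unitStable_integralBasis : UnitStable (integralBasis K) := by
  intro u x hx
  rw [mem_span_integralBasis] at hx ⊢
  exact mul_mem ⟨(u : 𝓞 K), rfl⟩ hx

variable {K}

lemma mem_span_traceDualBasis {x : K} :
    x ∈ Submodule.span ℤ (Set.range (traceDualBasis (integralBasis K))) ↔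
      ∀ y : 𝓞 K, ∃ n : ℤ, Algebra.trace ℚ K (x * y) = n := by
  rw [traceDualBasis, ← LinearMap.BilinForm.dualSubmodule_span_of_basis,
    LinearMap.BilinForm.mem_dualSubmodule]
  simp only [mem_span_integralBasis]
  constructor
  · intro h y
    obtain ⟨n, hn⟩ := Submodule.mem_one.mp (h y ⟨y, rfl⟩)
    exact ⟨n, by simpa using hn.symm⟩
  · rintro h _ ⟨y, rfl⟩
    obtain ⟨n, hn⟩ := h y
    exact Submodule.mem_one.mpr ⟨n, by simpa using hn.symm⟩

variable (K) in
lemma unitStable_traceDualBasis : UnitStable (traceDualBasis (integralBasis K)) := by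
  intro u x hx
  rw [mem_span_traceDualBasis] at hx ⊢
  intro y
  obtain ⟨n, hn⟩ := hx (u * y)
  refine ⟨n, hn ▸ congr_arg _ ?_⟩
  simp only [map_mul]
  ring

lemma one_le_abs_norm_of_mem {x : K} (hx : x ∈ Submodule.span ℤ (Set.range (integralBasis K)))
    (hx0 : x ≠ 0) : (1 : ℝ) ≤ ((|Algebra.norm ℚ x| : ℚ) : ℝ) := by
  rw [mem_span_integralBasis] at hx
  obtain ⟨y, rfl⟩ := hx
  have h := Algebra.coe_norm_int y
  have h0 : Algebra.norm ℤ y ≠ 0 := by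
    rw [ne_eq, Algebra.norm_eq_zero_iff]
    rintro rfl
    simp at hx0
  have h1 : (1 : ℤ) ≤ |Algebra.norm ℤ y| := Int.one_le_abs h0
  change (1 : ℝ) ≤ ((|Algebra.norm ℚ (y : K)| : ℚ) : ℝ)
  rw [← h]
  exact_mod_cast h1

lemma one_le_discr_mul_abs_norm_of_mem {x : K}
    (hx : x ∈ Submodule.span ℤ (Set.range (traceDualBasis (integralBasis K)))) (hx0 : x ≠ 0) :
    (1 : ℝ) ≤ |(discr K : ℝ)| * ((|Algebra.norm ℚ x| : ℚ) : ℝ) := by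
  rw [mem_span_traceDualBasis] at hx
  have h1 : ∀ i j, ∃ n : ℤ, Algebra.trace ℚ K (x * (integralBasis K i * integralBasis K j)) = n := by
    intro i j
    obtain ⟨n, hn⟩ := hx (RingOfIntegers.basis K i * RingOfIntegers.basis K j)
    exact ⟨n, by simpa [integralBasis_apply] using hn⟩
  choose M hM using h1
  have h2 : Algebra.traceMatrix ℚ (integralBasis K) *
      Algebra.leftMulMatrix (integralBasis K) x = (Matrix.of M).map (Int.cast : ℤ → ℚ) := by
    ext i j
    rw [Matrix.mul_apply, Matrix.map_apply, Matrix.of_apply, ← hM]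
    have h3 : ∑ k, Algebra.leftMulMatrix (integralBasis K) x k j • integralBasis K k =
        x * integralBasis K j := by
      rw [← (integralBasis K).sum_repr (x * integralBasis K j)]
      simp only [Algebra.leftMulMatrix_eq_repr_mul]
    rw [show x * (integralBasis K i * integralBasis K j) =
      integralBasis K i * (x * integralBasis K j) by ring, ← h3, Finset.mul_sum, map_sum]
    refine Finset.sum_congr rfl fun k _ ↦ ?_
    rw [mul_smul_comm, map_smul, Algebra.traceMatrix_apply, Algebra.traceForm_apply, smul_eq_mul,
      mul_comm]
  have h4 : (discr K : ℚ) * Algebra.norm ℚ x = ((Matrix.of M).det : ℤ) := by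
    rw [coe_discr, Algebra.discr_def, Algebra.norm_eq_matrix_det (integralBasis K),
      ← Matrix.det_mul, h2]
    exact ((Int.castRingHom ℚ).map_det _).symm
  have h5 : (Matrix.of M).det ≠ 0 := by
    intro h
    rw [h, Int.cast_zero, mul_eq_zero, Algebra.norm_eq_zero_iff] at h4
    exact h4.elim (by exact_mod_cast discr_ne_zero K) hx0
  have h6 : (1 : ℚ) ≤ |(discr K : ℚ)| * |Algebra.norm ℚ x| := by
    rw [← abs_mul, h4]
    exact_mod_cast Int.one_le_abs h5
  exact_mod_cast h6

end IntegralLattices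

section MellinBounds

lemma exists_norm_mellin_le {f : ℝ → ℂ} {α β : ℝ} (hα : MellinConvergent f α)
    (hβ : MellinConvergent f β) :
    ∃ C, ∀ s : ℂ, α ≤ s.re → s.re ≤ β → ‖mellin f s‖ ≤ C := by
  have hα' := hα.norm
  have hβ' := hβ.norm
  refine ⟨∫ t in Set.Ioi (0 : ℝ), (‖(t : ℂ) ^ ((α : ℂ) - 1) • f t‖ +
    ‖(t : ℂ) ^ ((β : ℂ) - 1) • f t‖), fun s h1 h2 ↦ ?_⟩
  refine norm_integral_le_of_norm_le (hα'.add hβ') ?_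
  refine (ae_restrict_iff' measurableSet_Ioi).mpr (ae_of_all _ fun t ht ↦ ?_)
  have ht' : (0 : ℝ) < t := ht
  simp only [norm_smul, Complex.norm_cpow_eq_rpow_re_of_pos ht', Complex.sub_re,
    Complex.ofReal_re, Complex.one_re]
  rw [← add_mul]
  gcongr
  rcases le_total 1 t with h | h
  · have := Real.rpow_le_rpow_of_exponent_le h (show s.re - 1 ≤ β - 1 by linarith)
    have := Real.rpow_nonneg ht'.le (α - 1)
    linarith
  · have := Real.rpow_le_rpow_of_exponent_ge ht' h (show α - 1 ≤ s.re - 1 by linarith)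
    have := Real.rpow_nonneg ht'.le (β - 1)
    linarith

lemma WeakFEPair.exists_norm_Λ₀_le (P : WeakFEPair ℂ) (α β : ℝ) :
    ∃ C, ∀ s : ℂ, α ≤ s.re → s.re ≤ β → ‖P.Λ₀ s‖ ≤ C :=
  exists_norm_mellin_le (P.isStrongFEPair_toStrongFEPair.hasMellin α).1
    (P.isStrongFEPair_toStrongFEPair.hasMellin β).1

/-- The completed zeta function of a pair, in the variable for which the critical strip has
width one, with its poles removed. -/
def WeakFEPair.regularized (P : WeakFEPair ℂ) (s : ℂ) : ℂ :=
  s * (1 - s) * P.Λ₀ (P.k * s) - (1 - s) / P.k * P.f₀ - s * P.ε / P.k * P.g₀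

variable (P : WeakFEPair ℂ)

lemma WeakFEPair.k_ne_zero : (P.k : ℂ) ≠ 0 := by exact_mod_cast P.hk.ne'

lemma WeakFEPair.regularized_eq {s : ℂ} (h0 : s ≠ 0) (h1 : s ≠ 1) :
    P.regularized s = s * (1 - s) * P.Λ (P.k * s) := by
  have hk := P.k_ne_zero
  have h1' : 1 - s ≠ 0 := sub_ne_zero.mpr h1.symm
  have h2 : (P.k : ℂ) - P.k * s ≠ 0 := by
    rw [show (P.k : ℂ) - P.k * s = P.k * (1 - s) by ring]
    exact mul_ne_zero hk h1'
  rw [regularized, WeakFEPair.Λ]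
  simp only [smul_eq_mul]
  rw [show (P.k : ℂ) - P.k * s = P.k * (1 - s) by ring]
  field_simp

lemma WeakFEPair.differentiable_regularized : Differentiable ℂ P.regularized := by
  have := P.differentiable_Λ₀
  unfold regularized
  fun_prop

lemma WeakFEPair.regularized_one_sub (s : ℂ) :
    P.regularized (1 - s) = P.ε * P.symm.regularized s := by
  have hk := P.k_ne_zero
  have hε := P.hε
  have h := P.functional_equation₀ (P.k * s)
  rw [show (P.k : ℂ) - P.k * s = P.k * (1 - s) by ring, smul_eq_mul] at h
  rw [regularized, regularized, h]
  change _ = P.ε * (s * (1 - s) * P.symm.Λ₀ (P.k * s) - (1 - s) / P.k * P.g₀ -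
    s * P.ε⁻¹ / P.k * P.f₀)
  field_simp
  ring

lemma WeakFEPair.exists_norm_regularized_le (α β : ℝ) :
    ∃ C, 0 ≤ C ∧ ∀ s : ℂ, α ≤ s.re → s.re ≤ β → ‖P.regularized s‖ ≤ C * (1 + ‖s‖) ^ 2 := by
  obtain ⟨C, hC⟩ := P.exists_norm_Λ₀_le (P.k * α) (P.k * β)
  refine ⟨|C| + ‖P.f₀‖ / P.k + ‖P.ε‖ / P.k * ‖P.g₀‖, ?_, fun s h1 h2 ↦ ?_⟩
  · have := P.hk
    positivity
  have hk := P.hk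
  have h3 : ‖P.Λ₀ (P.k * s)‖ ≤ |C| := by
    refine (hC _ ?_ ?_).trans (le_abs_self C)
    · rw [Complex.re_ofReal_mul]; gcongr
    · rw [Complex.re_ofReal_mul]; gcongr
  have h4 : ‖1 - s‖ ≤ 1 + ‖s‖ := by simpa using norm_sub_le 1 s
  have h5 : ‖(P.k : ℂ)‖ = P.k := by simp [abs_of_pos hk]
  have hs := norm_nonneg s
  have h6 : 1 + ‖s‖ ≤ (1 + ‖s‖) ^ 2 := by nlinarith
  have e1 : ‖s * (1 - s) * P.Λ₀ (P.k * s)‖ ≤ |C| * (1 + ‖s‖) ^ 2 := by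
    rw [norm_mul, norm_mul, mul_comm]
    gcongr
    nlinarith [norm_nonneg (1 - s)]
  have e2 : ‖(1 - s) / P.k * P.f₀‖ ≤ ‖P.f₀‖ / P.k * (1 + ‖s‖) ^ 2 := by
    rw [norm_mul, norm_div, h5, div_mul_eq_mul_div, div_mul_eq_mul_div, mul_comm]
    gcongr
    linarith
  have e3 : ‖s * P.ε / P.k * P.g₀‖ ≤ ‖P.ε‖ / P.k * ‖P.g₀‖ * (1 + ‖s‖) ^ 2 := by
    rw [norm_mul, norm_div, norm_mul, h5]
    have : ‖s‖ * ‖P.ε‖ / P.k * ‖P.g₀‖ = ‖P.ε‖ / P.k * ‖P.g₀‖ * ‖s‖ := by ring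
    rw [this]
    gcongr
    linarith
  calc _ ≤ ‖s * (1 - s) * P.Λ₀ (P.k * s)‖ + ‖(1 - s) / P.k * P.f₀‖ + ‖s * P.ε / P.k * P.g₀‖ := by
        unfold regularized
        exact (norm_sub_le _ _).trans (by gcongr; exact norm_sub_le _ _)
    _ ≤ _ := by linarith

end MellinBounds

section CompletedZeta

open NumberField NumberField.InfinitePlace
open scoped Classical

variable {K : Type*} [Field K] [NumberField K] {ι : Type*} [Fintype ι] {b : Basis ι ℚ K}

lemma archFactor_ne_zero {s : ℂ} (hs : 0 < s.re) : archFactor K s ≠ 0 := by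
  refine Finset.prod_ne_zero_iff.mpr fun v _ ↦ mul_ne_zero ?_
    (Complex.Gamma_ne_zero_of_re_pos (mult_mul_div_re_pos hs v))
  simp [Complex.cpow_eq_zero_iff]

instance : Nonempty (LatticeOrbit b) := by
  obtain ⟨i⟩ : Nonempty ι := b.index_nonempty
  exact ⟨⟦⟨⟨b i, Submodule.subset_span ⟨i, rfl⟩⟩,
    fun h ↦ b.ne_zero i (congr_arg Subtype.val h)⟩⟧⟩

/-- The absolute norm of the representative of an orbit. -/
def orbitNorm (q : LatticeOrbit b) : ℝ := ((|Algebra.norm ℚ (orbitRep q)| : ℚ) : ℝ)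

omit [Fintype ι] in
lemma orbitNorm_pos (q : LatticeOrbit b) : 0 < orbitNorm q := by
  have : 0 < |Algebra.norm ℚ (orbitRep q)| :=
    abs_pos.mpr (Algebra.norm_ne_zero_iff.mpr (orbitRep_ne_zero q))
  exact Rat.cast_pos.mpr this

variable (b) in
/-- The Dirichlet series of the norms of the vectors of a lattice modulo fundamental units. -/
def orbitZeta (σ : ℝ) : ℝ := ∑' q : LatticeOrbit b, orbitNorm q ^ (-σ)

/-- The pair `P` has the folded theta function of `b` as its first component. -/
structure IsThetaOf (P : WeakFEPair ℂ) (b : Basis ι ℚ K) : Prop where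
  f_eq : P.f = foldedThetaC b
  f₀_eq : P.f₀ = unitCovolume K
  k_eq : P.k = finrank ℚ K / 2

variable {P : WeakFEPair ℂ}

lemma IsThetaOf.hasSum (hP : IsThetaOf P b) (hb : UnitStable b) {s : ℂ} (hs : 1 < s.re) :
    HasSum (fun q : LatticeOrbit b ↦ placeJacobian K * archFactor K s *
      (orbitNorm q : ℂ) ^ (-s)) (P.Λ (P.k * s)) := by
  have h1 : P.k < (P.k * s : ℂ).re := by
    rw [Complex.re_ofReal_mul]
    exact lt_mul_of_one_lt_right P.hk hs
  have h2 := P.hasMellin h1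
  have h3 : (fun t ↦ P.f t - P.f₀) = fun t ↦ ((foldedTheta b t).toReal : ℂ) := by
    ext t
    rw [hP.f_eq, hP.f₀_eq, foldedThetaC]
    push_cast
    ring
  have h4 : (P.k * s : ℂ) = finrank ℚ K * s / 2 := by
    rw [hP.k_eq]
    push_cast
    ring
  rw [h3] at h2
  rw [← h2.2, h4]
  rw [h4] at h2
  exact hasSum_mellin_foldedTheta hb (by linarith) h2.1

lemma IsThetaOf.summable (hP : IsThetaOf P b) (hb : UnitStable b) {σ : ℝ} (hσ : 1 < σ) :
    Summable fun q : LatticeOrbit b ↦ orbitNorm q ^ (-σ) := by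
  have h := (hP.hasSum hb (s := σ) (by simpa using hσ)).summable
  rw [summable_mul_left_iff (mul_ne_zero (by exact_mod_cast (placeJacobian_pos K).ne')
    (archFactor_ne_zero (by simpa using by linarith)))] at h
  rw [← Complex.summable_ofReal]
  refine h.congr fun q ↦ ?_
  rw [Complex.ofReal_cpow (orbitNorm_pos q).le, Complex.ofReal_neg]

lemma IsThetaOf.orbitZeta_pos (hP : IsThetaOf P b) (hb : UnitStable b) {σ : ℝ} (hσ : 1 < σ) :
    0 < orbitZeta b σ :=
  (hP.summable hb hσ).tsum_pos (fun q ↦ (Real.rpow_pos_of_pos (orbitNorm_pos q) _).le)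
    (Classical.arbitrary _) (Real.rpow_pos_of_pos (orbitNorm_pos _) _)

lemma IsThetaOf.norm_le (hP : IsThetaOf P b) (hb : UnitStable b) {s : ℂ} (hs : 1 < s.re) :
    ‖P.Λ (P.k * s)‖ ≤ placeJacobian K * ‖archFactor K s‖ * orbitZeta b s.re := by
  rw [← (hP.hasSum hb hs).tsum_eq, orbitZeta, ← tsum_mul_left]
  have h1 : ∀ q : LatticeOrbit b, ‖placeJacobian K * archFactor K s * (orbitNorm q : ℂ) ^ (-s)‖ =
      placeJacobian K * ‖archFactor K s‖ * orbitNorm q ^ (-s.re) := fun q ↦ by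
    rw [norm_mul, norm_mul, Complex.norm_cpow_eq_rpow_re_of_pos (orbitNorm_pos q),
      Complex.norm_real, Real.norm_of_nonneg (placeJacobian_pos K).le, Complex.neg_re]
  simp only [← h1]
  refine norm_tsum_le_tsum_norm ?_
  simp only [h1]
  exact (hP.summable hb hs).mul_left _

lemma IsThetaOf.eq_ofReal (hP : IsThetaOf P b) (hb : UnitStable b) {σ : ℝ} (hσ : 1 < σ) :
    P.Λ (P.k * σ) = placeJacobian K * archFactor K σ * orbitZeta b σ := by
  rw [← (hP.hasSum hb (s := σ) (by simpa using hσ)).tsum_eq, orbitZeta, Complex.ofReal_tsum,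
    ← tsum_mul_left]
  refine tsum_congr fun q ↦ ?_
  rw [Complex.ofReal_cpow (orbitNorm_pos q).le, Complex.ofReal_neg]

lemma IsThetaOf.orbitZeta_anti (hP : IsThetaOf P b) (hb : UnitStable b) {A : ℝ} (hA : 0 < A)
    (hN : ∀ q : LatticeOrbit b, 1 ≤ A * orbitNorm q) {σ τ : ℝ} (hσ : 1 < σ) (hτ : σ ≤ τ) :
    A ^ (-τ) * orbitZeta b τ ≤ A ^ (-σ) * orbitZeta b σ := by
  rw [orbitZeta, orbitZeta, ← tsum_mul_left, ← tsum_mul_left]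
  refine Summable.tsum_le_tsum (fun q ↦ ?_) ((hP.summable hb (hσ.trans_le hτ)).mul_left _)
    ((hP.summable hb hσ).mul_left _)
  rw [← Real.mul_rpow hA.le (orbitNorm_pos q).le, ← Real.mul_rpow hA.le (orbitNorm_pos q).le]
  exact Real.rpow_le_rpow_of_exponent_le (hN q) (by linarith)

variable (K) in
/-- An entire function, symmetric about `1/2`, of polynomial growth in vertical strips, dominated
to the right of `1` by the square of the archimedean factor and with controlled decay. -/
theorem exists_symmetric_zeta : ∃ (F : ℂ → ℂ) (W : ℝ → ℝ), Differentiable ℂ F ∧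
    (∀ s, F (1 - s) = F s) ∧
    (∃ C, ∀ s : ℂ, -1 ≤ s.re → s.re ≤ 2 → ‖F s‖ ≤ C * (1 + ‖s‖) ^ 4) ∧
    (∀ σ, 1 < σ → 0 < W σ) ∧
    (∀ σ τ, 1 < σ → σ ≤ τ → |(discr K : ℝ)| ^ (-τ) * W τ ≤ |(discr K : ℝ)| ^ (-σ) * W σ) ∧
    (∀ σ : ℝ, 1 < σ → ‖F σ‖ = (‖(σ * (1 - σ) : ℂ)‖ * ‖archFactor K σ‖) ^ 2 * W σ) ∧
    (∀ s : ℂ, 1 < s.re → ‖F s‖ ≤ (‖s * (1 - s)‖ * ‖archFactor K s‖) ^ 2 * W s.re) := by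
  have hb := unitStable_integralBasis K
  have hb' := unitStable_traceDualBasis K
  set P := thetaPair hb' with hPdef
  have hP : IsThetaOf P (integralBasis K) := ⟨rfl, rfl, rfl⟩
  have hQ : IsThetaOf P.symm (traceDualBasis (integralBasis K)) := ⟨rfl, rfl, rfl⟩
  have hc := placeJacobian_pos K
  have hD : 0 < |(discr K : ℝ)| := abs_pos.mpr (by exact_mod_cast discr_ne_zero K)
  refine ⟨fun s ↦ P.regularized s * P.symm.regularized s, fun σ ↦ placeJacobian K ^ 2 *
    (orbitZeta (integralBasis K) σ * orbitZeta (traceDualBasis (integralBasis K)) σ),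
    P.differentiable_regularized.mul P.symm.differentiable_regularized, fun s ↦ ?_, ?_,
    fun σ hσ ↦ mul_pos (pow_pos hc 2) (mul_pos (hP.orbitZeta_pos hb hσ) (hQ.orbitZeta_pos hb' hσ)),
    fun σ τ hσ hτ ↦ ?_, fun σ hσ ↦ ?_, fun s hs ↦ ?_⟩
  · have h := P.regularized_one_sub (1 - s)
    rw [sub_sub_cancel] at h
    beta_reduce
    rw [P.regularized_one_sub, h]
    ring
  · obtain ⟨C₁, hC₁, h₁⟩ := P.exists_norm_regularized_le (-1) 2
    obtain ⟨C₂, hC₂, h₂⟩ := P.symm.exists_norm_regularized_le (-1) 2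
    refine ⟨C₁ * C₂, fun s hs hs' ↦ ?_⟩
    rw [norm_mul]
    calc _ ≤ (C₁ * (1 + ‖s‖) ^ 2) * (C₂ * (1 + ‖s‖) ^ 2) :=
          mul_le_mul (h₁ s hs hs') (h₂ s hs hs') (norm_nonneg _) (by positivity)
      _ = _ := by ring
  · have h1 := hP.orbitZeta_anti hb one_pos (fun q ↦ by
      rw [one_mul]; exact one_le_abs_norm_of_mem (orbitRep_mem q) (orbitRep_ne_zero q)) hσ hτ
    have h2 := hQ.orbitZeta_anti hb' hD (fun q ↦
      one_le_discr_mul_abs_norm_of_mem (orbitRep_mem q) (orbitRep_ne_zero q)) hσ hτ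
    simp only [Real.one_rpow, one_mul] at h1
    have h3 := mul_le_mul h1 h2 (mul_nonneg (Real.rpow_nonneg hD.le _)
      (hQ.orbitZeta_pos hb' (hσ.trans_le hτ)).le) (hP.orbitZeta_pos hb hσ).le
    have h4 := mul_le_mul_of_nonneg_left h3 (pow_pos hc 2).le
    linarith
  · have h0 : (σ : ℂ) ≠ 0 := by exact_mod_cast (by linarith : σ ≠ 0)
    have h1 : (σ : ℂ) ≠ 1 := by exact_mod_cast hσ.ne'
    beta_reduce
    rw [P.regularized_eq h0 h1, P.symm.regularized_eq h0 h1, hP.eq_ofReal hb hσ,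
      hQ.eq_ofReal hb' hσ]
    simp only [norm_mul, Complex.norm_real, Real.norm_of_nonneg hc.le,
      Real.norm_of_nonneg (hP.orbitZeta_pos hb hσ).le,
      Real.norm_of_nonneg (hQ.orbitZeta_pos hb' hσ).le]
    ring
  · have h0 : s ≠ 0 := by rintro rfl; norm_num at hs
    have h1 : s ≠ 1 := by rintro rfl; norm_num at hs
    beta_reduce
    rw [P.regularized_eq h0 h1, P.symm.regularized_eq h0 h1, norm_mul, norm_mul (s * (1 - s)),
      norm_mul (s * (1 - s))]
    have e1 := hP.norm_le hb hs
    have e2 := hQ.norm_le hb' hs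
    have h3 := mul_le_mul e1 e2 (norm_nonneg _) (by
      have := (hP.orbitZeta_pos hb hs).le
      positivity)
    have h4 := mul_le_mul_of_nonneg_left h3 (sq_nonneg ‖s * (1 - s)‖)
    linarith

end CompletedZeta

section GammaModulus

open Complex

lemma Complex.norm_Gamma_le_Gamma_re {s : ℂ} (hs : 0 < s.re) :
    ‖Gamma s‖ ≤ Real.Gamma s.re := by
  rw [Gamma_eq_integral hs, GammaIntegral, Real.Gamma_eq_integral hs]
  refine (norm_integral_le_integral_norm _).trans_eq ?_
  refine setIntegral_congr_fun measurableSet_Ioi fun t ht ↦ ?_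
  have ht' : (0 : ℝ) < t := ht
  rw [norm_mul, norm_cpow_eq_rpow_re_of_pos ht', norm_real,
    Real.norm_of_nonneg (Real.exp_pos _).le, sub_re, one_re]

lemma Complex.norm_betaIntegral_le {s : ℂ} {d : ℝ} :
    ‖betaIntegral s d‖ ≤ ‖betaIntegral s.re d‖ := by
  have h : betaIntegral s.re d = ((∫ x in (0 : ℝ)..1, x ^ (s.re - 1) * (1 - x) ^ (d - 1) : ℝ) : ℂ) := by
    rw [betaIntegral, ← intervalIntegral.integral_ofReal]
    refine intervalIntegral.integral_congr fun x hx ↦ ?_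
    rw [Set.uIcc_of_le zero_le_one] at hx
    push_cast
    rw [ofReal_cpow hx.1, ofReal_cpow (sub_nonneg.mpr hx.2)]
    push_cast
    rfl
  rw [h, norm_real, betaIntegral]
  refine (intervalIntegral.norm_integral_le_integral_norm zero_le_one).trans ?_
  refine le_trans (le_of_eq ?_) (le_abs_self _)
  rw [intervalIntegral.integral_of_le zero_le_one, intervalIntegral.integral_of_le zero_le_one,
    integral_Ioc_eq_integral_Ioo, integral_Ioc_eq_integral_Ioo]
  refine setIntegral_congr_fun measurableSet_Ioo fun x hx ↦ ?_
  have h1 : (0 : ℝ) < 1 - x := sub_pos.mpr hx.2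
  have h2 : (1 - (x : ℂ)) = ((1 - x : ℝ) : ℂ) := by push_cast; rfl
  simp only [norm_mul, norm_cpow_eq_rpow_re_of_pos hx.1]
  rw [h2, norm_cpow_eq_rpow_re_of_pos h1]
  simp

/-- The ratio `‖Γ(s)‖ / Γ(Re s)` increases with the real part of `s`. -/
lemma Complex.norm_Gamma_mul_le {s : ℂ} (hs : 0 < s.re) {d : ℝ} (hd : 0 ≤ d) :
    ‖Gamma s‖ * Real.Gamma (s.re + d) ≤ ‖Gamma (s + d)‖ * Real.Gamma s.re := by
  rcases hd.eq_or_lt with rfl | hd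
  · simp
  have hdd : 0 < (d : ℂ).re := by simpa using hd
  have h1 := congrArg norm (Gamma_mul_Gamma_eq_betaIntegral hs hdd)
  have h2 := congrArg norm (Gamma_mul_Gamma_eq_betaIntegral (s := (s.re : ℂ)) (by simpa using hs) hdd)
  rw [← ofReal_add] at h2
  simp only [norm_mul, Gamma_ofReal, norm_real, Real.norm_eq_abs,
    abs_of_pos (Real.Gamma_pos_of_pos hs), abs_of_pos (Real.Gamma_pos_of_pos hd),
    abs_of_pos (Real.Gamma_pos_of_pos (add_pos hs hd))] at h1 h2
  have h3 := norm_betaIntegral_le (s := s) (d := d)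
  have hG := Real.Gamma_pos_of_pos hd
  refine le_of_mul_le_mul_right ?_ hG
  calc ‖Gamma s‖ * Real.Gamma (s.re + d) * Real.Gamma d
      = ‖Gamma (s + d)‖ * (Real.Gamma (s.re + d) * ‖betaIntegral s d‖) := by
        rw [mul_right_comm, h1]; ring
    _ ≤ ‖Gamma (s + d)‖ * (Real.Gamma (s.re + d) * ‖betaIntegral s.re d‖) := by
        have := (Real.Gamma_pos_of_pos (add_pos hs hd)).le
        gcongr
    _ = _ := by rw [← h2]; ring

lemma Complex.norm_Gamma_half_add_mul_I (τ : ℝ) :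
    Real.Gamma (1 / 2) * Real.exp (-(Real.pi * |τ| / 2)) ≤ ‖Gamma (1 / 2 + τ * I)‖ := by
  have h := congrArg norm (Gamma_mul_Gamma_one_sub (1 / 2 + τ * I))
  have h1 : (1 : ℂ) - (1 / 2 + τ * I) = (starRingEnd ℂ) (1 / 2 + τ * I) := by
    simp only [map_add, map_mul, conj_ofReal, conj_I, map_div₀, map_one]
    rw [show (starRingEnd ℂ) 2 = 2 from conj_ofReal 2]
    ring
  have h2 : (Real.pi : ℂ) * (1 / 2 + τ * I) = Real.pi / 2 - (-(Real.pi * τ : ℝ) : ℂ) * I := by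
    push_cast; ring
  rw [h1, Gamma_conj, norm_mul, norm_conj, h2, sin_pi_div_two_sub, cos_mul_I, ← ofReal_neg,
    ← ofReal_cosh, norm_div, norm_real, norm_real, Real.norm_eq_abs, Real.norm_eq_abs,
    abs_of_pos Real.pi_pos, abs_of_pos (Real.cosh_pos _), Real.cosh_neg] at h
  have hcosh : Real.cosh (Real.pi * τ) ≤ Real.exp (Real.pi * |τ|) := by
    rw [← Real.cosh_abs, abs_mul, abs_of_pos Real.pi_pos]
    have : Real.sinh (Real.pi * |τ|) ≥ 0 := Real.sinh_nonneg_iff.mpr (by positivity)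
    rw [← Real.cosh_add_sinh]
    linarith
  refine le_of_sq_le_sq ?_ (norm_nonneg _)
  rw [sq ‖_‖, h, mul_pow, Real.Gamma_one_half_eq, Real.sq_sqrt Real.pi_pos.le, ← Real.exp_nat_mul]
  have : Real.exp ((2 : ℕ) * -(Real.pi * |τ| / 2)) = (Real.exp (Real.pi * |τ|))⁻¹ := by
    rw [← Real.exp_neg]; congr 1; push_cast; ring
  rw [this, div_eq_mul_inv]
  have := Real.cosh_pos (Real.pi * τ)
  gcongr

lemma Complex.Gamma_re_mul_exp_le_norm_Gamma {s : ℂ} (hs : 1 / 2 ≤ s.re) :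
    Real.Gamma s.re * Real.exp (-(Real.pi * |s.im| / 2)) ≤ ‖Gamma s‖ := by
  have h1 := norm_Gamma_half_add_mul_I s.im
  have h2 := norm_Gamma_mul_le (s := 1 / 2 + s.im * I) (by simp) (sub_nonneg.mpr hs)
  have hre : (1 / 2 + s.im * I : ℂ).re = 1 / 2 := by simp
  rw [hre, show (1 / 2 + s.im * I : ℂ) + ((s.re - 1 / 2 : ℝ) : ℂ) = s by
    conv_rhs => rw [← re_add_im s]
    push_cast; ring, show (1 / 2 + (s.re - 1 / 2) : ℝ) = s.re by ring] at h2
  have hG : 0 < Real.Gamma (1 / 2) := Real.Gamma_pos_of_pos (by norm_num)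
  have hG' : 0 < Real.Gamma s.re := Real.Gamma_pos_of_pos (by linarith)
  refine le_of_mul_le_mul_right ?_ hG
  refine le_trans ?_ h2
  calc _ = Real.Gamma (1 / 2) * Real.exp (-(Real.pi * |s.im| / 2)) * Real.Gamma s.re := by ring
    _ ≤ _ := by gcongr

end GammaModulus

section GammaRatio

open Complex

/-- An even function of `y` in the strip `|Re y| ≤ h / 2` whose modulus on the boundary is
`‖Γ(x + iτ)‖ / ‖Γ(x + 2h + iτ)‖`. -/
def gammaRatio (x h : ℝ) (y : ℂ) : ℂ :=
  Gamma ((x + h / 2 : ℝ) + y) * Gamma ((x + h / 2 : ℝ) - y) /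
    (Gamma ((x + 3 * h / 2 : ℝ) + y) * Gamma ((x + 3 * h / 2 : ℝ) - y))

lemma gammaRatio_neg (x h : ℝ) (y : ℂ) : gammaRatio x h (-y) = gammaRatio x h y := by
  rw [gammaRatio, gammaRatio, sub_neg_eq_add, ← sub_eq_add_neg, ← sub_eq_add_neg, sub_neg_eq_add,
    mul_comm (Gamma (_ - y)), mul_comm (Gamma (_ - y))]

variable {x h : ℝ} {y : ℂ}

lemma gammaRatio_ne_zero (hx : 0 < x) (hh : 0 < h) (hy : |y.re| ≤ h / 2) :
    gammaRatio x h y ≠ 0 := by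
  obtain ⟨h1, h2⟩ := abs_le.mp hy
  refine div_ne_zero (mul_ne_zero ?_ ?_) (mul_ne_zero ?_ ?_) <;>
  · refine Gamma_ne_zero_of_re_pos ?_
    simp only [add_re, sub_re, ofReal_re]
    linarith

lemma differentiableAt_Gamma_of_re_pos {s : ℂ} (hs : 0 < s.re) : DifferentiableAt ℂ Gamma s := by
  refine differentiableAt_Gamma s fun m hm ↦ ?_
  have : s.re = -m := by rw [hm]; simp
  have : (0 : ℝ) ≤ m := m.cast_nonneg
  linarith

lemma differentiableAt_gammaRatio (hx : 0 < x) (hh : 0 < h) (hy : |y.re| ≤ h / 2) :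
    DifferentiableAt ℂ (gammaRatio x h) y := by
  obtain ⟨h1, h2⟩ := abs_le.mp hy
  have hp (c : ℝ) (hc : h / 2 < c) : DifferentiableAt ℂ (fun y : ℂ ↦ Gamma ((c : ℂ) + y)) y := by
    refine DifferentiableAt.comp y (g := Gamma) (differentiableAt_Gamma_of_re_pos ?_) (by fun_prop)
    simp only [add_re, ofReal_re]; linarith
  have hm (c : ℝ) (hc : h / 2 < c) : DifferentiableAt ℂ (fun y : ℂ ↦ Gamma ((c : ℂ) - y)) y := by
    refine DifferentiableAt.comp y (g := Gamma) (differentiableAt_Gamma_of_re_pos ?_) (by fun_prop)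
    simp only [sub_re, ofReal_re]; linarith
  refine ((hp _ (by linarith)).mul (hm _ (by linarith))).div
    ((hp _ (by linarith)).mul (hm _ (by linarith))) (mul_ne_zero ?_ ?_) <;>
  · refine Gamma_ne_zero_of_re_pos ?_
    simp only [add_re, sub_re, ofReal_re]
    linarith

lemma norm_Gamma_add_mul_I_eq_sub (c τ : ℝ) : ‖Gamma (c + τ * I)‖ = ‖Gamma (c - τ * I)‖ := by
  rw [← norm_conj, ← Gamma_conj]
  simp [sub_eq_add_neg]

lemma norm_gammaRatio_boundary (hx : 0 < x) (hh : 0 < h) (τ : ℝ) :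
    ‖gammaRatio x h ((h / 2 : ℝ) + τ * I)‖ =
      ‖Gamma (x + τ * I)‖ / ‖Gamma ((x + 2 * h : ℝ) + τ * I)‖ := by
  have h0 : ‖Gamma ((x + h : ℝ) - τ * I)‖ ≠ 0 :=
    norm_ne_zero_iff.mpr (Gamma_ne_zero_of_re_pos (by simp; linarith))
  rw [gammaRatio, show ((x + h / 2 : ℝ) : ℂ) + ((h / 2 : ℝ) + τ * I) = (x + h : ℝ) + τ * I by
      push_cast; ring,
    show ((x + h / 2 : ℝ) : ℂ) - ((h / 2 : ℝ) + τ * I) = x - τ * I by push_cast; ring,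
    show ((x + 3 * h / 2 : ℝ) : ℂ) + ((h / 2 : ℝ) + τ * I) = (x + 2 * h : ℝ) + τ * I by
      push_cast; ring,
    show ((x + 3 * h / 2 : ℝ) : ℂ) - ((h / 2 : ℝ) + τ * I) = (x + h : ℝ) - τ * I by
      push_cast; ring, norm_div, norm_mul, norm_mul, norm_Gamma_add_mul_I_eq_sub (x + h),
    norm_Gamma_add_mul_I_eq_sub x, mul_comm ‖Gamma ((x + h : ℝ) - τ * I)‖,
    mul_div_mul_right _ _ h0]

lemma exists_norm_gammaRatio_inv_le (hx : 1 / 2 ≤ x) (hh : 0 < h) :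
    ∃ M, 0 ≤ M ∧ ∀ y : ℂ, |y.re| ≤ h / 2 →
      ‖(gammaRatio x h y)⁻¹‖ ≤ M * Real.exp (Real.pi * |y.im|) := by
  have hc : ContinuousOn (fun r : ℝ ↦ Real.Gamma (x + 3 * h / 2 + r) *
      Real.Gamma (x + 3 * h / 2 - r) / (Real.Gamma (x + h / 2 + r) * Real.Gamma (x + h / 2 - r)))
      (Set.Icc (-(h / 2)) (h / 2)) := by
    have hp (c : ℝ) (hc : h / 2 < c) :
        ContinuousOn (fun r : ℝ ↦ Real.Gamma (c + r)) (Set.Icc (-(h / 2)) (h / 2)) := by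
      refine Real.differentiableOn_Gamma_Ioi.continuousOn.comp (by fun_prop) fun r hr ↦ ?_
      have := hr.1
      simp only [Set.mem_Ioi]; linarith
    have hm (c : ℝ) (hc : h / 2 < c) :
        ContinuousOn (fun r : ℝ ↦ Real.Gamma (c - r)) (Set.Icc (-(h / 2)) (h / 2)) := by
      refine Real.differentiableOn_Gamma_Ioi.continuousOn.comp (by fun_prop) fun r hr ↦ ?_
      have := hr.2
      simp only [Set.mem_Ioi]; linarith
    refine ((hp _ (by linarith)).mul (hm _ (by linarith))).div
      ((hp _ (by linarith)).mul (hm _ (by linarith))) fun r hr ↦ ?_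
    have h1 := hr.1
    have h2 := hr.2
    exact (mul_pos (Real.Gamma_pos_of_pos (by linarith)) (Real.Gamma_pos_of_pos (by linarith))).ne'
  obtain ⟨M, hM⟩ := isCompact_Icc.exists_bound_of_continuousOn hc
  refine ⟨max M 0, le_max_right _ _, fun y hy ↦ ?_⟩
  obtain ⟨h1, h2⟩ := abs_le.mp hy
  have hM' := (Real.le_norm_self _).trans ((hM y.re ⟨h1, h2⟩).trans (le_max_left M 0))
  have hup (c : ℝ) (hc : h / 2 < c) : ‖Gamma (c + y)‖ ≤ Real.Gamma (c + y.re) ∧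
      ‖Gamma (c - y)‖ ≤ Real.Gamma (c - y.re) := by
    constructor
    · simpa using norm_Gamma_le_Gamma_re (s := c + y) (by simp; linarith)
    · simpa using norm_Gamma_le_Gamma_re (s := c - y) (by simp; linarith)
  have hl1 := Gamma_re_mul_exp_le_norm_Gamma (s := (x + h / 2 : ℝ) + y)
    (by simp only [add_re, ofReal_re]; linarith)
  have hl2 := Gamma_re_mul_exp_le_norm_Gamma (s := (x + h / 2 : ℝ) - y)
    (by simp only [sub_re, ofReal_re]; linarith)
  simp only [add_re, sub_re, ofReal_re, add_im, sub_im, ofReal_im, zero_add, zero_sub, abs_neg]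
    at hl1 hl2
  obtain ⟨hu1, hu2⟩ := hup (x + 3 * h / 2) (by linarith)
  have hp1 : 0 < Real.Gamma (x + h / 2 + y.re) := Real.Gamma_pos_of_pos (by linarith)
  have hp2 : 0 < Real.Gamma (x + h / 2 - y.re) := Real.Gamma_pos_of_pos (by linarith)
  have hp3 : 0 < Real.Gamma (x + 3 * h / 2 + y.re) := Real.Gamma_pos_of_pos (by linarith)
  have hp4 : 0 < Real.Gamma (x + 3 * h / 2 - y.re) := Real.Gamma_pos_of_pos (by linarith)
  rw [gammaRatio, inv_div, norm_div, norm_mul, norm_mul]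
  have he : Real.exp (-(Real.pi * |y.im| / 2)) * Real.exp (-(Real.pi * |y.im| / 2)) =
      (Real.exp (Real.pi * |y.im|))⁻¹ := by
    rw [← Real.exp_add, ← Real.exp_neg]; congr 1; ring
  calc _ ≤ Real.Gamma (x + 3 * h / 2 + y.re) * Real.Gamma (x + 3 * h / 2 - y.re) /
        (Real.Gamma (x + h / 2 + y.re) * Real.exp (-(Real.pi * |y.im| / 2)) *
          (Real.Gamma (x + h / 2 - y.re) * Real.exp (-(Real.pi * |y.im| / 2)))) := by
        have := mul_pos hp1 (Real.exp_pos (-(Real.pi * |y.im| / 2)))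
        have := mul_pos hp2 (Real.exp_pos (-(Real.pi * |y.im| / 2)))
        gcongr
    _ = Real.Gamma (x + 3 * h / 2 + y.re) * Real.Gamma (x + 3 * h / 2 - y.re) /
        (Real.Gamma (x + h / 2 + y.re) * Real.Gamma (x + h / 2 - y.re)) *
          Real.exp (Real.pi * |y.im|) := by
        rw [mul_mul_mul_comm, he, div_mul_eq_div_div _ _ (Real.exp _)⁻¹, div_inv_eq_mul]
    _ ≤ _ := by gcongr

/-- A product of `gammaRatio`s whose boundary modulus telescopes. -/
def gammaRatioProd (x h : ℝ) (L : ℕ) (y : ℂ) : ℂ :=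
  ∏ l ∈ Finset.range L, gammaRatio (x + 2 * h * l) h y

lemma gammaRatioProd_neg (x h : ℝ) (L : ℕ) (y : ℂ) :
    gammaRatioProd x h L (-y) = gammaRatioProd x h L y := by
  simp only [gammaRatioProd, gammaRatio_neg]

lemma gammaRatioProd_ne_zero (hx : 0 < x) (hh : 0 < h) (L : ℕ) (hy : |y.re| ≤ h / 2) :
    gammaRatioProd x h L y ≠ 0 :=
  Finset.prod_ne_zero_iff.mpr fun _ _ ↦ gammaRatio_ne_zero (by positivity) hh hy

lemma differentiableAt_gammaRatioProd (hx : 0 < x) (hh : 0 < h) (L : ℕ) (hy : |y.re| ≤ h / 2) :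
    DifferentiableAt ℂ (gammaRatioProd x h L) y := by
  unfold gammaRatioProd
  exact DifferentiableAt.fun_finsetProd fun _ _ ↦
    differentiableAt_gammaRatio (by positivity) hh hy

lemma norm_gammaRatioProd_boundary (hx : 0 < x) (hh : 0 < h) (L : ℕ) (τ : ℝ) :
    ‖gammaRatioProd x h L ((h / 2 : ℝ) + τ * I)‖ =
      ‖Gamma (x + τ * I)‖ / ‖Gamma ((x + 2 * h * L : ℝ) + τ * I)‖ := by
  have hne (l : ℕ) : ‖Gamma ((x + 2 * h * l : ℝ) + τ * I)‖ ≠ 0 :=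
    norm_ne_zero_iff.mpr (Gamma_ne_zero_of_re_pos (by simp; positivity))
  induction L with
  | zero => have := hne 0; simp [gammaRatioProd] at this ⊢; rw [div_self]; simpa using this
  | succ L ih =>
    rw [gammaRatioProd, Finset.prod_range_succ, norm_mul, ← gammaRatioProd, ih,
      norm_gammaRatio_boundary (by positivity) hh, div_mul_div_cancel₀ (hne L)]
    congr 4
    push_cast; ring

lemma norm_Gamma_mul_norm_gammaRatioProd_le (hx : 0 < x) (hh : 0 < h) (L : ℕ) (τ : ℝ) :
    ‖Gamma (x + τ * I)‖ * ‖gammaRatioProd x h L (h / 2 : ℝ)‖ ≤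
      ‖Gamma x‖ * ‖gammaRatioProd x h L ((h / 2 : ℝ) + τ * I)‖ := by
  have h0 := norm_gammaRatioProd_boundary hx hh L 0
  simp only [ofReal_zero, zero_mul, add_zero] at h0
  have hpos : 0 < x + 2 * h * L := by positivity
  have h1 := norm_Gamma_le_Gamma_re (s := (x + 2 * h * L : ℝ) + τ * I) (by simpa using hpos)
  have h2 : 0 < ‖Gamma ((x + 2 * h * L : ℝ) + τ * I)‖ :=
    norm_pos_iff.mpr (Gamma_ne_zero_of_re_pos (by simpa using hpos))
  rw [norm_gammaRatioProd_boundary hx hh, h0, Gamma_ofReal (x + 2 * h * L), norm_real,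
    Real.norm_of_nonneg (Real.Gamma_pos_of_pos hpos).le, mul_div_left_comm]
  simp only [add_re, ofReal_re, mul_re, I_re, mul_zero, ofReal_im, I_im, mul_one, sub_self,
    add_zero] at h1
  gcongr

lemma exists_norm_gammaRatioProd_inv_le (hx : 1 / 2 ≤ x) (hh : 0 < h) (L : ℕ) :
    ∃ M, 0 ≤ M ∧ ∀ y : ℂ, |y.re| ≤ h / 2 →
      ‖(gammaRatioProd x h L y)⁻¹‖ ≤ M * Real.exp (L * Real.pi * |y.im|) := by
  have hl (l : ℕ) : 1 / 2 ≤ x + 2 * h * l := by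
    have : 0 ≤ 2 * h * l := by positivity
    linarith
  choose M hM0 hM using fun l ↦ exists_norm_gammaRatio_inv_le (hl l) hh
  refine ⟨∏ l ∈ Finset.range L, M l, Finset.prod_nonneg fun l _ ↦ hM0 l, fun y hy ↦ ?_⟩
  rw [gammaRatioProd, ← Finset.prod_inv_distrib, norm_prod]
  calc _ ≤ ∏ l ∈ Finset.range L, (M l * Real.exp (Real.pi * |y.im|)) :=
        Finset.prod_le_prod (fun _ _ ↦ norm_nonneg _) fun l _ ↦ hM l y hy
    _ = _ := by
        rw [Finset.prod_mul_distrib, Finset.prod_const, Finset.card_range, ← Real.exp_nat_mul]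
        ring_nf

end GammaRatio

section EvenStrip

open Complex Filter

/-- Phragmen–Lindelöf for an even function in a symmetric strip. -/
lemma norm_le_of_even_strip {Q : ℂ → ℂ} {a M B C : ℝ} (ha : 0 < a) (hM : 0 ≤ M)
    (heven : ∀ z, Q (-z) = Q z) (hd : ∀ z : ℂ, |z.re| ≤ a → DifferentiableAt ℂ Q z)
    (hgrowth : ∀ z : ℂ, |z.re| ≤ a → ‖Q z‖ ≤ M * Real.exp (B * |z.im|))
    (hC : ∀ t : ℝ, ‖Q (a + t * I)‖ ≤ C) {z : ℂ} (hz : |z.re| ≤ a) : ‖Q z‖ ≤ C := by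
  obtain ⟨h1, h2⟩ := abs_le.mp hz
  have hright (w : ℂ) (hw : w.re = a) : ‖Q w‖ ≤ C := by
    have := hC w.im
    rwa [← hw, re_add_im] at this
  set c : ℝ := Real.pi / (4 * a) with hc
  have hcpos : 0 < c := by have := Real.pi_pos; positivity
  refine PhragmenLindelof.vertical_strip (a := -a) (b := a) (f := Q) ?_ ?_ (fun w hw ↦ ?_)
    hright h1 h2
  · refine DifferentiableOn.diffContOnCl fun w hw ↦ (hd w ?_).differentiableWithinAt
    have := closure_minimal (t := re ⁻¹' Set.Icc (-a) a) (Set.preimage_mono Set.Ioo_subset_Icc_self)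
      (isClosed_Icc.preimage continuous_re) hw
    exact abs_le.mpr this
  · refine ⟨c, ?_, |B| / c, ?_⟩
    · rw [hc, sub_neg_eq_add]
      have := Real.pi_pos
      gcongr
      linarith
    · refine Asymptotics.IsBigO.of_bound M ?_
      refine Filter.eventually_inf_principal.mpr (Eventually.of_forall fun w hw ↦ ?_)
      refine (hgrowth w (abs_le.mpr ⟨hw.1.le, hw.2.le⟩)).trans ?_
      rw [Real.norm_of_nonneg (Real.exp_pos _).le]
      refine mul_le_mul_of_nonneg_left (Real.exp_le_exp.mpr ?_) hM
      calc B * |w.im| ≤ |B| * |w.im| := by gcongr; exact le_abs_self B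
        _ = |B| / c * (c * |w.im|) := by field_simp
        _ ≤ _ := by
          refine mul_le_mul_of_nonneg_left ?_ (by positivity)
          linarith [Real.add_one_le_exp (c * |w.im|)]
  · rw [← heven]
    exact hright _ (by simp [hw])

end EvenStrip

section StripInequality

open Complex NumberField InfinitePlace
open scoped Classical

variable (K : Type*) [Field K] [NumberField K]

/-- The comparison function for the completed zeta function on the strip
`1 / 2 - a ≤ Re s ≤ 1 / 2 + a`, with `z = s - 1 / 2`. -/
def stripComparison (a c : ℝ) (L : ℕ) (z : ℂ) : ℂ :=
  ((c : ℂ) ^ 2 - z ^ 2) * ∏ v : InfinitePlace K,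
    gammaRatioProd (v.mult * (a + 1 / 2) / 2) (a * v.mult) L (v.mult / 2 * z)

lemma stripComparison_neg (a c : ℝ) (L : ℕ) (z : ℂ) :
    stripComparison K a c L (-z) = stripComparison K a c L z := by
  simp only [stripComparison, mul_neg, gammaRatioProd_neg, neg_sq]

variable {a c : ℝ} {z : ℂ}

lemma sq_le_norm_sq_sub_sq (hac : a < c) (hz : |z.re| ≤ a) :
    (c - a) ^ 2 ≤ ‖(c : ℂ) ^ 2 - z ^ 2‖ := by
  obtain ⟨h1, h2⟩ := abs_le.mp hz
  rw [sq_sub_sq, norm_mul, sq]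
  have h3 : c - a ≤ ‖(c : ℂ) + z‖ := by
    refine le_trans ?_ (re_le_norm _)
    simp only [add_re, ofReal_re]; linarith
  have h4 : c - a ≤ ‖(c : ℂ) - z‖ := by
    refine le_trans ?_ (re_le_norm _)
    simp only [sub_re, ofReal_re]; linarith
  have : 0 ≤ c - a := by linarith
  gcongr

omit [NumberField K] in
lemma abs_re_mult_mul_le (v : InfinitePlace K) (hz : |z.re| ≤ a) :
    |(v.mult / 2 * z : ℂ).re| ≤ a * v.mult / 2 := by
  have : (v.mult / 2 * z : ℂ).re = v.mult / 2 * z.re := by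
    rw [show (v.mult / 2 * z : ℂ) = ((v.mult / 2 : ℝ) : ℂ) * z by push_cast; rfl, re_ofReal_mul]
  rw [this, abs_mul, abs_of_nonneg (by positivity)]
  calc (v.mult / 2 : ℝ) * |z.re| ≤ v.mult / 2 * a := by gcongr
    _ = _ := by ring

omit [NumberField K] in
lemma one_le_mult (v : InfinitePlace K) : (1 : ℝ) ≤ v.mult := by
  exact_mod_cast v.mult_pos

lemma stripComparison_ne_zero (ha : 0 < a) (hac : a < c) (L : ℕ) (hz : |z.re| ≤ a) :
    stripComparison K a c L z ≠ 0 := by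
  refine mul_ne_zero ?_ (Finset.prod_ne_zero_iff.mpr fun v _ ↦ ?_)
  · exact norm_pos_iff.mp ((pow_pos (sub_pos.mpr hac) 2).trans_le (sq_le_norm_sq_sub_sq hac hz))
  · have := one_le_mult K v
    exact gammaRatioProd_ne_zero (by positivity) (by positivity) L (abs_re_mult_mul_le K v hz)

lemma differentiableAt_stripComparison (ha : 0 < a) (L : ℕ) (hz : |z.re| ≤ a) :
    DifferentiableAt ℂ (stripComparison K a c L) z := by
  unfold stripComparison
  refine DifferentiableAt.mul (by fun_prop) (DifferentiableAt.fun_finsetProd fun v _ ↦ ?_)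
  have := one_le_mult K v
  exact DifferentiableAt.comp z (g := gammaRatioProd _ _ _) (differentiableAt_gammaRatioProd (by positivity) (by positivity) L
    (abs_re_mult_mul_le K v hz)) (by fun_prop)

lemma exists_norm_stripComparison_inv_le (ha : 1 / 2 ≤ a) (hac : a < c) (L : ℕ) :
    ∃ M B, 0 ≤ M ∧ ∀ z : ℂ, |z.re| ≤ a →
      ‖(stripComparison K a c L z)⁻¹‖ ≤ M * Real.exp (B * |z.im|) := by
  have hx (v : InfinitePlace K) : 1 / 2 ≤ (v.mult * (a + 1 / 2) / 2 : ℝ) := by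
    nlinarith [one_le_mult K v]
  have hh (v : InfinitePlace K) : 0 < a * v.mult := by
    have := one_le_mult K v
    positivity
  choose M hM0 hM using fun v : InfinitePlace K ↦ exists_norm_gammaRatioProd_inv_le (hx v) (hh v) L
  refine ⟨((c - a) ^ 2)⁻¹ * ∏ v, M v, ∑ v : InfinitePlace K, L * Real.pi * (v.mult / 2),
    mul_nonneg (by positivity) (Finset.prod_nonneg fun v _ ↦ hM0 v), fun z hz ↦ ?_⟩
  rw [stripComparison, mul_inv, norm_mul, ← Finset.prod_inv_distrib, norm_prod, mul_assoc,
    Finset.sum_mul, Real.exp_sum, ← Finset.prod_mul_distrib]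
  have h0 : 0 < (c - a) ^ 2 := pow_pos (sub_pos.mpr hac) 2
  refine mul_le_mul ?_ ?_ (Finset.prod_nonneg fun _ _ ↦ norm_nonneg _) (by positivity)
  · rw [norm_inv]
    exact inv_anti₀ h0 (sq_le_norm_sq_sub_sq hac hz)
  · refine Finset.prod_le_prod (fun _ _ ↦ norm_nonneg _) fun v _ ↦ ?_
    refine (hM v _ (abs_re_mult_mul_le K v hz)).trans_eq ?_
    rw [show (v.mult / 2 * z : ℂ) = ((v.mult / 2 : ℝ) : ℂ) * z by push_cast; rfl, im_ofReal_mul,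
      abs_mul, abs_of_nonneg (by positivity : (0 : ℝ) ≤ v.mult / 2)]
    ring_nf

lemma norm_archFactor_mul_norm_prod_le (ha : 0 < a) (L : ℕ) (t : ℝ) :
    ‖archFactor K ((a + 1 / 2 : ℝ) + t * I)‖ * ‖∏ v : InfinitePlace K,
      gammaRatioProd (v.mult * (a + 1 / 2) / 2) (a * v.mult) L (v.mult / 2 * a)‖ ≤
    ‖archFactor K (a + 1 / 2 : ℝ)‖ * ‖∏ v : InfinitePlace K,
      gammaRatioProd (v.mult * (a + 1 / 2) / 2) (a * v.mult) L (v.mult / 2 * (a + t * I))‖ := by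
  simp only [archFactor, norm_prod, ← Finset.prod_mul_distrib]
  refine Finset.prod_le_prod (fun _ _ ↦ by positivity) fun v _ ↦ ?_
  have hv := one_le_mult K v
  have hpi : 0 < Real.pi * v.mult := mul_pos Real.pi_pos (by positivity)
  have h := norm_Gamma_mul_norm_gammaRatioProd_le (x := v.mult * (a + 1 / 2) / 2)
    (h := a * v.mult) (by positivity) (by positivity) L (v.mult / 2 * t)
  rw [norm_mul, norm_mul, norm_cpow_eq_rpow_re_of_pos hpi, norm_cpow_eq_rpow_re_of_pos hpi]
  have e1 : (-(v.mult * ((a + 1 / 2 : ℝ) + t * I) / 2) : ℂ).re =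
      (-(v.mult * (a + 1 / 2 : ℝ) / 2) : ℂ).re := by
    rw [show (-(v.mult * ((a + 1 / 2 : ℝ) + t * I) / 2) : ℂ) =
        ((-(v.mult * (a + 1 / 2) / 2) : ℝ) : ℂ) + ((-(v.mult * t / 2) : ℝ) : ℂ) * I by
        push_cast; ring,
      show (-(v.mult * (a + 1 / 2 : ℝ) / 2) : ℂ) = ((-(v.mult * (a + 1 / 2) / 2) : ℝ) : ℂ) by
        push_cast; ring]
    simp
  rw [e1, mul_assoc, mul_assoc]
  refine mul_le_mul_of_nonneg_left ?_ (by positivity)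
  rwa [show ((a * v.mult / 2 : ℝ) : ℂ) = v.mult / 2 * a by push_cast; ring,
    show (v.mult / 2 * a : ℂ) + ((v.mult / 2 * t : ℝ) : ℂ) * I = v.mult / 2 * (a + t * I) by
      push_cast; ring,
    show ((v.mult * (a + 1 / 2) / 2 : ℝ) : ℂ) + ((v.mult / 2 * t : ℝ) : ℂ) * I =
      v.mult * ((a + 1 / 2 : ℝ) + t * I) / 2 by push_cast; ring,
    show ((v.mult * (a + 1 / 2) / 2 : ℝ) : ℂ) = v.mult * (a + 1 / 2 : ℝ) / 2 by push_cast; ring]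
    at h

lemma norm_quarter_sub_sq_le (hc : c ^ 2 = 2 * a ^ 2 - 1 / 4) (ha : 1 / 2 < a) (t : ℝ) :
    ‖(1 / 4 : ℂ) - (a + t * I) ^ 2‖ ≤ ‖(c : ℂ) ^ 2 - (a + t * I) ^ 2‖ := by
  have h1 : (1 / 4 : ℂ) - (a + t * I) ^ 2 = ⟨1 / 4 - a ^ 2 + t ^ 2, -(2 * a * t)⟩ := by
    apply Complex.ext <;> simp [pow_two] <;> ring
  have h2 : (c : ℂ) ^ 2 - (a + t * I) ^ 2 = ⟨c ^ 2 - a ^ 2 + t ^ 2, -(2 * a * t)⟩ := by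
    apply Complex.ext <;> simp [pow_two] <;> ring
  rw [h1, h2, ← sq_le_sq₀ (norm_nonneg _) (norm_nonneg _), Complex.sq_norm, Complex.sq_norm,
    normSq_mk, normSq_mk, hc]
  nlinarith [mul_nonneg (sq_nonneg t) (by nlinarith : 0 ≤ a ^ 2 - 1 / 4)]

theorem strip_inequality (L : ℕ) (ha : 1 / 2 < a) (ha' : a ≤ 3 / 2) (hc0 : 0 < c)
    (hc : c ^ 2 = 2 * a ^ 2 - 1 / 4) {r : ℝ} (hr : 1 / 2 < r) (hra : r ≤ a) :
    ((r ^ 2 - 1 / 4) * ‖archFactor K (r + 1 / 2 : ℝ)‖ / ‖stripComparison K a c L r‖) ^ 2 *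
      |(discr K : ℝ)| ^ r ≤
    ((a ^ 2 - 1 / 4) * ‖archFactor K (a + 1 / 2 : ℝ)‖ / ‖stripComparison K a c L a‖) ^ 2 *
      |(discr K : ℝ)| ^ a := by
  obtain ⟨F, W, hFd, hF1, ⟨C, hC⟩, hW0, hWmono, hFreal, hFle⟩ := exists_symmetric_zeta K
  have hac : a < c := by nlinarith
  have ha0 : 0 < a := by linarith
  have hD : 0 < |(discr K : ℝ)| := abs_pos.mpr (by exact_mod_cast discr_ne_zero K)
  set P := stripComparison K a c L with hP
  set Q : ℂ → ℂ := fun z ↦ F (z + 1 / 2) / P z ^ 2 with hQ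
  have hPne (z : ℂ) (hz : |z.re| ≤ a) : P z ≠ 0 := stripComparison_ne_zero K ha0 hac L hz
  have hnorm (x : ℝ) (hx : 1 / 2 < x) :
      ‖((x + 1 / 2 : ℝ) * (1 - (x + 1 / 2 : ℝ)) : ℂ)‖ = x ^ 2 - 1 / 4 := by
    rw [show ((x + 1 / 2 : ℝ) * (1 - (x + 1 / 2 : ℝ)) : ℂ) = ((1 / 4 - x ^ 2 : ℝ) : ℂ) by
      push_cast; ring, norm_real, Real.norm_eq_abs, abs_of_nonpos (by nlinarith)]
    ring
  have hQreal (x : ℝ) (hx : 1 / 2 < x) : ‖Q x‖ =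
      ((x ^ 2 - 1 / 4) * ‖archFactor K (x + 1 / 2 : ℝ)‖ / ‖P x‖) ^ 2 * W (x + 1 / 2) := by
    rw [hQ, norm_div, norm_pow, show (x + 1 / 2 : ℂ) = ((x + 1 / 2 : ℝ) : ℂ) by push_cast; rfl,
      hFreal _ (by linarith), hnorm x hx]
    ring
  have hline (t : ℝ) : ‖Q (a + t * I)‖ ≤ ‖Q a‖ := by
    have hz : |(a + t * I : ℂ).re| ≤ a := by simp [abs_of_pos ha0]
    have hPpos : 0 < ‖P (a + t * I)‖ := norm_pos_iff.mpr (hPne _ hz)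
    have hPpos' : 0 < ‖P a‖ := norm_pos_iff.mpr (hPne _ (by simp [abs_of_pos ha0]))
    rw [hQreal a ha, hQ, norm_div, norm_pow]
    have e1 : (a + t * I + 1 / 2 : ℂ) = (a + 1 / 2 : ℝ) + t * I := by push_cast; ring
    have e2 : ((a + 1 / 2 : ℝ) + t * I : ℂ).re = a + 1 / 2 := by simp
    have h := hFle ((a + 1 / 2 : ℝ) + t * I) (by rw [e2]; linarith)
    rw [e2, show (((a + 1 / 2 : ℝ) + t * I) * (1 - ((a + 1 / 2 : ℝ) + t * I)) : ℂ) =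
      1 / 4 - (a + t * I) ^ 2 by push_cast; ring] at h
    have hkey : ‖(1 / 4 : ℂ) - (a + t * I) ^ 2‖ * ‖archFactor K ((a + 1 / 2 : ℝ) + t * I)‖ *
        ‖P a‖ ≤ (a ^ 2 - 1 / 4) * ‖archFactor K (a + 1 / 2 : ℝ)‖ * ‖P (a + t * I)‖ := by
      have h1 := norm_archFactor_mul_norm_prod_le K ha0 L t
      have h2 := norm_quarter_sub_sq_le hc ha t
      have h3 : ‖(c : ℂ) ^ 2 - a ^ 2‖ = a ^ 2 - 1 / 4 := by
        rw [show (c : ℂ) ^ 2 - a ^ 2 = ((c ^ 2 - a ^ 2 : ℝ) : ℂ) by push_cast; rfl, norm_real, hc,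
          Real.norm_eq_abs, abs_of_nonneg (by nlinarith)]
        ring
      rw [hP, stripComparison, stripComparison, norm_mul, norm_mul, h3]
      have h4 := mul_le_mul h2 h1 (by positivity) (norm_nonneg _)
      have h5 := mul_le_mul_of_nonneg_left h4 (by nlinarith : 0 ≤ a ^ 2 - 1 / 4)
      calc _ = _ := ?_
        _ ≤ _ := h5
        _ = _ := ?_
      all_goals ring
    rw [e1]
    calc _ ≤ _ := div_le_div_of_nonneg_right h (by positivity)
      _ = (‖(1 / 4 : ℂ) - (a + t * I) ^ 2‖ * ‖archFactor K ((a + 1 / 2 : ℝ) + t * I)‖ /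
          ‖P (a + t * I)‖) ^ 2 * W (a + 1 / 2) := by ring
      _ ≤ _ := by
        refine mul_le_mul_of_nonneg_right ?_ (hW0 _ (by linarith)).le
        refine pow_le_pow_left₀ (by positivity) ?_ 2
        rwa [div_le_div_iff₀ hPpos hPpos']
  obtain ⟨M, B, hM0, hM⟩ := exists_norm_stripComparison_inv_le K ha.le hac L
  have hC0 : 0 ≤ C := by
    have := (norm_nonneg _).trans (hC 0 (by simp) (by simp))
    simpa using this
  have hbound : ‖Q r‖ ≤ ‖Q a‖ := by
    refine norm_le_of_even_strip (Q := Q) (M := C * 81 * M ^ 2) (B := 4 + 2 * B) ha0 (by positivity)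
      (fun z ↦ ?_) (fun z hz ↦ ?_) (fun z hz ↦ ?_) hline (by simpa [abs_of_pos, (by linarith : 0 < r)])
    · simp only [hQ]
      rw [hP, stripComparison_neg, ← hF1 (z + 1 / 2)]
      congr 2; ring
    · refine DifferentiableAt.div ?_ ?_ (pow_ne_zero _ (hPne z hz))
      · exact hFd.differentiableAt.comp z (by fun_prop)
      · exact (differentiableAt_stripComparison K ha0 L hz).pow 2
    · obtain ⟨h1, h2⟩ := abs_le.mp hz
      have hre : (z + 1 / 2 : ℂ).re = z.re + 1 / 2 := by simp
      have h3 := hC (z + 1 / 2) (by rw [hre]; linarith) (by rw [hre]; linarith)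
      have h4 : 1 + ‖z + 1 / 2‖ ≤ 3 * Real.exp |z.im| := by
        have h5 := norm_le_abs_re_add_abs_im (z + 1 / 2)
        have h6 : (z + 1 / 2 : ℂ).im = z.im := by simp
        rw [hre, h6] at h5
        have h7 : |z.re + 1 / 2| ≤ 2 := abs_le.mpr ⟨by linarith, by linarith⟩
        have := Real.add_one_le_exp |z.im|
        nlinarith [abs_nonneg z.im]
      have h8 := hM z hz
      simp only [hQ]
      rw [norm_div, div_eq_mul_inv, ← norm_inv, ← inv_pow, norm_pow]
      calc _ ≤ (C * (3 * Real.exp |z.im|) ^ 4) * (M * Real.exp (B * |z.im|)) ^ 2 := by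
            refine mul_le_mul (h3.trans ?_) (pow_le_pow_left₀ (norm_nonneg _) h8 2) (by positivity)
              (by positivity)
            gcongr
        _ = C * 81 * M ^ 2 * Real.exp ((4 + 2 * B) * |z.im|) := by
            rw [mul_pow, mul_pow, ← Real.exp_nat_mul, ← Real.exp_nat_mul,
              show (4 + 2 * B) * |z.im| = (4 : ℕ) * |z.im| + (2 : ℕ) * (B * |z.im|) by
                push_cast; ring, Real.exp_add]
            ring
  rw [hQreal r hr, hQreal a ha] at hbound
  have hmono := hWmono (r + 1 / 2) (a + 1 / 2) (by linarith) (by linarith)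
  set X := ((r ^ 2 - 1 / 4) * ‖archFactor K (r + 1 / 2 : ℝ)‖ / ‖P r‖) ^ 2
  set Y := ((a ^ 2 - 1 / 4) * ‖archFactor K (a + 1 / 2 : ℝ)‖ / ‖P a‖) ^ 2
  have hWa := hW0 (a + 1 / 2) (by linarith)
  have hWr : W (a + 1 / 2) * |(discr K : ℝ)| ^ r ≤ W (r + 1 / 2) * |(discr K : ℝ)| ^ a := by
    rw [Real.rpow_neg hD.le, Real.rpow_neg hD.le, inv_mul_eq_div, inv_mul_eq_div,
      div_le_div_iff₀ (by positivity) (by positivity), Real.rpow_add hD, Real.rpow_add hD] at hmono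
    have : 0 < |(discr K : ℝ)| ^ (1 / 2 : ℝ) := by positivity
    nlinarith
  refine le_of_mul_le_mul_right ?_ hWa
  calc X * |(discr K : ℝ)| ^ r * W (a + 1 / 2) = X * (W (a + 1 / 2) * |(discr K : ℝ)| ^ r) := by ring
    _ ≤ X * (W (r + 1 / 2) * |(discr K : ℝ)| ^ a) :=
        mul_le_mul_of_nonneg_left hWr (sq_nonneg _)
    _ = X * W (r + 1 / 2) * |(discr K : ℝ)| ^ a := by ring
    _ ≤ Y * W (a + 1 / 2) * |(discr K : ℝ)| ^ a :=
        mul_le_mul_of_nonneg_right hbound (by positivity)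
    _ = _ := by ring

end StripInequality

section LogGammaDerivative

/-- The derivative of `log Γ` on the positive real axis. -/
def realDigamma (x : ℝ) : ℝ := deriv (fun y ↦ Real.log (Real.Gamma y)) x

lemma hasDerivAt_log_Gamma {x : ℝ} (hx : 0 < x) :
    HasDerivAt (fun y ↦ Real.log (Real.Gamma y)) (realDigamma x) x :=
  ((Real.differentiableOn_Gamma_Ioi.differentiableAt (Ioi_mem_nhds hx)).log
    (Real.Gamma_pos_of_pos hx).ne').hasDerivAt

lemma HasDerivAt.log_Gamma {f : ℝ → ℝ} {f' x : ℝ} (hf : HasDerivAt f f' x) (hx : 0 < f x) :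
    HasDerivAt (fun y ↦ Real.log (Real.Gamma (f y))) (realDigamma (f x) * f') x :=
  (hasDerivAt_log_Gamma hx).comp x hf

lemma nonneg_of_hasDerivAt_of_le_left {f : ℝ → ℝ} {f' a b : ℝ} (hf : HasDerivAt f f' a)
    (hba : b < a) (h : ∀ r, b < r → r < a → f r ≤ f a) : 0 ≤ f' := by
  have h1 : Filter.Tendsto (slope f a) (nhdsWithin a (Set.Iio a)) (nhds f') :=
    (hasDerivAt_iff_tendsto_slope.mp hf).mono_left
      (nhdsWithin_mono _ fun r (hr : r < a) ↦ hr.ne)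
  refine ge_of_tendsto h1 ?_
  filter_upwards [Ioo_mem_nhdsLT hba] with r hr
  rw [slope_def_field]
  exact div_nonneg_of_nonpos (sub_nonpos.mpr (h r hr.1 hr.2)) (sub_nonpos.mpr hr.2.le)

/-- The second difference of the digamma function with step `h`, up to sign. -/
def digammaDiff (x h : ℝ) : ℝ := 2 * realDigamma (x + h) - realDigamma x - realDigamma (x + 2 * h)

lemma log_norm_Gamma_ofReal {x : ℝ} (hx : 0 < x) :
    Real.log ‖Complex.Gamma x‖ = Real.log (Real.Gamma x) := by
  rw [Complex.Gamma_ofReal, Complex.norm_real, Real.norm_of_nonneg (Real.Gamma_pos_of_pos hx).le]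

lemma log_norm_gammaRatio {x h r : ℝ} (hx : 0 < x) (hh : 0 < h) (hr : |r| ≤ h / 2) :
    Real.log ‖gammaRatio x h r‖ = Real.log (Real.Gamma (x + h / 2 + r)) +
      Real.log (Real.Gamma (x + h / 2 - r)) - (Real.log (Real.Gamma (x + 3 * h / 2 + r)) +
      Real.log (Real.Gamma (x + 3 * h / 2 - r))) := by
  obtain ⟨h1, h2⟩ := abs_le.mp hr
  have hne (y : ℝ) (hy : 0 < y) : ‖Complex.Gamma y‖ ≠ 0 :=
    norm_ne_zero_iff.mpr (Complex.Gamma_ne_zero_of_re_pos (by simpa using hy))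
  rw [gammaRatio]
  simp only [← Complex.ofReal_add, ← Complex.ofReal_sub]
  rw [norm_div, norm_mul, norm_mul, Real.log_div, Real.log_mul, Real.log_mul,
    log_norm_Gamma_ofReal, log_norm_Gamma_ofReal, log_norm_Gamma_ofReal, log_norm_Gamma_ofReal]
  all_goals first
    | linarith
    | exact hne _ (by linarith)
    | exact mul_ne_zero (hne _ (by linarith)) (hne _ (by linarith))

lemma log_norm_gammaRatioProd {x h r : ℝ} (hx : 0 < x) (hh : 0 < h) (L : ℕ) (hr : |r| ≤ h / 2) :
    Real.log ‖gammaRatioProd x h L r‖ = ∑ l ∈ Finset.range L,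
      (Real.log (Real.Gamma (x + 2 * h * l + h / 2 + r)) +
      Real.log (Real.Gamma (x + 2 * h * l + h / 2 - r)) -
      (Real.log (Real.Gamma (x + 2 * h * l + 3 * h / 2 + r)) +
      Real.log (Real.Gamma (x + 2 * h * l + 3 * h / 2 - r)))) := by
  rw [gammaRatioProd, norm_prod, Real.log_prod fun l _ ↦ norm_ne_zero_iff.mpr
    (gammaRatio_ne_zero (by positivity) hh (by simpa using hr))]
  exact Finset.sum_congr rfl fun l _ ↦ log_norm_gammaRatio (by positivity) hh hr

end LogGammaDerivative

section DiscriminantBound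

open NumberField InfinitePlace
open scoped Classical

variable (K : Type*) [Field K] [NumberField K]

lemma log_norm_archFactor {σ : ℝ} (hσ : 0 < σ) :
    Real.log ‖archFactor K σ‖ = ∑ v : InfinitePlace K,
      (-(v.mult * σ / 2) * Real.log (Real.pi * v.mult) +
        Real.log (Real.Gamma (v.mult * σ / 2))) := by
  have hm (v : InfinitePlace K) : (0 : ℝ) < v.mult := zero_lt_one.trans_le (one_le_mult K v)
  have hpi (v : InfinitePlace K) : 0 < Real.pi * v.mult := mul_pos Real.pi_pos (hm v)
  have hpos (v : InfinitePlace K) : 0 < v.mult * σ / 2 := by have := hm v; positivity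
  have hterm (v : InfinitePlace K) : ‖((Real.pi * v.mult : ℝ) : ℂ) ^ (-(v.mult * σ / 2) : ℂ) *
      Complex.Gamma (v.mult * σ / 2)‖ =
      (Real.pi * v.mult) ^ (-(v.mult * σ / 2)) * Real.Gamma (v.mult * σ / 2) := by
    rw [norm_mul, Complex.norm_cpow_eq_rpow_re_of_pos (hpi v),
      show (v.mult * σ / 2 : ℂ) = ((v.mult * σ / 2 : ℝ) : ℂ) by push_cast; rfl,
      Complex.Gamma_ofReal, Complex.norm_real,
      Real.norm_of_nonneg (Real.Gamma_pos_of_pos (hpos v)).le, ← Complex.ofReal_neg,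
      Complex.ofReal_re]
  rw [archFactor, norm_prod, Finset.prod_congr rfl fun v _ ↦ hterm v, Real.log_prod fun v _ ↦
    (mul_pos (Real.rpow_pos_of_pos (hpi v) _) (Real.Gamma_pos_of_pos (hpos v))).ne']
  refine Finset.sum_congr rfl fun v _ ↦ ?_
  rw [Real.log_mul (Real.rpow_pos_of_pos (hpi v) _).ne' (Real.Gamma_pos_of_pos (hpos v)).ne',
    Real.log_rpow (hpi v)]

lemma log_norm_stripComparison {a c r : ℝ} (hr0 : 0 < r) (hra : r ≤ a) (hac : a < c) (L : ℕ) :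
    Real.log ‖stripComparison K a c L r‖ = Real.log (c ^ 2 - r ^ 2) + ∑ v : InfinitePlace K,
      ∑ l ∈ Finset.range L,
      (Real.log (Real.Gamma (v.mult * (a + 1 / 2) / 2 + 2 * (a * v.mult) * l + a * v.mult / 2 +
        v.mult / 2 * r)) +
      Real.log (Real.Gamma (v.mult * (a + 1 / 2) / 2 + 2 * (a * v.mult) * l + a * v.mult / 2 -
        v.mult / 2 * r)) -
      (Real.log (Real.Gamma (v.mult * (a + 1 / 2) / 2 + 2 * (a * v.mult) * l +
        3 * (a * v.mult) / 2 + v.mult / 2 * r)) +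
      Real.log (Real.Gamma (v.mult * (a + 1 / 2) / 2 + 2 * (a * v.mult) * l +
        3 * (a * v.mult) / 2 - v.mult / 2 * r)))) := by
  have ha : 0 < a := hr0.trans_le hra
  have hm (v : InfinitePlace K) : (0 : ℝ) < v.mult := zero_lt_one.trans_le (one_le_mult K v)
  have hz (v : InfinitePlace K) : |v.mult / 2 * r| ≤ a * v.mult / 2 := by
    have := hm v
    rw [abs_of_pos (by positivity)]
    nlinarith
  have hcast (v : InfinitePlace K) : (v.mult / 2 * r : ℂ) = ((v.mult / 2 * r : ℝ) : ℂ) := by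
    push_cast; rfl
  have hne (v : InfinitePlace K) :
      ‖gammaRatioProd (v.mult * (a + 1 / 2) / 2) (a * v.mult) L (v.mult / 2 * r)‖ ≠ 0 := by
    have := hm v
    refine norm_ne_zero_iff.mpr (gammaRatioProd_ne_zero (by positivity) (by positivity) L ?_)
    rw [hcast, Complex.ofReal_re]
    exact hz v
  have h1 : 0 < c ^ 2 - r ^ 2 := by nlinarith
  rw [stripComparison, norm_mul, norm_prod,
    show (c : ℂ) ^ 2 - (r : ℂ) ^ 2 = ((c ^ 2 - r ^ 2 : ℝ) : ℂ) by push_cast; rfl,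
    Complex.norm_real, Real.norm_of_nonneg h1.le,
    Real.log_mul h1.ne' (Finset.prod_ne_zero_iff.mpr fun v _ ↦ hne v),
    Real.log_prod fun v _ ↦ hne v]
  congr 1
  refine Finset.sum_congr rfl fun v _ ↦ ?_
  have := hm v
  rw [hcast, log_norm_gammaRatioProd (by positivity) (by positivity) L (hz v)]

/-- A lower bound for the discriminant in terms of the digamma function. -/
theorem log_discr_ge_sum_digamma (L : ℕ) {a : ℝ} (ha : 1 / 2 < a) (ha' : a ≤ 3 / 2) :
    (∑ v : InfinitePlace K, (v.mult : ℝ) * (Real.log (Real.pi * v.mult) -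
      realDigamma (v.mult * (a + 1 / 2) / 2) + ∑ l ∈ Finset.range L,
        digammaDiff (v.mult * (a + 1 / 2) / 2 + 2 * (a * v.mult) * l) (a * v.mult))) -
      8 * a / (a ^ 2 - 1 / 4) ≤ Real.log |(discr K : ℝ)| := by
  set c : ℝ := √(2 * a ^ 2 - 1 / 4) with hcdef
  have hc : c ^ 2 = 2 * a ^ 2 - 1 / 4 := Real.sq_sqrt (by nlinarith)
  have hc0 : 0 < c := Real.sqrt_pos.mpr (by nlinarith)
  have hac : a < c := by nlinarith
  have ha0 : 0 < a := by linarith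
  have hD : 0 < |(discr K : ℝ)| := abs_pos.mpr (by exact_mod_cast discr_ne_zero K)
  have hm (v : InfinitePlace K) : (0 : ℝ) < v.mult := zero_lt_one.trans_le (one_le_mult K v)
  let Φ : ℝ → ℝ := fun r ↦ 2 * (Real.log (r ^ 2 - 1 / 4) + (∑ v : InfinitePlace K,
      (-(v.mult * (r + 1 / 2) / 2) * Real.log (Real.pi * v.mult) +
        Real.log (Real.Gamma (v.mult * (r + 1 / 2) / 2)))) - (Real.log (c ^ 2 - r ^ 2) +
      ∑ v : InfinitePlace K, ∑ l ∈ Finset.range L,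
      (Real.log (Real.Gamma (v.mult * (a + 1 / 2) / 2 + 2 * (a * v.mult) * l + a * v.mult / 2 +
        v.mult / 2 * r)) +
      Real.log (Real.Gamma (v.mult * (a + 1 / 2) / 2 + 2 * (a * v.mult) * l + a * v.mult / 2 -
        v.mult / 2 * r)) -
      (Real.log (Real.Gamma (v.mult * (a + 1 / 2) / 2 + 2 * (a * v.mult) * l +
        3 * (a * v.mult) / 2 + v.mult / 2 * r)) +
      Real.log (Real.Gamma (v.mult * (a + 1 / 2) / 2 + 2 * (a * v.mult) * l +
        3 * (a * v.mult) / 2 - v.mult / 2 * r)))))) + r * Real.log |(discr K : ℝ)|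
  have hΦ (r : ℝ) (hr : 1 / 2 < r) (hra : r ≤ a) : Φ r = Real.log
      (((r ^ 2 - 1 / 4) * ‖archFactor K (r + 1 / 2 : ℝ)‖ / ‖stripComparison K a c L r‖) ^ 2 *
      |(discr K : ℝ)| ^ r) := by
    have h1 : r ^ 2 - 1 / 4 ≠ 0 := by nlinarith
    have h2 : ‖archFactor K (r + 1 / 2 : ℝ)‖ ≠ 0 :=
      norm_ne_zero_iff.mpr (archFactor_ne_zero (by simp; linarith))
    have h3 : ‖stripComparison K a c L r‖ ≠ 0 := norm_ne_zero_iff.mpr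
      (stripComparison_ne_zero K ha0 hac L
        (by simpa [abs_of_pos (by linarith : 0 < r)] using hra))
    rw [Real.log_mul (pow_ne_zero _ (div_ne_zero (mul_ne_zero h1 h2) h3))
      (Real.rpow_pos_of_pos hD r).ne', Real.log_pow, Real.log_div (mul_ne_zero h1 h2) h3,
      Real.log_mul h1 h2, Real.log_rpow hD, log_norm_archFactor K (by linarith),
      log_norm_stripComparison K (by linarith) hra hac]
    push_cast
    rfl
  have hle (r : ℝ) (hr : 1 / 2 < r) (hra : r < a) : Φ r ≤ Φ a := by
    rw [hΦ r hr hra.le, hΦ a ha le_rfl]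
    refine Real.log_le_log ?_ (strip_inequality K L ha ha' hc0 hc hr hra.le)
    have h1 : 0 < r ^ 2 - 1 / 4 := by nlinarith
    have h2 : 0 < ‖archFactor K (r + 1 / 2 : ℝ)‖ :=
      norm_pos_iff.mpr (archFactor_ne_zero (by simp; linarith))
    have h3 : 0 < ‖stripComparison K a c L r‖ := norm_pos_iff.mpr
      (stripComparison_ne_zero K ha0 hac L
        (by simpa [abs_of_pos (by linarith : 0 < r)] using hra.le))
    positivity
  have hq : 0 < a ^ 2 - 1 / 4 := by nlinarith
  have hderiv : HasDerivAt Φ (2 * (2 * a / (a ^ 2 - 1 / 4) + (∑ v : InfinitePlace K,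
      (-(v.mult / 2) * Real.log (Real.pi * v.mult) +
        realDigamma (v.mult * (a + 1 / 2) / 2) * (v.mult / 2))) - (-(2 * a) / (c ^ 2 - a ^ 2) +
      ∑ v : InfinitePlace K, ∑ l ∈ Finset.range L, (v.mult / 2 : ℝ) *
        digammaDiff (v.mult * (a + 1 / 2) / 2 + 2 * (a * v.mult) * l) (a * v.mult))) +
      Real.log |(discr K : ℝ)|) a := by
    have hid := hasDerivAt_id' a
    have hsq : HasDerivAt (fun r : ℝ ↦ r ^ 2) (2 * a) a := by simpa using hasDerivAt_pow 2 a
    refine HasDerivAt.add (HasDerivAt.const_mul 2 (HasDerivAt.sub (HasDerivAt.add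
      ((hsq.sub_const _).log hq.ne') (HasDerivAt.fun_sum fun v _ ↦ HasDerivAt.add ?_ ?_))
      (HasDerivAt.add ?_ (HasDerivAt.fun_sum fun v _ ↦ HasDerivAt.fun_sum fun l _ ↦ ?_)))) ?_
    · have h := ((((hid.add_const (1 / 2)).const_mul (v.mult : ℝ)).div_const 2).neg).mul_const
        (Real.log (Real.pi * v.mult))
      simpa using h
    · have h := (((hid.add_const (1 / 2)).const_mul (v.mult : ℝ)).div_const 2).log_Gamma
        (by have := hm v; positivity)
      simpa using h
    · have h := (hsq.const_sub (c ^ 2)).log (by nlinarith)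
      simpa using h
    · have hv := hm v
      set x : ℝ := v.mult * (a + 1 / 2) / 2 + 2 * (a * v.mult) * l with hx
      have hxpos : 0 < x := by positivity
      have hah : 0 < a * v.mult := by positivity
      have hp (b : ℝ) (hb : 0 < b + v.mult / 2 * a) :=
        ((hid.const_mul (v.mult / 2 : ℝ)).const_add b).log_Gamma hb
      have hn (b : ℝ) (hb : 0 < b - v.mult / 2 * a) :=
        ((hid.const_mul (v.mult / 2 : ℝ)).const_sub b).log_Gamma hb
      have h := ((hp (x + a * v.mult / 2) (by positivity)).add
        (hn (x + a * v.mult / 2) (by linarith))).sub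
        ((hp (x + 3 * (a * v.mult) / 2) (by positivity)).add
        (hn (x + 3 * (a * v.mult) / 2) (by linarith)))
      refine h.congr_deriv ?_
      rw [show x + a * v.mult / 2 + v.mult / 2 * a = x + a * v.mult by ring,
        show x + a * v.mult / 2 - v.mult / 2 * a = x by ring,
        show x + 3 * (a * v.mult) / 2 + v.mult / 2 * a = x + 2 * (a * v.mult) by ring,
        show x + 3 * (a * v.mult) / 2 - v.mult / 2 * a = x + a * v.mult by ring, digammaDiff]
      ring
    · simpa using hid.mul_const (Real.log |(discr K : ℝ)|)
  have hfinal := nonneg_of_hasDerivAt_of_le_left hderiv ha hle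
  have hca : c ^ 2 - a ^ 2 = a ^ 2 - 1 / 4 := by rw [hc]; ring
  rw [hca] at hfinal
  have hsum : (∑ v : InfinitePlace K, (v.mult : ℝ) * (Real.log (Real.pi * v.mult) -
      realDigamma (v.mult * (a + 1 / 2) / 2) + ∑ l ∈ Finset.range L,
        digammaDiff (v.mult * (a + 1 / 2) / 2 + 2 * (a * v.mult) * l) (a * v.mult))) =
      -2 * ((∑ v : InfinitePlace K, (-(v.mult / 2) * Real.log (Real.pi * v.mult) +
        realDigamma (v.mult * (a + 1 / 2) / 2) * (v.mult / 2))) -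
      ∑ v : InfinitePlace K, ∑ l ∈ Finset.range L, (v.mult / 2 : ℝ) *
        digammaDiff (v.mult * (a + 1 / 2) / 2 + 2 * (a * v.mult) * l) (a * v.mult)) := by
    rw [← Finset.sum_sub_distrib, Finset.mul_sum]
    refine Finset.sum_congr rfl fun v _ ↦ ?_
    rw [← Finset.mul_sum]
    ring
  rw [hsum]
  have : 8 * a / (a ^ 2 - 1 / 4) = 4 * (2 * a / (a ^ 2 - 1 / 4)) := by ring
  rw [this]
  have : -(2 * a) / (a ^ 2 - 1 / 4) = -(2 * a / (a ^ 2 - 1 / 4)) := by ring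
  rw [this] at hfinal
  linarith

end DiscriminantBound

section DigammaBounds

lemma realDigamma_add_one {x : ℝ} (hx : 0 < x) : realDigamma (x + 1) = realDigamma x + 1 / x := by
  have h1 : HasDerivAt (fun y : ℝ ↦ Real.log (Real.Gamma (y + 1))) (realDigamma (x + 1)) x := by
    simpa using ((hasDerivAt_id' x).add_const 1).log_Gamma (by linarith)
  have h2 : HasDerivAt (fun y : ℝ ↦ Real.log (Real.Gamma y) + Real.log y)
      (realDigamma x + 1 / x) x := by
    simpa only [one_div] using (hasDerivAt_log_Gamma hx).fun_add (Real.hasDerivAt_log hx.ne')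
  refine (h1.congr_of_eventuallyEq ?_).unique h2
  filter_upwards [Ioi_mem_nhds hx] with y hy
  have hy' : (0 : ℝ) < y := hy
  rw [Real.Gamma_add_one hy'.ne', Real.log_mul hy'.ne' (Real.Gamma_pos_of_pos hy').ne', add_comm]

lemma log_Gamma_add_one_sub {x : ℝ} (hx : 0 < x) :
    slope (Real.log ∘ Real.Gamma) x (x + 1) = Real.log x := by
  rw [slope_def_field, Function.comp, Function.comp, Real.Gamma_add_one hx.ne',
    Real.log_mul hx.ne' (Real.Gamma_pos_of_pos hx).ne']
  simp

lemma realDigamma_le_log {x : ℝ} (hx : 0 < x) : realDigamma x ≤ Real.log x := by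
  rw [← log_Gamma_add_one_sub hx]
  exact Real.convexOn_log_Gamma.le_slope_of_hasDerivAt hx (Set.mem_Ioi.mpr (by linarith))
    (by linarith) (hasDerivAt_log_Gamma hx)

lemma log_le_realDigamma_add {x : ℝ} (hx : 0 < x) : Real.log x ≤ realDigamma x + 1 / x := by
  rw [← log_Gamma_add_one_sub hx, ← realDigamma_add_one hx]
  exact Real.convexOn_log_Gamma.slope_le_of_hasDerivAt hx (Set.mem_Ioi.mpr (by linarith))
    (by linarith) (hasDerivAt_log_Gamma (by linarith))

lemma realDigamma_add_nat {x : ℝ} (hx : 0 < x) (N : ℕ) :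
    realDigamma (x + N) = realDigamma x + ∑ j ∈ Finset.range N, 1 / (x + j) := by
  induction N with
  | zero => simp
  | succ N ih =>
    rw [Nat.cast_succ, ← add_assoc, realDigamma_add_one (by positivity), ih,
      Finset.sum_range_succ, add_assoc]

lemma neg_le_digammaDiff {x h : ℝ} (hx : 0 < x) (hh : 0 < h) : -(2 / x) ≤ digammaDiff x h := by
  have h1 := log_le_realDigamma_add (x := x + h) (by linarith)
  have h2 := realDigamma_le_log hx
  have h3 := realDigamma_le_log (x := x + 2 * h) (by linarith)
  have h4 : Real.log x + Real.log (x + 2 * h) ≤ 2 * Real.log (x + h) := by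
    rw [← Real.log_mul hx.ne' (by linarith), ← Real.log_rpow (by linarith)]
    refine Real.log_le_log (by positivity) ?_
    norm_num
    nlinarith
  have h5 : 1 / (x + h) ≤ 1 / x := by gcongr; linarith
  have h6 : 2 / x = 2 * (1 / x) := by ring
  rw [digammaDiff, h6]
  linarith

lemma digammaDiff_add_nat {x h : ℝ} (hx : 0 < x) (hh : 0 < h) (N : ℕ) :
    digammaDiff x h = ∑ j ∈ Finset.range N,
      2 * h ^ 2 / ((x + j) * (x + j + h) * (x + j + 2 * h)) + digammaDiff (x + N) h := by
  have hterm (j : ℕ) : 2 * h ^ 2 / ((x + j) * (x + j + h) * (x + j + 2 * h)) =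
      1 / (x + j) + 1 / (x + 2 * h + j) - 2 * (1 / (x + h + j)) := by
    rw [show x + 2 * h + j = x + j + 2 * h by ring, show x + h + j = x + j + h by ring]
    have : x + j ≠ 0 := by positivity
    have : x + j + h ≠ 0 := by positivity
    have : x + j + 2 * h ≠ 0 := by positivity
    field_simp
    ring
  simp only [digammaDiff, hterm]
  rw [Finset.sum_sub_distrib, Finset.sum_add_distrib, ← Finset.mul_sum,
    show x + N + h = x + h + N by ring, show x + N + 2 * h = x + 2 * h + N by ring,
    realDigamma_add_nat hx, realDigamma_add_nat (by positivity), realDigamma_add_nat (by positivity)]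
  ring

lemma digammaDiff_nonneg {x h : ℝ} (hx : 0 < x) (hh : 0 < h) : 0 ≤ digammaDiff x h := by
  have h1 : Filter.Tendsto (fun N : ℕ ↦ -(2 / (x + N))) Filter.atTop (nhds 0) := by
    simpa using (tendsto_const_nhds.div_atTop (Filter.tendsto_atTop_add_const_left _ x
      tendsto_natCast_atTop_atTop) : Filter.Tendsto (fun N : ℕ ↦ 2 / (x + N)) _ _).neg
  refine le_of_tendsto' h1 fun N ↦ (neg_le_digammaDiff (by positivity) hh).trans ?_
  rw [digammaDiff_add_nat hx hh N]
  exact le_add_of_nonneg_left (Finset.sum_nonneg fun j _ ↦ by positivity)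

lemma sum_le_digammaDiff {x h : ℝ} (hx : 0 < x) (hh : 0 < h) (N : ℕ) :
    ∑ j ∈ Finset.range N, 2 * h ^ 2 / ((x + j) * (x + j + h) * (x + j + 2 * h)) ≤
      digammaDiff x h := by
  rw [digammaDiff_add_nat hx hh N]
  linarith [digammaDiff_nonneg (x := x + N) (by positivity) hh]

end DigammaBounds

section DigammaNumerics

lemma natCast_mul_div_div_le (N d : ℕ) {E : ℕ} (hE : 0 < E) :
    ((N * E / d : ℕ) : ℝ) / E ≤ N / d := by
  have hE' : (0 : ℝ) < E := Nat.cast_pos.mpr hE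
  rw [div_le_iff₀ hE']
  refine Nat.cast_div_le.trans_eq ?_
  push_cast
  ring

/-- A rational lower bound, computed by truncated division, for
`log (x + J) - ψ x + ∑ l < L, digammaDiff (x + 2hl) h` where `x = X / q` and `h = H / q`. -/
def digammaFloor (q X H L J E : ℕ) : ℕ :=
  ∑ j ∈ Finset.range J, q * E / (X + q * j) + ∑ l ∈ Finset.range L, ∑ j ∈ Finset.range J,
    2 * H ^ 2 * q * E /
      ((X + 2 * H * l + q * j) * (X + 2 * H * l + q * j + H) * (X + 2 * H * l + q * j + 2 * H))

lemma digammaFloor_le {q X H E : ℕ} (hq : 0 < q) (hX : 0 < X) (hH : 0 < H) (hE : 0 < E)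
    (L J : ℕ) : (digammaFloor q X H L J E : ℝ) / E ≤ Real.log ((X / q : ℝ) + J) -
      realDigamma (X / q) + ∑ l ∈ Finset.range L, digammaDiff ((X / q : ℝ) + 2 * (H / q) * l) (H / q) := by
  have hq' : (0 : ℝ) < q := Nat.cast_pos.mpr hq
  have hX' : (0 : ℝ) < X := Nat.cast_pos.mpr hX
  have hH' : (0 : ℝ) < H := Nat.cast_pos.mpr hH
  rw [digammaFloor, Nat.cast_add, add_div, Nat.cast_sum, Nat.cast_sum, Finset.sum_div,
    Finset.sum_div]
  refine add_le_add ?_ (Finset.sum_le_sum fun l _ ↦ ?_)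
  · have h1 := realDigamma_le_log (x := (X / q : ℝ) + J) (by positivity)
    rw [realDigamma_add_nat (by positivity)] at h1
    refine le_trans (Finset.sum_le_sum fun j _ ↦ ?_) (le_sub_iff_add_le'.mpr h1)
    refine (natCast_mul_div_div_le q (X + q * j) hE).trans_eq ?_
    push_cast
    field_simp
  · refine le_trans ?_ (sum_le_digammaDiff (by positivity) (by positivity) J)
    rw [Nat.cast_sum, Finset.sum_div]
    refine Finset.sum_le_sum fun j _ ↦ (natCast_mul_div_div_le _ _ hE).trans_eq ?_
    push_cast
    field_simp

lemma digammaFloor_real : digammaFloor 2000 1010 1020 16 100 1000000 = 7528170 := by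
  decide +kernel

lemma digammaFloor_complex : digammaFloor 1000 1010 1020 16 100 1000000 = 5849369 := by
  decide +kernel

lemma log_le_of_le_exp_one_pow_mul {y f : ℝ} (n : ℕ) (hy : 0 < y) (hf : 0 ≤ f)
    (h : y ≤ 2.7182818283 ^ n * ∑ i ∈ Finset.range 6, f ^ i / i.factorial) :
    Real.log y ≤ n + f := by
  rw [Real.log_le_iff_le_exp hy, Real.exp_add]
  refine h.trans (mul_le_mul ?_ (Real.sum_le_exp_of_nonneg hf 6)
    (Finset.sum_nonneg fun i _ ↦ by positivity) (Real.exp_pos _).le)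
  rw [← mul_one (n : ℝ), Real.exp_nat_mul]
  exact pow_le_pow_left₀ (by norm_num) Real.exp_one_gt_d9.le n

lemma log_fifty_five_le : Real.log 55 + 0.00404 ≤ Real.log Real.pi - realDigamma (101 / 200) +
    ∑ l ∈ Finset.range 16, digammaDiff ((101 / 200 : ℝ) + 2 * (51 / 100) * l) (51 / 100) := by
  have h := digammaFloor_le (q := 2000) (X := 1010) (H := 1020) (E := 1000000) (by norm_num)
    (by norm_num) (by norm_num) (by norm_num) 16 100
  rw [digammaFloor_real] at h
  norm_num at h
  have h1 : Real.log (55 * (20101 / 200)) - Real.log Real.pi ≤ 7 + 0.5 := by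
    rw [← Real.log_div (by norm_num) Real.pi_pos.ne']
    refine log_le_of_le_exp_one_pow_mul 7 (by positivity) (by norm_num) ?_
    rw [div_le_iff₀ Real.pi_pos]
    norm_num [Finset.sum_range_succ, Nat.factorial]
    linarith [Real.pi_gt_d6]
  rw [Real.log_mul (by norm_num) (by norm_num)] at h1
  norm_num at h1 ⊢
  linarith

lemma log_twenty_one_le : Real.log 21 + 0.00404 ≤ Real.log (Real.pi * 2) -
    realDigamma (101 / 100) +
    ∑ l ∈ Finset.range 16, digammaDiff ((101 / 100 : ℝ) + 2 * (51 / 50) * l) (51 / 50) := by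
  have h := digammaFloor_le (q := 1000) (X := 1010) (H := 1020) (E := 1000000) (by norm_num)
    (by norm_num) (by norm_num) (by norm_num) 16 100
  rw [digammaFloor_complex] at h
  norm_num at h
  have h1 : Real.log (21 * (10101 / 100)) - Real.log (Real.pi * 2) ≤ 5 + 0.84 := by
    have hpi : 0 < Real.pi * 2 := by positivity
    rw [← Real.log_div (by norm_num) hpi.ne']
    refine log_le_of_le_exp_one_pow_mul 5 (by positivity) (by norm_num) ?_
    rw [div_le_iff₀ hpi]
    norm_num [Finset.sum_range_succ, Nat.factorial]
    linarith [Real.pi_gt_d6]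
  rw [Real.log_mul (by norm_num) (by norm_num)] at h1
  norm_num at h1 ⊢
  linarith

end DigammaNumerics

section Assembly

open InfinitePlace
open scoped Classical

variable (K : Type*) [Field K] [NumberField K]

lemma sum_mult_mul_ite (x y : ℝ) :
    ∑ v : InfinitePlace K, (v.mult : ℝ) * (if v.IsReal then x else y) =
      nrRealPlaces K * x + 2 * nrComplexPlaces K * y := by
  rw [← Fintype.sum_subtype_add_sum_subtype (fun v : InfinitePlace K ↦ v.IsReal)]
  have h1 : ∑ v : {v : InfinitePlace K // v.IsReal},
      (v.1.mult : ℝ) * (if v.1.IsReal then x else y) = nrRealPlaces K * x := by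
    rw [Finset.sum_congr rfl fun v _ ↦ by rw [if_pos v.2, mult_isReal v, Nat.cast_one, one_mul]]
    simp [nrRealPlaces]
  have h2 : ∑ v : {v : InfinitePlace K // ¬ v.IsReal},
      (v.1.mult : ℝ) * (if v.1.IsReal then x else y) = 2 * nrComplexPlaces K * y := by
    rw [Finset.sum_congr rfl fun v _ ↦ by
      rw [if_neg v.2, mult, if_neg v.2, Nat.cast_ofNat]]
    simp only [Finset.sum_const, Finset.card_univ, nsmul_eq_mul, nrComplexPlaces]
    rw [Fintype.card_congr (Equiv.subtypeEquivRight fun v ↦ not_isReal_iff_isComplex)]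
    ring
  rw [h1, h2]

lemma log_discr_ge (h : 100000 < finrank ℚ K) :
    nrRealPlaces K * Real.log 55 + 2 * nrComplexPlaces K * Real.log 21 ≤
      Real.log |(discr K : ℝ)| := by
  have hmain := log_discr_ge_sum_digamma K 16 (a := 51 / 100) (by norm_num) (by norm_num)
  have hterm (v : InfinitePlace K) :
      (v.mult : ℝ) * (if v.IsReal then Real.log 55 + 0.00404 else Real.log 21 + 0.00404) ≤
      (v.mult : ℝ) * (Real.log (Real.pi * v.mult) -
      realDigamma (v.mult * (51 / 100 + 1 / 2) / 2) + ∑ l ∈ Finset.range 16,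
        digammaDiff (v.mult * (51 / 100 + 1 / 2) / 2 + 2 * (51 / 100 * v.mult) * l)
          (51 / 100 * v.mult)) := by
    refine mul_le_mul_of_nonneg_left ?_ (Nat.cast_nonneg _)
    split_ifs with hv
    · refine log_fifty_five_le.trans_eq ?_
      rw [mult, if_pos hv]
      norm_num
    · refine log_twenty_one_le.trans_eq ?_
      rw [mult, if_neg hv]
      norm_num
  have hsum := Finset.sum_le_sum fun v (_ : v ∈ (Finset.univ : Finset (InfinitePlace K))) ↦ hterm v
  rw [sum_mult_mul_ite] at hsum
  have hn : (nrRealPlaces K + 2 * nrComplexPlaces K : ℝ) = finrank ℚ K := by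
    exact_mod_cast card_add_two_mul_card_eq_rank K
  have hn' : (100000 : ℝ) < finrank ℚ K := by exact_mod_cast h
  have hpole : (8 * (51 / 100) / ((51 / 100) ^ 2 - 1 / 4) : ℝ) ≤ 404 := by norm_num
  norm_num at hsum hpole hmain ⊢
  nlinarith

end Assembly

end

/-- Odlyzko's bound: if `[k:ℚ] > 10⁵`, then `D_k ≥ 55^{r₁} · 21^{2r₂}`. -/
theorem odlyzko_discr_bound (k : Type) [Field k] [NumberField k]
    (h : 100000 < Module.finrank ℚ k) :
    (55 : ℝ) ^ (NumberField.InfinitePlace.nrRealPlaces k) *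
      (21 : ℝ) ^ (2 * NumberField.InfinitePlace.nrComplexPlaces k) ≤
      |(NumberField.discr k : ℝ)| := by
  have hD : 0 < |(discr k : ℝ)| := abs_pos.mpr (by exact_mod_cast discr_ne_zero k)
  rw [← Real.log_le_log_iff (by positivity) hD, Real.log_mul (by positivity) (by positivity),
    Real.log_pow, Real.log_pow]
  push_cast
  exact log_discr_ge k h
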